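/- Existence of an extremal for the Gagliardo–Nirenberg–Sobolev inequality (Proposition 4.2): Let d ≥ 3, 0 < m < (d+2)/(d−2), and α = (d+2−(d−2)m)/(dm). Then there exists a function V in the admissible class 𝒞 that is compactly supported, not identically zero, radially symmetric (V(x) = φ(‖x‖) for some function φ), and radially nonincreasing (φ antitone), such that for every u ∈ 𝒞 with u not a.e. zero and ∫|∇u|² dx > 0, (∫u^{m+1} dx)^{(α+2)/(m+1)} / ((∫u dx)^α ∫|∇u|² dx) ≤ (∫V^{m+1} dx)^{(α+2)/(m+1)} / ((∫V dx)^α ∫|∇V|² dx); i.e. V attains the supremum C_* of the Gagliardo–Nirenberg–Sobolev quotient J(u) = ‖u‖_{m+1}^{α+2}/(‖u‖_1^α ‖∇u‖_2^2) over 𝒞. -/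

import Mathlib

open MeasureTheory Real

noncomputable section

namespace GNS

abbrev Eu (d : ℕ) := EuclideanSpace ℝ (Fin d)

/-- The squared difference quotient. -/
def dq {d : ℕ} (ε : ℝ) (u : Eu d → ℝ) (h x : Eu d) : ℝ := ((u (x + ε • h) - u x) / ε) ^ 2

/-- Nonlocal Dirichlet energy at scale `ε`. -/
def Den {d : ℕ} (ε : ℝ) (u : Eu d → ℝ) : ENNReal :=
  ∫⁻ h in Metric.ball (0 : Eu d) 1, ∫⁻ x, ENNReal.ofReal (dq ε u h x)

/-- Generalised Dirichlet energy. -/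
def Dir {d : ℕ} (u : Eu d → ℝ) : ENNReal := ⨆ (ε : ℝ) (_ : 0 < ε), Den ε u

lemma Den_le_Dir {d : ℕ} {ε : ℝ} (hε : 0 < ε) (u : Eu d → ℝ) : Den ε u ≤ Dir u :=
  le_iSup₂ (f := fun (ε : ℝ) (_ : 0 < ε) => Den ε u) ε hε

lemma Dir_le {d : ℕ} {u : Eu d → ℝ} {C : ENNReal} (h : ∀ ε : ℝ, 0 < ε → Den ε u ≤ C) :
    Dir u ≤ C := iSup₂_le h

lemma measurable_dq {d : ℕ} (ε : ℝ) {u : Eu d → ℝ} (hu : Measurable u) :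
    Measurable (fun p : Eu d × Eu d => dq ε u p.1 p.2) := by
  unfold dq
  fun_prop

lemma measurable_dq_right {d : ℕ} (ε : ℝ) {u : Eu d → ℝ} (hu : Measurable u) (h : Eu d) :
    Measurable (fun x : Eu d => dq ε u h x) := by
  unfold dq
  fun_prop

lemma measurable_dq_int {d : ℕ} (ε : ℝ) {u : Eu d → ℝ} (hu : Measurable u) :
    Measurable (fun h : Eu d => ∫⁻ x, ENNReal.ofReal (dq ε u h x)) :=
  Measurable.lintegral_prod_right' (f := fun p : Eu d × Eu d => ENNReal.ofReal (dq ε u p.1 p.2))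
    (measurable_dq ε hu).ennreal_ofReal

lemma Den_congr {d : ℕ} (ε : ℝ) {u v : Eu d → ℝ} (h : u =ᵐ[volume] v) : Den ε u = Den ε v := by
  unfold Den
  congr 1
  ext k
  apply lintegral_congr_ae
  have h2 : ∀ᵐ x : Eu d, u (x + ε • k) = v (x + ε • k) :=
    (measurePreserving_add_right volume (ε • k)).quasiMeasurePreserving.ae h
  filter_upwards [h, h2] with x h1 h2
  simp [dq, h1, h2]

lemma Dir_congr {d : ℕ} {u v : Eu d → ℝ} (h : u =ᵐ[volume] v) : Dir u = Dir v := by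
  unfold Dir
  simp_rw [Den_congr _ h]

lemma Den_half {d : ℕ} {ε : ℝ} (hε : 0 < ε) {u : Eu d → ℝ} (hu : Measurable u) :
    Den ε u ≤ Den (ε / 2) u := by
  unfold Den
  apply lintegral_mono
  intro h
  have key : ∀ x, ENNReal.ofReal (dq ε u h x) ≤
      2⁻¹ * ENNReal.ofReal (dq (ε/2) u h (x + (ε/2) • h)) + 2⁻¹ * ENNReal.ofReal (dq (ε/2) u h x) := by
    intro x
    have e1 : (2⁻¹ : ENNReal) = ENNReal.ofReal (2⁻¹) := by
      rw [ENNReal.ofReal_inv_of_pos (by norm_num)]; simp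
    rw [e1, ← ENNReal.ofReal_mul (by norm_num), ← ENNReal.ofReal_mul (by norm_num),
      ← ENNReal.ofReal_add (by unfold dq; positivity) (by unfold dq; positivity)]
    apply ENNReal.ofReal_le_ofReal
    unfold dq
    have e2 : x + (ε/2) • h + (ε/2) • h = x + ε • h := by
      rw [add_assoc, ← add_smul]; congr 2; ring
    rw [e2]
    generalize u (x + ε • h) = a
    generalize u (x + (ε/2) • h) = b
    generalize u x = c
    have : 2⁻¹ * ((a - b) / (ε / 2)) ^ 2 + 2⁻¹ * ((b - c) / (ε / 2)) ^ 2 - ((a - c) / ε) ^ 2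
      = ((a - 2 * b + c) / ε) ^ 2 := by field_simp; ring
    nlinarith [sq_nonneg ((a - 2 * b + c) / ε)]
  have hm := measurable_dq_right (ε/2) hu h
  calc ∫⁻ x, ENNReal.ofReal (dq ε u h x)
      ≤ ∫⁻ x, (2⁻¹ * ENNReal.ofReal (dq (ε/2) u h (x + (ε/2) • h))
          + 2⁻¹ * ENNReal.ofReal (dq (ε/2) u h x)) := lintegral_mono key
    _ = 2⁻¹ * (∫⁻ x, ENNReal.ofReal (dq (ε/2) u h (x + (ε/2) • h)))
          + 2⁻¹ * ∫⁻ x, ENNReal.ofReal (dq (ε/2) u h x) := by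
        rw [lintegral_add_right _ (by fun_prop), lintegral_const_mul _ (by fun_prop),
          lintegral_const_mul _ (by fun_prop)]
    _ = ∫⁻ x, ENNReal.ofReal (dq (ε/2) u h x) := by
        rw [lintegral_add_right_eq_self (fun x => ENNReal.ofReal (dq (ε/2) u h x))]
        rw [← add_mul, ENNReal.inv_two_add_inv_two, one_mul]

lemma Den_pow_half {d : ℕ} {ε : ℝ} (hε : 0 < ε) {u : Eu d → ℝ} (hu : Measurable u) (k : ℕ) :
    Den ε u ≤ Den (ε / 2 ^ k) u := by
  induction k with
  | zero => simp
  | succ n ih =>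
    refine ih.trans ((Den_half (by positivity) hu).trans (le_of_eq ?_))
    congr 1
    rw [pow_succ]; field_simp

lemma Den_lsc {d : ℕ} {ε : ℝ} {u : ℕ → Eu d → ℝ} (hu : ∀ n, Measurable (u n)) {v : Eu d → ℝ}
    {C : ENNReal} (hC : ∀ n, Den ε (u n) ≤ C)
    (hlim : ∀ᵐ x, Filter.Tendsto (fun n => u n x) Filter.atTop (nhds (v x))) :
    Den ε v ≤ C := by
  have step : ∀ h : Eu d, ∫⁻ x, ENNReal.ofReal (dq ε v h x) ≤
      Filter.liminf (fun n => ∫⁻ x, ENNReal.ofReal (dq ε (u n) h x)) Filter.atTop := by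
    intro h
    refine le_trans (le_of_eq ?_) (lintegral_liminf_le
      (fun n => (measurable_dq_right ε (hu n) h).ennreal_ofReal))
    apply lintegral_congr_ae
    have h2 : ∀ᵐ x : Eu d, Filter.Tendsto (fun n => u n (x + ε • h)) Filter.atTop
        (nhds (v (x + ε • h))) :=
      (measurePreserving_add_right volume (ε • h)).quasiMeasurePreserving.ae hlim
    filter_upwards [hlim, h2] with x h1 h2
    symm
    apply Filter.Tendsto.liminf_eq
    apply ENNReal.tendsto_ofReal
    unfold dq
    exact ((h2.sub h1).div_const _).pow 2
  calc Den ε v ≤ ∫⁻ h in Metric.ball (0 : Eu d) 1,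
        Filter.liminf (fun n => ∫⁻ x, ENNReal.ofReal (dq ε (u n) h x)) Filter.atTop :=
        lintegral_mono step
    _ ≤ Filter.liminf (fun n => Den ε (u n)) Filter.atTop :=
        lintegral_liminf_le (fun n => measurable_dq_int ε (hu n))
    _ ≤ C := by
        refine (Filter.liminf_le_liminf (Filter.Eventually.of_forall hC)).trans ?_
        simp

lemma Dir_lsc {d : ℕ} {u : ℕ → Eu d → ℝ} (hu : ∀ n, Measurable (u n)) {v : Eu d → ℝ}
    {C : ENNReal} (hC : ∀ n, Dir (u n) ≤ C)
    (hlim : ∀ᵐ x, Filter.Tendsto (fun n => u n x) Filter.atTop (nhds (v x))) :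
    Dir v ≤ C :=
  Dir_le fun _ hε => Den_lsc hu (fun n => (Den_le_Dir hε _).trans (hC n)) hlim

lemma Dir_comp_le {d : ℕ} {u : Eu d → ℝ} {g : ℝ → ℝ} (hg : ∀ a b, |g a - g b| ≤ |a - b|) :
    Dir (fun x => g (u x)) ≤ Dir u := by
  refine Dir_le fun ε hε => le_trans ?_ (Den_le_Dir hε u)
  unfold Den
  refine lintegral_mono fun h => lintegral_mono fun x => ENNReal.ofReal_le_ofReal ?_
  unfold dq
  rw [div_pow, div_pow]
  gcongr ?_ / _
  exact sq_le_sq.2 (hg _ _)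

lemma lintegral_comp_smul {d : ℕ} {s : ℝ} (hs : 0 < s) (f : Eu d → ENNReal) :
    ∫⁻ x, f (s • x) = ENNReal.ofReal ((s ^ d)⁻¹) * ∫⁻ x, f x := by
  have h1 := Measure.map_addHaar_smul (volume : Measure (Eu d)) hs.ne'
  have h2 : ∫⁻ x, f (s • x) = ∫⁻ x, f x ∂(Measure.map (s • ·) (volume : Measure (Eu d))) := by
    exact ((Homeomorph.smulOfNeZero s hs.ne').toMeasurableEquiv.measurableEmbedding.lintegral_map
      (f := f) (μ := volume)).symm
  rw [h2, h1, lintegral_smul_measure]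
  simp [abs_of_pos hs]

lemma Dir_scale {d : ℕ} {u : Eu d → ℝ} (l s : ℝ) (hs : 0 < s) :
    Dir (fun x => l * u (s • x)) ≤ ENNReal.ofReal (l ^ 2 * s ^ 2 * (s ^ d)⁻¹) * Dir u := by
  refine Dir_le fun ε hε => ?_
  refine le_trans ?_ (mul_le_mul_right (Den_le_Dir (mul_pos hs hε) u) _)
  unfold Den
  rw [← lintegral_const_mul' _ _ ENNReal.ofReal_ne_top]
  refine le_of_eq (lintegral_congr fun h => ?_)
  have : ∀ x, ENNReal.ofReal (dq ε (fun x => l * u (s • x)) h x) =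
      ENNReal.ofReal (l ^ 2 * s ^ 2) * ENNReal.ofReal (dq (s * ε) u h (s • x)) := by
    intro x
    rw [← ENNReal.ofReal_mul (by positivity)]
    congr 1
    unfold dq
    simp only [smul_add, smul_smul]
    field_simp
  simp_rw [this]
  rw [lintegral_const_mul' _ _ ENNReal.ofReal_ne_top,
    lintegral_comp_smul hs (fun x => ENNReal.ofReal (dq (s * ε) u h x)), ← mul_assoc,
    ← ENNReal.ofReal_mul (by positivity)]

end GNS

namespace GNS

def sd {d : ℕ} (e : Eu d) (t : ℝ) (x : Eu d) : ℝ := inner ℝ e x - t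
def sg {d : ℕ} (e : Eu d) (t : ℝ) (x : Eu d) : Eu d := x - (2 * sd e t x) • e
def pol {d : ℕ} (e : Eu d) (t : ℝ) (u : Eu d → ℝ) (x : Eu d) : ℝ :=
  if sd e t x ≤ 0 then max (u x) (u (sg e t x)) else min (u x) (u (sg e t x))


lemma sd_sg {d : ℕ} {e : Eu d} (he : ‖e‖ = 1) (t : ℝ) (x : Eu d) : sd e t (sg e t x) = - sd e t x := by
  unfold sg
  have : sd e t (x - (2 * sd e t x) • e) = sd e t x - 2 * sd e t x := by
    conv_lhs => unfold sd
    rw [inner_sub_right, inner_smul_right, real_inner_self_eq_norm_sq, he]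
    unfold sd; ring
  rw [this]; ring

lemma sg_sg {d : ℕ} {e : Eu d} (he : ‖e‖ = 1) (t : ℝ) (x : Eu d) : sg e t (sg e t x) = x := by
  have h : sg e t (sg e t x) = sg e t x - (2 * sd e t (sg e t x)) • e := rfl
  rw [h, sd_sg he]
  unfold sg
  module

lemma norm_sub_sg {d : ℕ} {e : Eu d} (he : ‖e‖ = 1) (t : ℝ) (x y : Eu d) : ‖x - sg e t y‖ ^ 2 = ‖x - y‖ ^ 2 + 4 * (sd e t x * sd e t y) := by
  have : x - sg e t y = (x - y) + (2 * sd e t y) • e := by unfold sg; abel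
  rw [this, norm_add_sq_real, norm_smul, inner_smul_right, he, real_inner_comm, inner_sub_right]
  have h1 : inner ℝ e x = sd e t x + t := by unfold sd; ring
  have h2 : inner ℝ e y = sd e t y + t := by unfold sd; ring
  rw [h1, h2, mul_pow, Real.norm_eq_abs, sq_abs]
  ring

lemma norm_sg_sub_sg {d : ℕ} {e : Eu d} (he : ‖e‖ = 1) (t : ℝ) (x y : Eu d) : ‖sg e t x - sg e t y‖ = ‖x - y‖ := by
  have h := norm_sub_sg he t (sg e t x) y
  rw [sd_sg he] at h
  have h2 := norm_sub_sg he t y x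
  rw [norm_sub_rev (sg e t x) y, h2, norm_sub_rev y x] at h
  have : ‖sg e t x - sg e t y‖ ^ 2 = ‖x - y‖ ^ 2 := by rw [h]; ring
  exact (pow_left_inj₀ (norm_nonneg _) (norm_nonneg _) two_ne_zero).1 this

lemma norm_sg_sub {d : ℕ} {e : Eu d} (he : ‖e‖ = 1) (t : ℝ) (x y : Eu d) : ‖sg e t x - y‖ = ‖x - sg e t y‖ := by
  rw [← norm_sg_sub_sg he t x (sg e t y), sg_sg he]

lemma continuous_sg {d : ℕ} {e : Eu d} (t : ℝ) : Continuous (sg e t) := by unfold sg sd; fun_prop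
lemma continuous_sd {d : ℕ} {e : Eu d} (t : ℝ) : Continuous (sd e t) := by unfold sd; fun_prop

lemma mp_sg {d : ℕ} {e : Eu d} (he : ‖e‖ = 1) (t : ℝ) : MeasurePreserving (sg e t) (volume : Measure (Eu d)) volume := by
  have h1 : MeasurePreserving (fun x : Eu d => (ℝ ∙ e)ᗮ.reflection x) volume volume :=
    LinearIsometryEquiv.measurePreserving _
  have h2 := (measurePreserving_add_right (volume : Measure (Eu d)) ((2 * t) • e)).comp h1
  convert h2 using 1
  ext1 x
  simp only [Function.comp]
  rw [Submodule.reflection_orthogonal_apply, Submodule.reflection_singleton_apply]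
  simp only [he, sg, sd]
  simp
  module

lemma measurable_pol {d : ℕ} {e : Eu d} (t : ℝ) {u : Eu d → ℝ} (hu : Measurable u) : Measurable (pol e t u) := by
  have h1 : Measurable (sg e t) := (continuous_sg t).measurable
  unfold pol
  refine Measurable.ite (measurableSet_le (continuous_sd t).measurable measurable_const) ?_ ?_
  · exact hu.max (hu.comp h1)
  · exact hu.min (hu.comp h1)

lemma sg_of_sd_zero {d : ℕ} {e : Eu d} (t : ℝ) {x : Eu d} (h : sd e t x = 0) : sg e t x = x := by unfold sg; simp [h]

lemma pol_sg {d : ℕ} {e : Eu d} (he : ‖e‖ = 1) (t : ℝ) (u : Eu d → ℝ) (x : Eu d) : pol e t u (sg e t x) =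
    if sd e t x ≤ 0 then min (u x) (u (sg e t x)) else max (u x) (u (sg e t x)) := by
  unfold pol
  rw [sd_sg he, sg_sg he]
  rcases lt_trichotomy (sd e t x) 0 with h | h | h
  · rw [if_neg (by linarith), if_pos h.le, min_comm]
  · rw [sg_of_sd_zero t h]; simp [h]
  · rw [if_pos (by linarith), if_neg (by linarith), max_comm]

lemma lintegral_sg {d : ℕ} {e : Eu d} (he : ‖e‖ = 1) (t : ℝ) (F : Eu d → ENNReal) (hF : Measurable F) :
    ∫⁻ x, F (sg e t x) = ∫⁻ x, F x := (mp_sg he t).lintegral_comp hF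

lemma lintegral_pair {d : ℕ} {e : Eu d} (he : ‖e‖ = 1) (t : ℝ) (F : Eu d → ENNReal) (hF : Measurable F) :
    ∫⁻ x, (F x + F (sg e t x)) = 2 * ∫⁻ x, F x := by
  rw [lintegral_add_left hF, lintegral_sg he t F hF, two_mul]

lemma lintegral_pol {d : ℕ} {e : Eu d} (he : ‖e‖ = 1) (t : ℝ) (F : ℝ → ENNReal) (hF : Measurable F) {u : Eu d → ℝ} (hu : Measurable u) :
    ∫⁻ x, F (pol e t u x) = ∫⁻ x, F (u x) := by
  have h1 := lintegral_pair he t (fun x => F (pol e t u x)) (hF.comp (measurable_pol t hu))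
  have h2 := lintegral_pair he t (fun x => F (u x)) (hF.comp hu)
  have h3 : ∀ x, F (pol e t u x) + F (pol e t u (sg e t x)) = F (u x) + F (u (sg e t x)) := by
    intro x
    rw [pol_sg he]
    unfold pol
    split_ifs
    · rcases le_total (u x) (u (sg e t x)) with h | h
      · rw [max_eq_right h, min_eq_left h, add_comm]
      · rw [max_eq_left h, min_eq_right h]
    · rcases le_total (u x) (u (sg e t x)) with h | h
      · rw [max_eq_right h, min_eq_left h]
      · rw [max_eq_left h, min_eq_right h, add_comm]
  simp_rw [h3] at h1
  rw [h1] at h2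
  exact (ENNReal.mul_right_inj (by norm_num) (by norm_num)).1 h2


lemma four_point {p p' q q' k1 k2 : ℝ} (h : k2 ≤ k1) :
    k1 * ((max q q' - max p p') ^ 2 + (min q q' - min p p') ^ 2)
     + k2 * ((max q q' - min p p') ^ 2 + (min q q' - max p p') ^ 2)
    ≤ k1 * ((q - p) ^ 2 + (q' - p') ^ 2) + k2 * ((q - p') ^ 2 + (q' - p) ^ 2) := by
  rcases le_total p p' with h1 | h1 <;> rcases le_total q q' with h2 | h2 <;>
  simp only [h1, h2, max_eq_left, max_eq_right, min_eq_left, min_eq_right]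
  · nlinarith
  · nlinarith [mul_nonneg (sub_nonneg.2 h) (mul_nonneg (sub_nonneg.2 h1) (sub_nonneg.2 h2))]
  · nlinarith [mul_nonneg (sub_nonneg.2 h) (mul_nonneg (sub_nonneg.2 h1) (sub_nonneg.2 h2))]
  · nlinarith

/-- interaction kernel -/
def kr {d : ℕ} (ε : ℝ) (x y : Eu d) : ℝ := if ‖x - y‖ < ε then 1 else 0

def gk {d : ℕ} (ε : ℝ) (u : Eu d → ℝ) (p : Eu d × Eu d) : ENNReal :=
  ENNReal.ofReal (kr ε p.1 p.2 * (u p.2 - u p.1) ^ 2)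

lemma kr_nonneg {d : ℕ} (ε : ℝ) (x y : Eu d) : 0 ≤ kr ε x y := by unfold kr; split_ifs <;> norm_num

lemma measurable_gk {d : ℕ} (ε : ℝ) {u : Eu d → ℝ} (hu : Measurable u) : Measurable (gk ε u) := by
  unfold gk
  have : Measurable (fun p : Eu d × Eu d => kr ε p.1 p.2) := by
    unfold kr
    exact Measurable.ite (measurableSet_lt (by fun_prop) measurable_const) measurable_const
      measurable_const
  fun_prop

lemma Den_eq {d : ℕ} {ε : ℝ} (hε : 0 < ε) {u : Eu d → ℝ} (hu : Measurable u) :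
    Den ε u = ENNReal.ofReal ((ε ^ 2)⁻¹ * (ε ^ d)⁻¹) * ∫⁻ x, ∫⁻ y, gk ε u (x, y) := by
  unfold Den
  rw [← lintegral_indicator Metric.isOpen_ball.measurableSet]
  have e1 : ∀ h : Eu d, (Metric.ball (0 : Eu d) 1).indicator
      (fun h => ∫⁻ x, ENNReal.ofReal (dq ε u h x)) h
      = ∫⁻ x, ENNReal.ofReal ((ε ^ 2)⁻¹) * gk ε u (x, x + ε • h) := by
    intro h
    by_cases hh : h ∈ Metric.ball (0 : Eu d) 1
    · rw [Set.indicator_of_mem hh]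
      refine lintegral_congr fun x => ?_
      unfold gk
      rw [← ENNReal.ofReal_mul (by positivity)]
      congr 1
      have : kr ε x (x + ε • h) = 1 := by
        unfold kr
        rw [if_pos]
        rw [sub_add_cancel_left, norm_neg, norm_smul, Real.norm_of_nonneg hε.le]
        rw [mem_ball_zero_iff] at hh
        nlinarith
      simp only [this, dq]
      field_simp
    · rw [Set.indicator_of_notMem hh]
      symm
      rw [lintegral_eq_zero_iff']
      · refine Filter.Eventually.of_forall fun x => ?_
        have : kr ε x (x + ε • h) = 0 := by
          unfold kr
          rw [if_neg]
          rw [sub_add_cancel_left, norm_neg, norm_smul, Real.norm_of_nonneg hε.le]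
          rw [mem_ball_zero_iff] at hh
          nlinarith
        simp [gk, this]
      · have := measurable_gk ε hu
        fun_prop
  simp_rw [e1]
  have hm := measurable_gk ε hu
  rw [lintegral_lintegral_swap (by fun_prop)]
  have e2 : ∀ x : Eu d, ∫⁻ h, ENNReal.ofReal ((ε ^ 2)⁻¹) * gk ε u (x, x + ε • h)
      = ENNReal.ofReal ((ε ^ 2)⁻¹ * (ε ^ d)⁻¹) * ∫⁻ y, gk ε u (x, y) := by
    intro x
    rw [lintegral_const_mul' _ _ ENNReal.ofReal_ne_top,
      lintegral_comp_smul hε (fun y => gk ε u (x, x + y)),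
      lintegral_add_left_eq_self (fun y => gk ε u (x, y)),
      ← mul_assoc, ← ENNReal.ofReal_mul (by positivity)]
  simp_rw [e2]
  rw [lintegral_const_mul' _ _ ENNReal.ofReal_ne_top]


lemma quad_sum {d : ℕ} {e : Eu d} (he : ‖e‖ = 1) (t : ℝ) (g : Eu d × Eu d → ENNReal) (hg : Measurable g) :
    ∫⁻ x, ∫⁻ y, ((g (x, y) + g (x, sg e t y)) + (g (sg e t x, y) + g (sg e t x, sg e t y)))
      = 4 * ∫⁻ x, ∫⁻ y, g (x, y) := by
  have hs : Measurable (sg e t) := (continuous_sg t).measurable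
  have e1 : ∀ x, ∫⁻ y, ((g (x, y) + g (x, sg e t y)) + (g (sg e t x, y) + g (sg e t x, sg e t y)))
      = 2 * ((∫⁻ y, g (x, y)) + ∫⁻ y, g (sg e t x, y)) := by
    intro x
    rw [lintegral_add_left (by fun_prop), lintegral_pair he t (fun y => g (x, y)) (by fun_prop),
      lintegral_pair he t (fun y => g (sg e t x, y)) (by fun_prop), mul_add]
  simp_rw [e1]
  have hm : Measurable fun x => ∫⁻ y, g (x, y) := hg.lintegral_prod_right'
  rw [lintegral_const_mul' _ _ (by norm_num),
    lintegral_pair he t (fun x => ∫⁻ y, g (x, y)) hm, ← mul_assoc]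
  norm_num

lemma gk_pol_le {d : ℕ} {e : Eu d} (he : ‖e‖ = 1) (t : ℝ) {ε : ℝ} (u : Eu d → ℝ) (x y : Eu d) :
    (gk ε (pol e t u) (x, y) + gk ε (pol e t u) (x, sg e t y)) +
      (gk ε (pol e t u) (sg e t x, y) + gk ε (pol e t u) (sg e t x, sg e t y))
    ≤ (gk ε u (x, y) + gk ε u (x, sg e t y)) + (gk ε u (sg e t x, y) + gk ε u (sg e t x, sg e t y)) := by
  have k1 : kr ε (sg e t x) (sg e t y) = kr ε x y := by unfold kr; rw [norm_sg_sub_sg he]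
  have k2 : kr ε (sg e t x) y = kr ε x (sg e t y) := by unfold kr; rw [norm_sg_sub he]
  have hn := norm_sub_sg he t x y
  have n1 := kr_nonneg ε x y
  have n2 := kr_nonneg ε x (sg e t y)
  unfold gk
  simp only [k1, k2]
  rw [← ENNReal.ofReal_add (by positivity) (by positivity),
    ← ENNReal.ofReal_add (by positivity) (by positivity),
    ← ENNReal.ofReal_add (by positivity) (by positivity),
    ← ENNReal.ofReal_add (by positivity) (by positivity),
    ← ENNReal.ofReal_add (by positivity) (by positivity),
    ← ENNReal.ofReal_add (by positivity) (by positivity)]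
  apply ENNReal.ofReal_le_ofReal
  rw [pol_sg he, pol_sg he]
  have hk : ∀ {a b : Eu d} {a' b' : Eu d}, ‖a - b‖ ^ 2 ≤ ‖a' - b'‖ ^ 2 → kr ε a' b' ≤ kr ε a b := by
    intro a b a' b' h
    have := (pow_le_pow_iff_left₀ (norm_nonneg _) (norm_nonneg _) two_ne_zero).1 h
    unfold kr
    split_ifs <;> linarith
  unfold pol
  by_cases hx : sd e t x ≤ 0 <;> by_cases hy : sd e t y ≤ 0 <;> simp only [hx, hy, if_true, if_false]
  · have := four_point (p := u x) (p' := u (sg e t x)) (q := u y) (q' := u (sg e t y))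
      (hk (a := x) (b := y) (a' := x) (b' := sg e t y) (by nlinarith))
    linarith
  · have := four_point (p := u x) (p' := u (sg e t x)) (q' := u y) (q := u (sg e t y))
      (hk (a' := x) (b' := y) (a := x) (b := sg e t y) (by nlinarith))
    rw [max_comm (u (sg e t y)), min_comm (u (sg e t y))] at this
    linarith
  · have := four_point (p := u x) (p' := u (sg e t x)) (q' := u y) (q := u (sg e t y))
      (hk (a' := x) (b' := y) (a := x) (b := sg e t y) (by nlinarith))
    rw [max_comm (u (sg e t y)), min_comm (u (sg e t y))] at this
    linarith
  · have := four_point (p := u x) (p' := u (sg e t x)) (q := u y) (q' := u (sg e t y))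
      (hk (a := x) (b := y) (a' := x) (b' := sg e t y) (by nlinarith))
    linarith

lemma Dir_pol_le {d : ℕ} {e : Eu d} (he : ‖e‖ = 1) (t : ℝ) {u : Eu d → ℝ} (hu : Measurable u) : Dir (pol e t u) ≤ Dir u := by
  refine Dir_le fun ε hε => le_trans ?_ (Den_le_Dir hε u)
  rw [Den_eq hε hu, Den_eq hε (measurable_pol t hu)]
  refine mul_le_mul_right ?_ _
  have h1 := quad_sum he t _ (measurable_gk ε hu)
  have h2 := quad_sum he t _ (measurable_gk ε (measurable_pol (e := e) t hu))
  have h3 := lintegral_mono (μ := (volume : Measure (Eu d))) fun x =>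
    lintegral_mono (μ := (volume : Measure (Eu d))) fun y => gk_pol_le he t (ε := ε) u x y
  rw [h1, h2] at h3
  exact (ENNReal.mul_le_mul_iff_right (by norm_num) (by norm_num)).1 h3

lemma pol_lipschitz {d : ℕ} {e : Eu d} (he : ‖e‖ = 1) (t : ℝ) {u : Eu d → ℝ} {L : ℝ} (hL : 0 ≤ L) (hu : ∀ x y, |u x - u y| ≤ L * ‖x - y‖) (x y : Eu d) :
    |pol e t u x - pol e t u y| ≤ L * ‖x - y‖ := by
  have a1 := hu x y
  have a2 := hu (sg e t x) (sg e t y)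
  have a3 := hu x (sg e t y)
  have a4 := hu (sg e t x) y
  rw [norm_sg_sub_sg he] at a2
  rw [norm_sg_sub he] at a4
  have hn := norm_sub_sg he t x y
  have hcross : sd e t x * sd e t y ≤ 0 → ‖x - sg e t y‖ ≤ ‖x - y‖ := by
    intro h
    apply (pow_le_pow_iff_left₀ (norm_nonneg _) (norm_nonneg _) two_ne_zero).1
    linarith
  unfold pol
  rw [abs_le] at *
  by_cases hx : sd e t x ≤ 0 <;> by_cases hy : sd e t y ≤ 0 <;> simp only [hx, hy, if_true, if_false]
  · constructor <;> rcases le_total (u x) (u (sg e t x)) with h | h <;>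
      rcases le_total (u y) (u (sg e t y)) with h' | h' <;>
      simp only [h, h', max_eq_left, max_eq_right] <;> linarith
  · have := mul_le_mul_of_nonneg_left (hcross (by nlinarith)) hL
    constructor <;> rcases le_total (u x) (u (sg e t x)) with h | h <;>
      rcases le_total (u y) (u (sg e t y)) with h' | h' <;>
      simp only [h, h', max_eq_left, max_eq_right, min_eq_left, min_eq_right] <;> linarith
  · have := mul_le_mul_of_nonneg_left (hcross (by nlinarith)) hL
    constructor <;> rcases le_total (u x) (u (sg e t x)) with h | h <;>
      rcases le_total (u y) (u (sg e t y)) with h' | h' <;>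
      simp only [h, h', max_eq_left, max_eq_right, min_eq_left, min_eq_right] <;> linarith
  · constructor <;> rcases le_total (u x) (u (sg e t x)) with h | h <;>
      rcases le_total (u y) (u (sg e t y)) with h' | h' <;>
      simp only [h, h', min_eq_left, min_eq_right] <;> linarith

lemma norm_le_norm_sg {d : ℕ} {e : Eu d} (he : ‖e‖ = 1) (t : ℝ) (ht : 0 ≤ t) {x : Eu d} (hx : sd e t x ≤ 0) : ‖x‖ ≤ ‖sg e t x‖ := by
  have h := norm_sub_sg he t 0 x
  simp only [zero_sub, norm_neg] at h
  have h0 : sd e t 0 = -t := by simp [sd]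
  rw [h0] at h
  apply (pow_le_pow_iff_left₀ (norm_nonneg _) (norm_nonneg _) two_ne_zero).1
  nlinarith

lemma pol_nonneg {d : ℕ} {e : Eu d} (t : ℝ) {u : Eu d → ℝ} (hu : ∀ x, 0 ≤ u x) (x : Eu d) : 0 ≤ pol e t u x := by
  unfold pol
  split_ifs
  · exact (hu x).trans (le_max_left _ _)
  · exact le_min (hu _) (hu _)

lemma pol_le {d : ℕ} {e : Eu d} (t : ℝ) {u : Eu d → ℝ} {M : ℝ} (hu : ∀ x, u x ≤ M) (x : Eu d) : pol e t u x ≤ M := by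
  unfold pol
  split_ifs
  · exact max_le (hu _) (hu _)
  · exact (min_le_left _ _).trans (hu _)

lemma pol_support {d : ℕ} {e : Eu d} (he : ‖e‖ = 1) (t : ℝ) (ht : 0 ≤ t) {u : Eu d → ℝ} (hu0 : ∀ x, 0 ≤ u x) {R : ℝ}
    (hu : ∀ x, R < ‖x‖ → u x = 0) (x : Eu d) (hx : R < ‖x‖) : pol e t u x = 0 := by
  unfold pol
  split_ifs with h
  · rw [hu x hx, hu _ (hx.trans_le (norm_le_norm_sg he t ht h)), max_self]
  · rw [hu x hx, min_eq_left (hu0 _)]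


end GNS

namespace GNS

structure Adm {d : ℕ} (L R M p : ℝ) (D a K : ENNReal) (v : Eu d → ℝ) : Prop where
  lip : ∀ x y, |v x - v y| ≤ L * ‖x - y‖
  nonneg : ∀ x, 0 ≤ v x
  le : ∀ x, v x ≤ M
  supp : ∀ x, R < ‖x‖ → v x = 0
  dir : Dir v ≤ D
  int : ∫⁻ x, ENNReal.ofReal (v x) ≤ a
  pw : K ≤ ∫⁻ x, ENNReal.ofReal (v x ^ p)

lemma cont_of_lip {d : ℕ} {L : ℝ} {v : Eu d → ℝ} (h : ∀ x y, |v x - v y| ≤ L * ‖x - y‖) :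
    Continuous v := by
  have : LipschitzWith (Real.toNNReal L) v := by
    apply LipschitzWith.of_dist_le_mul
    intro x y
    rw [Real.dist_eq, dist_eq_norm]
    refine (h x y).trans ?_
    gcongr
    exact Real.le_coe_toNNReal L
  exact this.continuous

lemma Adm.cont {d : ℕ} {L R M p : ℝ} {D a K : ENNReal} {v : Eu d → ℝ}
    (h : Adm L R M p D a K v) : Continuous v := cont_of_lip h.lip

lemma lip_limit {d : ℕ} {L M : ℝ} (hL : 0 ≤ L) {v : ℕ → Eu d → ℝ}
    (hlip : ∀ n x y, |v n x - v n y| ≤ L * ‖x - y‖) (h0 : ∀ n x, 0 ≤ v n x) (hM : ∀ n x, v n x ≤ M) :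
    ∃ (w : Eu d → ℝ) (φ : ℕ → ℕ), StrictMono φ ∧
      ∀ x, Filter.Tendsto (fun n => v (φ n) x) Filter.atTop (nhds (w x)) := by
  let q := TopologicalSpace.denseSeq (Eu d)
  have hc : IsCompact (Set.pi Set.univ (fun _ : ℕ => Set.Icc (0 : ℝ) M)) :=
    isCompact_univ_pi fun _ => isCompact_Icc
  obtain ⟨f, -, φ, hφ, hf⟩ := hc.tendsto_subseq (x := fun n k => v n (q k))
    (fun n => by intro k _; exact ⟨h0 n _, hM n _⟩)
  rw [tendsto_pi_nhds] at hf
  have hcau : ∀ x, CauchySeq (fun n => v (φ n) x) := by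
    intro x
    rw [Metric.cauchySeq_iff']
    intro η hη
    have hd := TopologicalSpace.denseRange_denseSeq (Eu d)
    obtain ⟨k, hk⟩ := Metric.denseRange_iff.1 hd x (η / (4 * (L + 1))) (by positivity)
    have hk2 : L * ‖x - q k‖ ≤ η / 4 := by
      rw [dist_eq_norm] at hk
      calc L * ‖x - q k‖ ≤ (L + 1) * (η / (4 * (L + 1))) := by
            gcongr; linarith
        _ = η / 4 := by field_simp
    obtain ⟨N, hN⟩ := Metric.cauchySeq_iff'.1 (hf k).cauchySeq (η / 2) (by positivity)
    refine ⟨N, fun n hn => ?_⟩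
    have h1 := hN n hn
    simp only [Function.comp, Real.dist_eq] at h1 ⊢
    have h2 := hlip (φ n) x (q k)
    have h3 := hlip (φ N) x (q k)
    rw [abs_lt] at *
    rw [abs_le] at h2 h3
    constructor <;> linarith
  choose w hw using fun x => cauchySeq_tendsto_of_complete (hcau x)
  exact ⟨w, φ, hφ, hw⟩

lemma lint_tendsto {d : ℕ} {R C : ℝ} {g : ℕ → Eu d → ℝ} {w : Eu d → ℝ}
    (hm : ∀ n, Measurable (g n)) (hb : ∀ n x, g n x ≤ C) (hs : ∀ n x, R < ‖x‖ → g n x = 0)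
    (hl : ∀ x, Filter.Tendsto (fun n => g n x) Filter.atTop (nhds (w x))) :
    Filter.Tendsto (fun n => ∫⁻ x, ENNReal.ofReal (g n x)) Filter.atTop
      (nhds (∫⁻ x, ENNReal.ofReal (w x))) := by
  apply tendsto_lintegral_of_dominated_convergence
    ((Metric.closedBall (0 : Eu d) R).indicator fun _ => ENNReal.ofReal C)
  · intro n; exact (hm n).ennreal_ofReal
  · intro n
    refine Filter.Eventually.of_forall fun x => ?_
    by_cases hx : x ∈ Metric.closedBall (0 : Eu d) R
    · rw [Set.indicator_of_mem hx]
      exact ENNReal.ofReal_le_ofReal (hb n x)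
    · simp only [Set.indicator_of_notMem hx]
      rw [mem_closedBall_zero_iff, not_le] at hx
      rw [hs n x hx]; simp
  · rw [lintegral_indicator Metric.isClosed_closedBall.measurableSet, setLIntegral_const]
    exact ENNReal.mul_ne_top ENNReal.ofReal_ne_top measure_closedBall_lt_top.ne
  · exact Filter.Eventually.of_forall fun x => ENNReal.tendsto_ofReal (hl x)

def mom {d : ℕ} (v : Eu d → ℝ) : ENNReal := ∫⁻ x, ENNReal.ofReal (v x * ‖x‖ ^ 2)

lemma Adm.pol {d : ℕ} {L R M p : ℝ} {D a K : ENNReal} {v : Eu d → ℝ} (hL : 0 ≤ L)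
    (h : Adm L R M p D a K v) {e : Eu d} (he : ‖e‖ = 1) {t : ℝ} (ht : 0 ≤ t) :
    Adm L R M p D a K (pol e t v) where
  lip := pol_lipschitz he t hL h.lip
  nonneg := pol_nonneg t h.nonneg
  le := pol_le t h.le
  supp := pol_support he t ht h.nonneg h.supp
  dir := (Dir_pol_le he t h.cont.measurable).trans h.dir
  int := by
    rw [lintegral_pol he t (fun r => ENNReal.ofReal r) (by fun_prop) h.cont.measurable]
    exact h.int
  pw := by
    rw [lintegral_pol he t (fun r => ENNReal.ofReal (r ^ p)) (by fun_prop) h.cont.measurable]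
    exact h.pw

lemma Adm.limit {d : ℕ} {L R M p : ℝ} (hp : 0 < p) {D a K : ENNReal} {v : ℕ → Eu d → ℝ} {w : Eu d → ℝ}
    (h : ∀ n, Adm L R M p D a K (v n))
    (hl : ∀ x, Filter.Tendsto (fun n => v n x) Filter.atTop (nhds (w x))) :
    Adm L R M p D a K w ∧ Filter.Tendsto (fun n => mom (v n)) Filter.atTop (nhds (mom w)) := by
  have hmeas : ∀ n, Measurable (v n) := fun n => (h n).cont.measurable
  constructor
  · constructor
    · intro x y
      exact le_of_tendsto ((hl x).sub (hl y)).abs (Filter.Eventually.of_forall fun n => (h n).lip x y)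
    · intro x
      exact ge_of_tendsto (hl x) (Filter.Eventually.of_forall fun n => (h n).nonneg x)
    · intro x
      exact le_of_tendsto (hl x) (Filter.Eventually.of_forall fun n => (h n).le x)
    · intro x hx
      refine tendsto_nhds_unique (hl x) ?_
      simp only [fun n => (h n).supp x hx]
      exact tendsto_const_nhds
    · exact Dir_lsc hmeas (fun n => (h n).dir) (Filter.Eventually.of_forall hl)
    · exact le_of_tendsto (lint_tendsto (R := R) (C := M) hmeas (fun n => (h n).le)
        (fun n => (h n).supp) hl) (Filter.Eventually.of_forall fun n => (h n).int)
    · refine ge_of_tendsto (lint_tendsto (R := R) (C := M ^ p) (g := fun n x => v n x ^ p)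
        (fun n => by have := hmeas n; fun_prop)
        (fun n x => Real.rpow_le_rpow ((h n).nonneg x) ((h n).le x) hp.le)
        (fun n x hx => by rw [(h n).supp x hx, Real.zero_rpow hp.ne'])
        (fun x => (hl x).rpow_const (Or.inr hp.le))) (Filter.Eventually.of_forall fun n => (h n).pw)
  · unfold mom
    refine lint_tendsto (R := R) (C := M * R ^ 2) (g := fun n x => v n x * ‖x‖ ^ 2)
        (fun n => by have := hmeas n; fun_prop)
        (fun n x => ?_)
        (fun n x hx => by rw [(h n).supp x hx, zero_mul])
        (fun x => (hl x).mul_const _)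
    have h0 := (h n).nonneg x
    have h1 := (h n).le x
    rcases le_or_gt ‖x‖ R with hx | hx
    · have : 0 ≤ ‖x‖ := norm_nonneg x
      gcongr
      linarith
    · rw [(h n).supp x hx, zero_mul]
      have : 0 ≤ M := by linarith
      positivity

lemma Adm.mom_ne_top {d : ℕ} {L R M p : ℝ} {D a K : ENNReal} {v : Eu d → ℝ}
    (h : Adm L R M p D a K v) : mom v ≠ ⊤ := by
  have hc : Continuous (fun x => v x * ‖x‖ ^ 2) := by have := h.cont; fun_prop
  have hs : HasCompactSupport (fun x => v x * ‖x‖ ^ 2) := by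
    apply HasCompactSupport.intro (isCompact_closedBall (0 : Eu d) R)
    intro x hx
    rw [mem_closedBall_zero_iff, not_le] at hx
    rw [h.supp x hx, zero_mul]
  have := (hc.integrable_of_hasCompactSupport (μ := volume) hs).lintegral_lt_top
  exact this.ne

lemma mom_pol_key {d : ℕ} {L R M p : ℝ} {D a K : ENNReal} {v : Eu d → ℝ} (hL : 0 ≤ L)
    (h : Adm L R M p D a K v) {e : Eu d} (he : ‖e‖ = 1) {t : ℝ} (ht : 0 < t)
    (hmin : mom v ≤ mom (GNS.pol e t v)) (x : Eu d) (hx : sd e t x < 0) : v (sg e t x) ≤ v x := by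
  by_contra hcon
  push Not at hcon
  have hP := h.pol hL he ht.le
  have hc := h.cont
  have hPc := hP.cont
  have hsg : Continuous (sg e t) := continuous_sg t
  have hn : ∀ x, ‖sg e t x‖ ^ 2 = ‖x‖ ^ 2 - 4 * t * sd e t x := by
    intro x
    have h := norm_sub_sg he t 0 x
    simp only [zero_sub, norm_neg] at h
    have h0 : sd e t 0 = -t := by simp [sd]
    rw [h, h0]; ring
  have e1 := lintegral_pair he t (fun x => ENNReal.ofReal (v x * ‖x‖ ^ 2)) (by fun_prop)
  have e2 := lintegral_pair he t (fun x => ENNReal.ofReal (GNS.pol e t v x * ‖x‖ ^ 2)) (by fun_prop)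
  have hle : ∀ x, ENNReal.ofReal (GNS.pol e t v x * ‖x‖ ^ 2) +
      ENNReal.ofReal (GNS.pol e t v (sg e t x) * ‖sg e t x‖ ^ 2) ≤
      ENNReal.ofReal (v x * ‖x‖ ^ 2) + ENNReal.ofReal (v (sg e t x) * ‖sg e t x‖ ^ 2) := by
    intro x
    have a1 := h.nonneg x
    have a2 := h.nonneg (sg e t x)
    have a3 := hP.nonneg x
    have a4 := hP.nonneg (sg e t x)
    rw [← ENNReal.ofReal_add (by positivity) (by positivity),
      ← ENNReal.ofReal_add (by positivity) (by positivity)]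
    apply ENNReal.ofReal_le_ofReal
    rw [pol_sg he, hn]
    unfold GNS.pol
    by_cases hx : sd e t x ≤ 0 <;> simp only [hx, if_true, if_false] <;>
      rcases le_total (v x) (v (sg e t x)) with hh | hh <;>
      simp only [hh, max_eq_left, max_eq_right, min_eq_left, min_eq_right]
    · nlinarith [mul_nonneg (mul_nonneg ht.le (sub_nonneg.2 hh)) (neg_nonneg.2 hx)]
    · exact le_rfl
    · exact le_rfl
    · nlinarith [mul_nonneg (mul_nonneg ht.le (sub_nonneg.2 hh)) (not_le.1 hx).le]
  have hae := ae_eq_of_ae_le_of_lintegral_le (μ := (volume : Measure (Eu d)))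
    (Filter.Eventually.of_forall hle)
    (by rw [e2]; exact ENNReal.mul_ne_top (by norm_num) hP.mom_ne_top)
    (by fun_prop)
    (by rw [e1, e2]; exact mul_le_mul_right hmin _)
  have hopen : IsOpen {x | sd e t x < 0 ∧ v x < v (sg e t x)} :=
    (isOpen_lt (continuous_sd t) continuous_const).inter (isOpen_lt hc (hc.comp hsg))
  have hpos := hopen.measure_pos volume ⟨x, hx, hcon⟩
  have : ∃ y ∈ {x | sd e t x < 0 ∧ v x < v (sg e t x)},
      ENNReal.ofReal (GNS.pol e t v y * ‖y‖ ^ 2) +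
      ENNReal.ofReal (GNS.pol e t v (sg e t y) * ‖sg e t y‖ ^ 2) =
      ENNReal.ofReal (v y * ‖y‖ ^ 2) + ENNReal.ofReal (v (sg e t y) * ‖sg e t y‖ ^ 2) := by
    by_contra hne
    push Not at hne
    have : {x | sd e t x < 0 ∧ v x < v (sg e t x)} ⊆ {y | ¬ (ENNReal.ofReal (GNS.pol e t v y * ‖y‖ ^ 2) +
      ENNReal.ofReal (GNS.pol e t v (sg e t y) * ‖sg e t y‖ ^ 2) =
      ENNReal.ofReal (v y * ‖y‖ ^ 2) + ENNReal.ofReal (v (sg e t y) * ‖sg e t y‖ ^ 2))} :=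
      fun y hy => hne y hy
    exact hpos.ne' (measure_mono_null this hae)
  obtain ⟨y, ⟨hy1, hy2⟩, hy3⟩ := this
  have a1 := h.nonneg y
  have a2 := h.nonneg (sg e t y)
  have a3 := hP.nonneg y
  have a4 := hP.nonneg (sg e t y)
  rw [← ENNReal.ofReal_add (by positivity) (by positivity),
      ← ENNReal.ofReal_add (by positivity) (by positivity),
      ENNReal.ofReal_eq_ofReal_iff (by positivity) (by positivity), pol_sg he, hn] at hy3
  unfold GNS.pol at hy3
  simp only [hy1.le, if_true, max_eq_right hy2.le, min_eq_left hy2.le] at hy3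
  nlinarith [mul_pos (mul_pos ht (sub_pos.2 hy2)) (neg_pos.2 hy1)]

theorem symm_exists {d : ℕ} {L R M p : ℝ} (hL : 0 ≤ L) (hp : 0 < p) {D a K : ENNReal} {v0 : Eu d → ℝ}
    (h0 : Adm L R M p D a K v0) :
    ∃ v : Eu d → ℝ, Adm L R M p D a K v ∧ ∀ x y, ‖x‖ < ‖y‖ → v y ≤ v x := by
  let S : Set ENNReal := mom '' {v : Eu d → ℝ | Adm L R M p D a K v}
  have hne : S.Nonempty := ⟨_, v0, h0, rfl⟩
  obtain ⟨s, -, hs, hsS⟩ := exists_seq_tendsto_sInf hne (OrderBot.bddBelow S)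
  choose v hv hvs using hsS
  obtain ⟨w, φ, hφ, hw⟩ := lip_limit hL (fun n => (hv n).lip) (fun n => (hv n).nonneg)
    (fun n => (hv n).le)
  obtain ⟨hA, hm⟩ := Adm.limit hp (fun n => hv (φ n)) hw
  have hmw : mom w = sInf S := by
    refine tendsto_nhds_unique hm ?_
    simp_rw [hvs]
    exact hs.comp hφ.tendsto_atTop
  refine ⟨w, hA, fun x y hxy => ?_⟩
  have hxy0 : 0 < ‖y - x‖ := by
    rw [norm_pos_iff, sub_ne_zero]
    rintro rfl
    exact lt_irrefl _ hxy
  set e : Eu d := ‖y - x‖⁻¹ • (y - x) with he_def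
  have he : ‖e‖ = 1 := by
    rw [he_def, norm_smul, norm_inv, norm_norm, inv_mul_cancel₀ hxy0.ne']
  set t : ℝ := (‖y‖ ^ 2 - ‖x‖ ^ 2) / (2 * ‖y - x‖) with ht_def
  have ht : 0 < t := by
    apply div_pos _ (by positivity)
    have := norm_nonneg x
    nlinarith
  have hsd : sd e t x = - ‖y - x‖ / 2 := by
    unfold sd
    rw [he_def, ht_def, real_inner_smul_left, inner_sub_left, real_inner_self_eq_norm_sq]
    have := norm_sub_sq_real y x
    field_simp
    nlinarith
  have hsg : sg e t x = y := by
    unfold sg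
    rw [hsd, he_def, smul_smul]
    have : 2 * (-‖y - x‖ / 2) * ‖y - x‖⁻¹ = -1 := by field_simp
    rw [this]; module
  have hmin : mom w ≤ mom (pol e t w) := by
    rw [hmw]
    exact sInf_le ⟨_, hA.pol hL he ht.le, rfl⟩
  have := mom_pol_key hL hA he ht hmin x (by rw [hsd]; linarith)
  rwa [hsg] at this

end GNS

namespace GNS

/-- Mollification. -/
def mo {d : ℕ} (ρ u : Eu d → ℝ) (x : Eu d) : ℝ := ∫ t, ρ t * u (x - t)

structure Moll {d : ℕ} (M L : ℝ) (ρ : Eu d → ℝ) : Prop where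
  nonneg : ∀ x, 0 ≤ ρ x
  le : ∀ x, ρ x ≤ M
  lip : ∀ x y, |ρ x - ρ y| ≤ L * ‖x - y‖
  supp : ∀ x, 1 < ‖x‖ → ρ x = 0
  cont : Continuous ρ
  integ : Integrable ρ
  one : ∫ x, ρ x = 1

lemma jensen_sq {X : Type*} [MeasurableSpace X] {P : Measure X} [IsProbabilityMeasure P] {w : X → ℝ}
    (hw : Integrable w P) : ENNReal.ofReal ((∫ t, w t ∂P) ^ 2) ≤ ∫⁻ t, ENNReal.ofReal (w t ^ 2) ∂P := by
  by_cases h2 : Integrable (fun t => w t ^ 2) P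
  · rw [← ofReal_integral_eq_lintegral_ofReal h2 (Filter.Eventually.of_forall fun t => sq_nonneg _)]
    apply ENNReal.ofReal_le_ofReal
    set c := ∫ t, w t ∂P with hc
    have h0 : 0 ≤ ∫ t, (w t - c) ^ 2 ∂P := integral_nonneg fun t => sq_nonneg _
    have h1 : ∫ t, (w t - c) ^ 2 ∂P = ∫ t, (w t ^ 2 - (2 * c) * w t + c ^ 2) ∂P := by
      congr 1; ext t; ring
    have i1 : Integrable (fun t => w t ^ 2 - (2 * c) * w t) P := h2.sub (hw.const_mul _)
    rw [h1, integral_add i1 (integrable_const _),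
      integral_sub h2 (hw.const_mul _), integral_const_mul, integral_const, ← hc] at h0
    simp at h0
    nlinarith
  · have : ∫⁻ t, ENNReal.ofReal (w t ^ 2) ∂P = ⊤ := by
      by_contra h
      apply h2
      refine ⟨hw.aestronglyMeasurable.pow 2, ?_⟩
      rw [hasFiniteIntegral_iff_ofReal (Filter.Eventually.of_forall fun t => sq_nonneg _)]
      exact lt_top_iff_ne_top.2 h
    rw [this]; exact le_top


def mP {d : ℕ} (ρ : Eu d → ℝ) : Measure (Eu d) := volume.withDensity (fun t => ENNReal.ofReal (ρ t))

lemma Moll.prob {d : ℕ} {M L : ℝ} {ρ : Eu d → ℝ} (h : Moll M L ρ) : IsProbabilityMeasure (mP ρ) := by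
  constructor
  unfold mP
  rw [withDensity_apply _ MeasurableSet.univ, Measure.restrict_univ,
    ← ofReal_integral_eq_lintegral_ofReal h.integ (Filter.Eventually.of_forall h.nonneg), h.one]
  simp

lemma Moll.mo_eq {d : ℕ} {M L : ℝ} {ρ u : Eu d → ℝ} (h : Moll M L ρ) (x : Eu d) :
    mo ρ u x = ∫ t, u (x - t) ∂(mP ρ) := by
  unfold mP mo
  rw [integral_withDensity_eq_integral_toReal_smul h.cont.measurable.ennreal_ofReal (by simp)]
  congr 1; ext t
  rw [ENNReal.toReal_ofReal (h.nonneg t)]; rfl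

lemma Moll.integrable_comp {d : ℕ} {M L : ℝ} {ρ u : Eu d → ℝ} (h : Moll M L ρ)
    (hi : Integrable u) (x : Eu d) : Integrable (fun t => u (x - t)) (mP ρ) := by
  unfold mP
  rw [integrable_withDensity_iff_integrable_smul' h.cont.measurable.ennreal_ofReal (by simp)]
  have : Integrable (fun t => u (x - t)) := hi.comp_sub_left x
  refine this.bdd_mul (c := M) (f := fun t => (ENNReal.ofReal (ρ t)).toReal)
    h.cont.measurable.ennreal_ofReal.ennreal_toReal.aestronglyMeasurable ?_
  refine Filter.Eventually.of_forall fun t => ?_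
  rw [ENNReal.toReal_ofReal (h.nonneg t), Real.norm_of_nonneg (h.nonneg t)]
  exact h.le t

lemma Moll.mo_eq' {d : ℕ} {ρ u : Eu d → ℝ} (x : Eu d) :
    mo ρ u x = ∫ t, ρ (x - t) * u t := by
  unfold mo
  rw [← integral_sub_left_eq_self (fun t => ρ t * u (x - t)) volume x]
  simp

lemma Moll.int2 {d : ℕ} {M L : ℝ} {ρ u : Eu d → ℝ} (h : Moll M L ρ)
    (hi : Integrable u) (x : Eu d) : Integrable (fun t => ρ (x - t) * u t) := by
  refine hi.bdd_mul (c := M) (f := fun t => ρ (x - t))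
    (h.cont.comp (by fun_prop)).measurable.aestronglyMeasurable ?_
  refine Filter.Eventually.of_forall fun t => ?_
  rw [Real.norm_of_nonneg (h.nonneg _)]
  exact h.le _

lemma Moll.mo_nonneg {d : ℕ} {M L : ℝ} {ρ u : Eu d → ℝ} (h : Moll M L ρ)
    (hu : ∀ x, 0 ≤ u x) (x : Eu d) : 0 ≤ mo ρ u x :=
  integral_nonneg fun t => mul_nonneg (h.nonneg t) (hu _)

lemma Moll.mo_le {d : ℕ} {M L : ℝ} {ρ u : Eu d → ℝ} (h : Moll M L ρ) (hi : Integrable u)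
    (hu : ∀ x, 0 ≤ u x) (x : Eu d) : mo ρ u x ≤ M * ∫ t, u t := by
  rw [Moll.mo_eq', ← integral_const_mul]
  apply integral_mono (h.int2 hi x) (hi.const_mul _)
  intro t
  exact mul_le_mul_of_nonneg_right (h.le _) (hu t)

lemma Moll.mo_lip {d : ℕ} {M L : ℝ} {ρ u : Eu d → ℝ} (h : Moll M L ρ) (hi : Integrable u)
    (hu : ∀ x, 0 ≤ u x) (x y : Eu d) : |mo ρ u x - mo ρ u y| ≤ (L * ∫ t, u t) * ‖x - y‖ := by
  rw [Moll.mo_eq', Moll.mo_eq', ← integral_sub (h.int2 hi x) (h.int2 hi y)]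
  have e : (L * ∫ t, u t) * ‖x - y‖ = ∫ t, (L * ‖x - y‖) * u t := by
    rw [integral_const_mul]; ring
  rw [e, ← Real.norm_eq_abs]
  apply norm_integral_le_of_norm_le (hi.const_mul _)
  refine Filter.Eventually.of_forall fun t => ?_
  rw [← sub_mul, norm_mul, Real.norm_of_nonneg (hu t), Real.norm_eq_abs]
  apply mul_le_mul_of_nonneg_right _ (hu t)
  have := h.lip (x - t) (y - t)
  simpa using this

lemma Moll.mo_far {d : ℕ} {M L : ℝ} {ρ u : Eu d → ℝ} (h : Moll M L ρ) (hi : Integrable u)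
    (hu : ∀ x, 0 ≤ u x) {δ : ℝ} (hδ : 0 < δ) : ∃ R : ℝ, ∀ x, R < ‖x‖ → mo ρ u x ≤ δ := by
  have ht := tendsto_setIntegral_of_antitone (f := u) (μ := (volume : Measure (Eu d)))
    (s := fun n : ℕ => {t : Eu d | (n : ℝ) < ‖t‖})
    (fun n => measurableSet_lt measurable_const measurable_norm)
    (fun a b hab t ht => lt_of_le_of_lt (show (a : ℝ) ≤ b by exact_mod_cast hab) (show (b : ℝ) < ‖t‖ from ht)) ⟨0, hi.integrableOn⟩
  have he : (⋂ n : ℕ, {t : Eu d | (n : ℝ) < ‖t‖}) = ∅ := by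
    ext t
    simp only [Set.mem_iInter, Set.mem_setOf_eq, Set.mem_empty_iff_false, iff_false, not_forall, not_lt]
    exact exists_nat_ge _
  rw [he] at ht
  simp only [Measure.restrict_empty, integral_zero_measure] at ht
  have hM : 0 ≤ M := (h.nonneg 0).trans (h.le 0)
  have ht2 := (ht.const_mul M)
  rw [mul_zero] at ht2
  obtain ⟨n, hn⟩ := (ht2.eventually_lt_const hδ).exists
  refine ⟨n + 1, fun x hx => ?_⟩
  rw [Moll.mo_eq']
  refine le_trans ?_ hn.le
  rw [← integral_indicator (measurableSet_lt measurable_const measurable_norm), ← integral_const_mul]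
  apply integral_mono (h.int2 hi x)
    ((hi.indicator (measurableSet_lt measurable_const measurable_norm)).const_mul _)
  intro t
  simp only [Set.indicator, Set.mem_setOf_eq]
  split_ifs with hc
  · exact mul_le_mul_of_nonneg_right (h.le _) (hu t)
  · have : ρ (x - t) = 0 := by
      apply h.supp
      have := norm_sub_norm_le x t
      linarith
    rw [this]; simp

lemma Moll.mo_lint {d : ℕ} {M L : ℝ} {ρ u : Eu d → ℝ} (h : Moll M L ρ) (hm : Measurable u) (hi : Integrable u)
    (hu : ∀ x, 0 ≤ u x) : ∫⁻ x, ENNReal.ofReal (mo ρ u x) = ∫⁻ x, ENNReal.ofReal (u x) := by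
  have := h.prob
  have e : ∀ x, ENNReal.ofReal (mo ρ u x) = ∫⁻ t, ENNReal.ofReal (u (x - t)) ∂(mP ρ) := fun x => by
    rw [h.mo_eq, ofReal_integral_eq_lintegral_ofReal (h.integrable_comp hi x)
      (Filter.Eventually.of_forall fun t => hu _)]
  simp_rw [e]
  rw [lintegral_lintegral_swap (by fun_prop)]
  simp_rw [lintegral_sub_right_eq_self (fun x => ENNReal.ofReal (u x))]
  simp

lemma Moll.Dir_mo {d : ℕ} {M L : ℝ} {ρ u : Eu d → ℝ} (h : Moll M L ρ) (hm : Measurable u) (hi : Integrable u) :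
    Dir (mo ρ u) ≤ Dir u := by
  have := h.prob
  refine Dir_le fun ε hε => le_trans ?_ (Den_le_Dir hε u)
  unfold Den
  refine lintegral_mono fun k => ?_
  have e : ∀ x, ENNReal.ofReal (dq ε (mo ρ u) k x) ≤ ∫⁻ t, ENNReal.ofReal (dq ε u k (x - t)) ∂(mP ρ) := fun x => by
    unfold dq
    rw [h.mo_eq, h.mo_eq, ← integral_sub (h.integrable_comp hi _) (h.integrable_comp hi _), ← integral_div]
    refine (jensen_sq (((h.integrable_comp hi _).sub (h.integrable_comp hi _)).div_const _)).trans (le_of_eq ?_)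
    congr 1; ext t
    simp only [Pi.sub_apply]
    rw [show x + ε • k - t = x - t + ε • k by abel]
  refine (lintegral_mono e).trans ?_
  have hmm := measurable_dq_right ε hm k
  rw [lintegral_lintegral_swap (by fun_prop)]
  simp_rw [lintegral_sub_right_eq_self (fun x => ENNReal.ofReal (dq ε u k x))]
  simp

lemma bump_moll {d : ℕ} (φ : ContDiffBump (0 : Eu d)) (h : φ.rOut ≤ 1) :
    ∃ M L, 0 ≤ L ∧ Moll M L (φ.normed volume) := by
  obtain ⟨M, hM⟩ := (φ.hasCompactSupport_normed (μ := volume)).exists_bound_of_continuous φ.continuous_normed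
  obtain ⟨L, hL⟩ := ContDiff.lipschitzWith_of_hasCompactSupport (𝕂 := ℝ) (n := 1) (φ.hasCompactSupport_normed (μ := volume))
    (φ.contDiff_normed (n := 1)) one_ne_zero
  refine ⟨M, L, L.2, ⟨φ.nonneg_normed, fun x => (le_abs_self _).trans (hM x), fun x y => ?_, fun x hx => ?_,
    φ.continuous_normed, φ.integrable_normed, φ.integral_normed⟩⟩
  · have := hL.dist_le_mul x y
    rwa [Real.dist_eq, dist_eq_norm] at this
  · have : x ∉ Function.support (φ.normed volume) := by
      rw [φ.support_normed_eq]; simp; linarith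
    simpa using this

theorem radial_exists {d : ℕ} {p : ℝ} (hp : 0 < p) {u : Eu d → ℝ} (hm : Measurable u) (hu : ∀ x, 0 ≤ u x)
    (hi : Integrable u) {K : ENNReal} (hK : K < ∫⁻ x, ENNReal.ofReal (u x ^ p)) :
    ∃ L R M, ∃ v : Eu d → ℝ, 0 ≤ L ∧ Adm L R M p (Dir u) (∫⁻ x, ENNReal.ofReal (u x)) K v ∧
      ∀ x y, ‖x‖ < ‖y‖ → v y ≤ v x := by
  let φ : ℕ → ContDiffBump (0 : Eu d) := fun n => ⟨1 / (2 * ((n : ℝ) + 1)), 1 / ((n : ℝ) + 1), by positivity, by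
    apply one_div_lt_one_div_of_lt (by positivity); linarith [(Nat.cast_nonneg n : (0:ℝ) ≤ n)]⟩
  have hφ1 : ∀ n, (φ n).rOut ≤ 1 := fun n => by
    change 1 / ((n : ℝ) + 1) ≤ 1
    rw [div_le_one (by positivity)]; linarith [(Nat.cast_nonneg n : (0:ℝ) ≤ n)]
  have hlim := ContDiffBump.ae_convolution_tendsto_right_of_locallyIntegrable (μ := (volume : Measure (Eu d)))
    (φ := φ) (l := Filter.atTop) (K := 2) (g := u)
    (by exact tendsto_one_div_add_atTop_nhds_zero_nat)
    (Filter.Eventually.of_forall fun n => by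
      change 1 / ((n : ℝ) + 1) ≤ 2 * (1 / (2 * ((n : ℝ) + 1)))
      apply le_of_eq; field_simp) hi.locallyIntegrable
  have hlim2 : ∀ᵐ x : Eu d, Filter.Tendsto (fun n => max (mo ((φ n).normed volume) u x - 1 / ((n : ℝ) + 1)) 0)
      Filter.atTop (nhds (u x)) := by
    filter_upwards [hlim] with x hx
    have h1 : Filter.Tendsto (fun n => mo ((φ n).normed volume) u x) Filter.atTop (nhds (u x)) := hx
    have h2 := (h1.sub tendsto_one_div_add_atTop_nhds_zero_nat).max (tendsto_const_nhds (x := (0:ℝ)))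
    simpa [max_eq_left (hu x)] using h2
  choose M L hL hMo using fun n => bump_moll (φ n) (hφ1 n)
  have hcont : ∀ n, Continuous (mo ((φ n).normed volume) u) := fun n =>
    cont_of_lip ((hMo n).mo_lip hi hu)
  have hfat : ∫⁻ x, ENNReal.ofReal (u x ^ p) ≤ Filter.liminf (fun n : ℕ => ∫⁻ x, ENNReal.ofReal
      ((max (mo ((φ n).normed volume) u x - 1 / ((n : ℝ) + 1)) 0) ^ p)) Filter.atTop := by
    refine le_trans (le_of_eq ?_) (lintegral_liminf_le fun n => ?_)
    · apply lintegral_congr_ae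
      filter_upwards [hlim2] with x hx
      symm
      apply Filter.Tendsto.liminf_eq
      apply ENNReal.tendsto_ofReal
      exact (Real.continuousAt_rpow_const _ _ (Or.inr hp.le)).tendsto.comp hx
    · have := (hcont n).measurable
      fun_prop
  obtain ⟨n, hn⟩ := (Filter.eventually_lt_of_lt_liminf (hK.trans_le hfat)).exists
  have hδ : (0:ℝ) < 1 / ((n : ℝ) + 1) := by positivity
  obtain ⟨R, hR⟩ := (hMo n).mo_far hi hu hδ
  have hM0 : 0 ≤ ∫ t, u t := integral_nonneg hu
  have hA : Adm (L n * ∫ t, u t) R (M n * ∫ t, u t) p (Dir u) (∫⁻ x, ENNReal.ofReal (u x)) K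
      (fun x => max (mo ((φ n).normed volume) u x - 1 / ((n : ℝ) + 1)) 0) := by
    refine ⟨fun x y => ?_, fun x => le_max_right _ _, fun x => ?_, fun x hx => ?_, ?_, ?_, hn.le⟩
    · refine le_trans ?_ ((hMo n).mo_lip hi hu x y)
      refine (abs_max_sub_max_le_abs _ _ _).trans (le_of_eq ?_)
      congr 1; ring
    · refine max_le ?_ ?_
      · linarith [(hMo n).mo_le hi hu x]
      · exact ((hMo n).mo_nonneg hu x).trans ((hMo n).mo_le hi hu x)
    · exact max_eq_right (by linarith [hR x hx])
    · refine le_trans ?_ ((hMo n).Dir_mo hm hi)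
      apply Dir_comp_le (g := fun s => max (s - 1 / ((n : ℝ) + 1)) 0)
      intro a b
      refine (abs_max_sub_max_le_abs _ _ _).trans (le_of_eq ?_)
      congr 1; ring
    · rw [← (hMo n).mo_lint hm hi hu]
      apply lintegral_mono
      intro x
      apply ENNReal.ofReal_le_ofReal
      refine max_le ?_ ((hMo n).mo_nonneg hu x)
      linarith
  obtain ⟨v, hv⟩ := symm_exists (mul_nonneg (hL n) hM0) hp hA
  exact ⟨_, _, _, v, mul_nonneg (hL n) hM0, hv⟩

end GNS

namespace GNS

lemma integrableOn_ball {d : ℕ} {g : Eu d → ℝ} (hg : Continuous g) :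
    IntegrableOn g (Metric.ball (0 : Eu d) 1) :=
  (hg.continuousOn.integrableOn_compact (isCompact_closedBall (0 : Eu d) 1)).mono_set
    Metric.ball_subset_closedBall

/-- second moment constant -/
def kap (d : ℕ) : ℝ := (∫ h in Metric.ball (0 : Eu d) 1, ‖h‖ ^ 2) / d

lemma ball_inner_congr {d : ℕ} {v w : Eu d} (h : ‖v‖ = ‖w‖) :
    ∫ k in Metric.ball (0 : Eu d) 1, (inner ℝ v k) ^ 2 = ∫ k in Metric.ball (0 : Eu d) 1, (inner ℝ w k) ^ 2 := by
  set T := (Submodule.span ℝ {v - w})ᗮ.reflection with hT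
  have hTv : T v = w := Submodule.reflection_sub h
  have hpre : T ⁻¹' (Metric.ball (0 : Eu d) 1) = Metric.ball (0 : Eu d) 1 := by
    ext x; simp
  have := T.measurePreserving.setIntegral_preimage_emb T.toHomeomorph.measurableEmbedding
    (fun k => (inner ℝ w k : ℝ) ^ 2) (Metric.ball (0 : Eu d) 1)
  rw [hpre] at this
  rw [← this]
  congr 1; ext k
  rw [← hTv, T.inner_map_map]

lemma ball_inner {d : ℕ} (hd : 0 < d) (v : Eu d) :
    ∫ k in Metric.ball (0 : Eu d) 1, (inner ℝ v k) ^ 2 = kap d * ‖v‖ ^ 2 := by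
  have h1 : ∀ i : Fin d, ∫ k in Metric.ball (0 : Eu d) 1, (inner ℝ v k) ^ 2
      = ‖v‖ ^ 2 * ∫ k in Metric.ball (0 : Eu d) 1, (k i) ^ 2 := by
    intro i
    rw [ball_inner_congr (w := ‖v‖ • EuclideanSpace.single i (1:ℝ)) (by simp [norm_smul]), ← integral_const_mul]
    congr 1; ext k
    rw [inner_smul_left, EuclideanSpace.inner_single_left]
    simp [mul_pow]
  have h2 : ∫ h in Metric.ball (0 : Eu d) 1, ‖h‖ ^ 2 = ∑ i : Fin d, ∫ k in Metric.ball (0 : Eu d) 1, (k i) ^ 2 := by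
    rw [← integral_finsetSum]
    · congr 1; ext k; exact EuclideanSpace.real_norm_sq_eq k
    · intro i _
      exact integrableOn_ball (by fun_prop)
  have h3 : ∑ i : Fin d, ∫ k in Metric.ball (0 : Eu d) 1, (inner ℝ v k) ^ 2
      = ‖v‖ ^ 2 * ∫ h in Metric.ball (0 : Eu d) 1, ‖h‖ ^ 2 := by
    rw [h2, Finset.mul_sum]
    exact Finset.sum_congr rfl fun i _ => h1 i
  simp at h3
  unfold kap
  have : (d:ℝ) ≠ 0 := by positivity
  field_simp
  linarith

lemma ball_norm {d : ℕ} (hd : 0 < d) : ∫ h in Metric.ball (0 : Eu d) 1, ‖h‖ ^ 2 = d * kap d := by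
  unfold kap
  have : (d:ℝ) ≠ 0 := by positivity
  field_simp

lemma kap_pos {d : ℕ} (hd : 0 < d) : 0 < kap d := by
  unfold kap
  apply div_pos _ (by positivity)
  rw [setIntegral_pos_iff_support_of_nonneg_ae]
  · have : Function.support (fun h : Eu d => ‖h‖ ^ 2) = {0}ᶜ := by
      ext x; simp
    rw [this]
    have hne : Nonempty (Fin d) := ⟨⟨0, hd⟩⟩
    apply IsOpen.measure_pos
    · exact isOpen_compl_singleton.inter Metric.isOpen_ball
    · refine ⟨EuclideanSpace.single ⟨0, hd⟩ (1/2:ℝ), ?_, ?_⟩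
      · intro h
        have := congrArg (fun y : Eu d => ‖y‖) (Set.mem_singleton_iff.1 h)
        simp at this
      · simp; norm_num
  · exact Filter.Eventually.of_forall fun x => by positivity
  · exact integrableOn_ball (by fun_prop)

lemma ball_inner_lint {d : ℕ} (hd : 0 < d) (v : Eu d) :
    ∫⁻ k in Metric.ball (0 : Eu d) 1, ENNReal.ofReal ((inner ℝ v k) ^ 2) = ENNReal.ofReal (kap d * ‖v‖ ^ 2) := by
  rw [← ball_inner hd, ofReal_integral_eq_lintegral_ofReal]
  · exact integrableOn_ball (by fun_prop)
  · exact Filter.Eventually.of_forall fun x => by positivity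

lemma gradient_cont {d : ℕ} {u : Eu d → ℝ} (hu : ContDiff ℝ 1 u) : Continuous (gradient u) := by
  unfold gradient
  exact (LinearIsometryEquiv.continuous _).comp (hu.continuous_fderiv one_ne_zero)

lemma line_deriv {d : ℕ} {u : Eu d → ℝ} (hu : ContDiff ℝ 1 u) (x h : Eu d) (s : ℝ) :
    HasDerivAt (fun s : ℝ => u (x + s • h)) (inner ℝ (gradient u (x + s • h)) h) s := by
  rw [inner_gradient_left]
  have h1 : HasFDerivAt u (fderiv ℝ u (x + s • h)) (x + s • h) :=
    (hu.differentiable one_ne_zero).differentiableAt.hasFDerivAt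
  have h2 : HasDerivAt (fun s : ℝ => x + s • h) h s := by
    simpa using ((hasDerivAt_id s).smul_const h).const_add x
  exact h1.comp_hasDerivAt s h2

/-- Dirichlet energy of a `C¹` function is at most the classical one. -/
lemma Dir_le_grad {d : ℕ} (hd : 0 < d) {u : Eu d → ℝ} (hu : ContDiff ℝ 1 u) :
    Dir u ≤ ∫⁻ x, ENNReal.ofReal (kap d * ‖gradient u x‖ ^ 2) := by
  have hg := gradient_cont hu
  have hP : IsProbabilityMeasure (volume.restrict (Set.Ioc (0:ℝ) 1)) := ⟨by simp⟩
  refine Dir_le fun ε hε => ?_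
  have key : ∀ h x : Eu d, ENNReal.ofReal (dq ε u h x) ≤
      ∫⁻ s in Set.Ioc (0:ℝ) 1, ENNReal.ofReal ((inner ℝ (gradient u (x + s • (ε • h))) h) ^ 2) := by
    intro h x
    have hc : Continuous (fun s : ℝ => (inner ℝ (gradient u (x + s • (ε • h))) (ε • h) : ℝ)) := by
      have : Continuous (fun s : ℝ => gradient u (x + s • (ε • h))) := hg.comp (by fun_prop)
      fun_prop
    have e1 := intervalIntegral.integral_eq_sub_of_hasDerivAt (a := 0) (b := 1)
      (fun s _ => line_deriv hu x (ε • h) s) (hc.intervalIntegrable _ _)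
    have e2 : (u (x + ε • h) - u x) / ε = ∫ s in Set.Ioc (0:ℝ) 1, (inner ℝ (gradient u (x + s • (ε • h))) h : ℝ) := by
      rw [intervalIntegral.integral_of_le zero_le_one] at e1
      simp only [inner_smul_right, integral_const_mul, one_smul, zero_smul, add_zero] at e1
      rw [← e1]
      field_simp
    unfold dq
    rw [e2]
    apply jensen_sq
    have hc2 : Continuous (fun s : ℝ => (inner ℝ (gradient u (x + s • (ε • h))) (h) : ℝ)) := by
      have : Continuous (fun s : ℝ => gradient u (x + s • (ε • h))) := hg.comp (by fun_prop)
      fun_prop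
    exact (hc2.integrableOn_Icc).mono_set Set.Ioc_subset_Icc_self
  calc Den ε u ≤ ∫⁻ h in Metric.ball (0 : Eu d) 1, ∫⁻ x, ENNReal.ofReal ((inner ℝ (gradient u x) h) ^ 2) := by
        unfold Den
        refine lintegral_mono fun h => ?_
        refine (lintegral_mono (key h)).trans ?_
        have hmm : Continuous (fun p : Eu d × ℝ => (inner ℝ (gradient u (p.1 + p.2 • (ε • h))) h : ℝ) ^ 2) := by
          have : Continuous (fun p : Eu d × ℝ => gradient u (p.1 + p.2 • (ε • h))) := hg.comp (by fun_prop)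
          fun_prop
        rw [lintegral_lintegral_swap hmm.measurable.ennreal_ofReal.aemeasurable]
        simp_rw [lintegral_add_right_eq_self (fun x => ENNReal.ofReal ((inner ℝ (gradient u x) h : ℝ) ^ 2))]
        simp
    _ = ∫⁻ x, ∫⁻ h in Metric.ball (0 : Eu d) 1, ENNReal.ofReal ((inner ℝ (gradient u x) h) ^ 2) := by
        have hmm : Continuous (fun p : Eu d × Eu d => (inner ℝ (gradient u p.2) p.1 : ℝ) ^ 2) := by
          have : Continuous (fun p : Eu d × Eu d => gradient u p.2) := hg.comp (by fun_prop)
          fun_prop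
        rw [lintegral_lintegral_swap hmm.measurable.ennreal_ofReal.aemeasurable]
    _ = _ := by simp_rw [ball_inner_lint hd]

lemma grad_le_Dir {d : ℕ} (hd : 0 < d) {u : Eu d → ℝ} (hu : ContDiff ℝ 1 u) :
    ∫⁻ x, ENNReal.ofReal (kap d * ‖gradient u x‖ ^ 2) ≤ Dir u := by
  have hg := gradient_cont hu
  have hm := hu.continuous.measurable
  have hlim : ∀ h x : Eu d, Filter.Tendsto (fun n : ℕ => ENNReal.ofReal (dq (1 / ((n:ℝ) + 1)) u h x)) Filter.atTop
      (nhds (ENNReal.ofReal ((inner ℝ (gradient u x) h) ^ 2))) := by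
    intro h x
    apply ENNReal.tendsto_ofReal
    have h1 := line_deriv hu x h 0
    rw [hasDerivAt_iff_tendsto_slope_zero] at h1
    have h2 : Filter.Tendsto (fun n : ℕ => (1 / ((n:ℝ) + 1))) Filter.atTop (nhdsWithin 0 {0}ᶜ) := by
      rw [tendsto_nhdsWithin_iff]
      refine ⟨tendsto_one_div_add_atTop_nhds_zero_nat, Filter.Eventually.of_forall fun n => ?_⟩
      have : (0:ℝ) < 1 / ((n:ℝ) + 1) := by positivity
      exact this.ne'
    have h3 := (h1.comp h2).pow 2
    simp only [zero_smul, add_zero] at h3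
    refine h3.congr fun n => ?_
    unfold dq
    simp [Function.comp, div_eq_inv_mul]
  calc ∫⁻ x, ENNReal.ofReal (kap d * ‖gradient u x‖ ^ 2)
      = ∫⁻ x, ∫⁻ h in Metric.ball (0 : Eu d) 1, ENNReal.ofReal ((inner ℝ (gradient u x) h) ^ 2) := by
        simp_rw [ball_inner_lint hd]
    _ = ∫⁻ h in Metric.ball (0 : Eu d) 1, ∫⁻ x, ENNReal.ofReal ((inner ℝ (gradient u x) h) ^ 2) := by
        have hmm : Continuous (fun p : Eu d × Eu d => (inner ℝ (gradient u p.1) p.2 : ℝ) ^ 2) := by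
          have : Continuous (fun p : Eu d × Eu d => gradient u p.1) := hg.comp (by fun_prop)
          fun_prop
        rw [lintegral_lintegral_swap hmm.measurable.ennreal_ofReal.aemeasurable]
    _ ≤ ∫⁻ h in Metric.ball (0 : Eu d) 1, Filter.liminf (fun n : ℕ => ∫⁻ x, ENNReal.ofReal (dq (1 / ((n:ℝ) + 1)) u h x)) Filter.atTop := by
        refine lintegral_mono fun h => ?_
        refine le_trans (le_of_eq (lintegral_congr fun x => ?_))
          (lintegral_liminf_le fun n => (measurable_dq_right _ hm h).ennreal_ofReal)
        exact (hlim h x).liminf_eq.symm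
    _ ≤ Filter.liminf (fun n : ℕ => Den (1 / ((n:ℝ) + 1)) u) Filter.atTop :=
        lintegral_liminf_le fun n => measurable_dq_int _ hm
    _ ≤ Dir u := by
        refine (Filter.liminf_le_liminf (Filter.Eventually.of_forall fun n : ℕ => Den_le_Dir (ε := 1 / ((n:ℝ) + 1)) (by positivity) u)).trans ?_
        simp

end GNS

namespace GNS

structure TestF (f f1 f2 : ℝ → ℝ) (T : ℝ) : Prop where
  T0 : 0 ≤ T
  d1 : ∀ t, HasDerivAt f (f1 t) t
  d2 : ∀ t, HasDerivAt f1 (f2 t) t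
  c2 : Continuous f2
  z0 : ∀ t, T ≤ t → f t = 0
  z1 : ∀ t, T ≤ t → f1 t = 0
  z2 : ∀ t, T ≤ t → f2 t = 0

lemma TestF.c1 {f f1 f2 : ℝ → ℝ} {T : ℝ} (h : TestF f f1 f2 T) : Continuous f1 :=
  continuous_iff_continuousAt.2 fun t => (h.d2 t).continuousAt
lemma TestF.c0 {f f1 f2 : ℝ → ℝ} {T : ℝ} (h : TestF f f1 f2 T) : Continuous f :=
  continuous_iff_continuousAt.2 fun t => (h.d1 t).continuousAt

lemma second_diff {g g1 g2 : ℝ → ℝ} (h1 : ∀ s, HasDerivAt g (g1 s) s) (h2 : ∀ s, HasDerivAt g1 (g2 s) s)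
    {ε : ℝ} (hε : 0 < ε) : ∃ ξ, |ξ| ≤ ε ∧ g ε + g (-ε) - 2 * g 0 = ε ^ 2 * g2 ξ := by
  have hneg : ∀ s, HasDerivAt (fun s => g (-s)) (- g1 (-s)) s := fun s => by
    have := (h1 (-s)).comp s (hasDerivAt_neg s)
    exact this.congr_deriv (by ring)
  have hG : ∀ s, HasDerivAt (fun s => g s + g (-s)) (g1 s - g1 (-s)) s := fun s => by
    exact ((h1 s).add (hneg s)).congr_deriv (by ring)
  have hc : Continuous (fun s => g s + g (-s)) := continuous_iff_continuousAt.2 fun t => (hG t).continuousAt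
  obtain ⟨c, hc, hce⟩ := exists_ratio_hasDerivAt_eq_ratio_slope (fun s => s ^ 2) (fun s => 2 * s) hε
    (by fun_prop) (fun s _ => by simpa using hasDerivAt_pow 2 s) (fun s => g s + g (-s)) _ hc.continuousOn
    (fun s _ => hG s)
  have hc1 : Continuous g1 := continuous_iff_continuousAt.2 fun t => (h2 t).continuousAt
  obtain ⟨ξ, hξ, hξe⟩ := exists_hasDerivAt_eq_slope g1 g2 (a := -c) (b := c) (by linarith [hc.1]) hc1.continuousOn
    (fun s _ => h2 s)
  refine ⟨ξ, abs_le.2 ⟨by linarith [hξ.1, hc.2], by linarith [hξ.2, hc.2]⟩, ?_⟩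
  have hcp := hc.1
  have e : g1 c - g1 (-c) = 2 * c * g2 ξ := by
    rw [hξe]; field_simp; ring
  simp only [neg_zero] at hce
  rw [e] at hce
  have : (g ε + g (-ε) - (g 0 + g 0)) * (2 * c) = (ε ^ 2 * g2 ξ) * (2 * c) := by rw [hce]; ring
  have := mul_right_cancel₀ (by positivity) this
  linarith

def Wf {d : ℕ} (f1 f2 : ℝ → ℝ) (h x : Eu d) : ℝ :=
  4 * (inner ℝ x h) ^ 2 * f2 (‖x‖ ^ 2) + 2 * ‖h‖ ^ 2 * f1 (‖x‖ ^ 2)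

lemma TestF.line1 {d : ℕ} {f f1 f2 : ℝ → ℝ} {T : ℝ} (h : TestF f f1 f2 T) (x k : Eu d) (s : ℝ) :
    HasDerivAt (fun s : ℝ => f (‖x + s • k‖ ^ 2)) (f1 (‖x + s • k‖ ^ 2) * (2 * inner ℝ (x + s • k) k)) s := by
  have h2 : HasDerivAt (fun s : ℝ => x + s • k) k s := by
    simpa using ((hasDerivAt_id s).smul_const k).const_add x
  exact (h.d1 _).comp s h2.norm_sq

lemma TestF.line2 {d : ℕ} {f f1 f2 : ℝ → ℝ} {T : ℝ} (h : TestF f f1 f2 T) (x k : Eu d) (s : ℝ) :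
    HasDerivAt (fun s : ℝ => f1 (‖x + s • k‖ ^ 2) * (2 * inner ℝ (x + s • k) k)) (Wf f1 f2 k (x + s • k)) s := by
  have h2 : HasDerivAt (fun s : ℝ => x + s • k) k s := by
    simpa using ((hasDerivAt_id s).smul_const k).const_add x
  have h3 := (h.d2 (‖x + s • k‖ ^ 2)).comp s h2.norm_sq
  have h4 : HasDerivAt (fun s : ℝ => 2 * (inner ℝ (x + s • k) k : ℝ)) (2 * inner ℝ k k) s := by
    have := (h2.inner ℝ (hasDerivAt_const s k)).const_mul 2
    simpa using this
  have h5 := h3.mul h4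
  refine h5.congr_deriv ?_
  unfold Wf
  rw [real_inner_self_eq_norm_sq]
  simp only [Function.comp]
  ring

lemma TestF.W_bound {d : ℕ} {f f1 f2 : ℝ → ℝ} {T : ℝ} (h : TestF f f1 f2 T) :
    ∃ C, 0 ≤ C ∧ ∀ k x : Eu d, ‖k‖ ≤ 1 → |Wf f1 f2 k x| ≤ C := by
  obtain ⟨C1, h1⟩ := isCompact_Icc.exists_bound_of_continuousOn (h.c1.continuousOn (s := Set.Icc 0 T))
  obtain ⟨C2, h2⟩ := isCompact_Icc.exists_bound_of_continuousOn (h.c2.continuousOn (s := Set.Icc 0 T))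
  have hC1 : 0 ≤ C1 := (norm_nonneg _).trans (h1 0 ⟨le_rfl, h.T0⟩)
  have hC2 : 0 ≤ C2 := (norm_nonneg _).trans (h2 0 ⟨le_rfl, h.T0⟩)
  have hT := h.T0
  refine ⟨4 * T * C2 + 2 * C1, by positivity, fun k x hk => ?_⟩
  unfold Wf
  by_cases hx : ‖x‖ ^ 2 ≤ T
  · have b1 := h1 (‖x‖ ^ 2) ⟨by positivity, hx⟩
    have b2 := h2 (‖x‖ ^ 2) ⟨by positivity, hx⟩
    have hk2 : ‖k‖ ^ 2 ≤ 1 := by nlinarith [norm_nonneg k]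
    have b3 : (inner ℝ x k : ℝ) ^ 2 ≤ T := by
      have := abs_real_inner_le_norm x k
      have h4 : (inner ℝ x k : ℝ) ^ 2 ≤ (‖x‖ * ‖k‖) ^ 2 := by
        rw [← sq_abs]; gcongr
      rw [mul_pow] at h4
      nlinarith [sq_nonneg ‖x‖, sq_nonneg ‖k‖]
    refine (abs_add_le _ _).trans ?_
    rw [abs_mul, abs_mul (2 * ‖k‖ ^ 2), abs_of_nonneg (a := 4 * (inner ℝ x k : ℝ) ^ 2) (by positivity), abs_of_nonneg (a := 2 * ‖k‖ ^ 2) (by positivity)]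
    rw [Real.norm_eq_abs] at b1 b2
    gcongr
    · nlinarith
  · rw [h.z1 _ (by linarith), h.z2 _ (by linarith)]
    simp; positivity

lemma TestF.W_cont {d : ℕ} {f f1 f2 : ℝ → ℝ} {T : ℝ} (h : TestF f f1 f2 T) :
    Continuous (fun p : Eu d × Eu d => Wf f1 f2 p.1 p.2) := by
  unfold Wf
  have := h.c1
  have := h.c2
  fun_prop

/-- second difference -/
def sdf {d : ℕ} (f : ℝ → ℝ) (ε : ℝ) (k x : Eu d) : ℝ :=
  (f (‖x + ε • k‖ ^ 2) + f (‖x - ε • k‖ ^ 2) - 2 * f (‖x‖ ^ 2)) / ε ^ 2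

lemma TestF.sdf_eq {d : ℕ} {f f1 f2 : ℝ → ℝ} {T : ℝ} (h : TestF f f1 f2 T) {ε : ℝ} (hε : 0 < ε) (k x : Eu d) :
    ∃ ξ, |ξ| ≤ ε ∧ sdf f ε k x = Wf f1 f2 k (x + ξ • k) := by
  obtain ⟨ξ, h1, h2⟩ := second_diff (h.line1 x k) (h.line2 x k) hε
  refine ⟨ξ, h1, ?_⟩
  unfold sdf
  simp only [neg_smul, zero_smul, add_zero, ← sub_eq_add_neg] at h2
  rw [h2]; field_simp

lemma TestF.sdf_tendsto {d : ℕ} {f f1 f2 : ℝ → ℝ} {T : ℝ} (h : TestF f f1 f2 T) {ε : ℕ → ℝ} (hε : ∀ n, 0 < ε n)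
    (hl : Filter.Tendsto ε Filter.atTop (nhds 0)) (k x : Eu d) :
    Filter.Tendsto (fun n => sdf f (ε n) k x) Filter.atTop (nhds (Wf f1 f2 k x)) := by
  choose ξ h1 h2 using fun n => h.sdf_eq (hε n) k x
  simp_rw [h2]
  have h3 : Filter.Tendsto ξ Filter.atTop (nhds 0) := squeeze_zero_norm (fun n => by rw [Real.norm_eq_abs]; exact h1 n) hl
  have h4 : Continuous (fun s : ℝ => Wf f1 f2 k (x + s • k)) :=
    by
      have := h.c1
      have := h.c2
      unfold Wf
      fun_prop
  have h5 := (h4.tendsto 0).comp h3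
  simp only [zero_smul, add_zero] at h5
  exact h5

lemma TestF.compact {d : ℕ} {f f1 f2 : ℝ → ℝ} {T : ℝ} (_h : TestF f f1 f2 T) {g : Eu d → ℝ}
    (hg : ∀ x, T ≤ ‖x‖ ^ 2 → g x = 0) : HasCompactSupport g := by
  apply HasCompactSupport.intro (isCompact_closedBall (0 : Eu d) (T + 1))
  intro x hx
  apply hg
  simp at hx
  nlinarith [_h.T0]

lemma TestF.contDiff {d : ℕ} {f f1 f2 : ℝ → ℝ} {T : ℝ} (h : TestF f f1 f2 T) :
    ContDiff ℝ 1 (fun x : Eu d => f (‖x‖ ^ 2)) := by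
  have h1 : ContDiff ℝ 1 f := by
    rw [contDiff_one_iff_deriv]
    refine ⟨fun t => (h.d1 t).differentiableAt, ?_⟩
    have : deriv f = f1 := by ext t; exact (h.d1 t).deriv
    rw [this]; exact h.c1
  exact h1.comp (contDiff_norm_sq ℝ)

lemma grad_radial {d : ℕ} {f f1 : ℝ → ℝ} (h : ∀ t, HasDerivAt f (f1 t) t) (x : Eu d) :
    gradient (fun x : Eu d => f (‖x‖ ^ 2)) x = (2 * f1 (‖x‖ ^ 2)) • x := by
  apply HasGradientAt.gradient
  rw [hasGradientAt_iff_hasFDerivAt]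
  have h1 := (hasStrictFDerivAt_norm_sq x).hasFDerivAt
  have h2 := (h (‖x‖ ^ 2)).comp_hasFDerivAt x h1
  refine h2.congr_fderiv ?_
  ext y
  simp
  ring

def Np (d : ℕ) (f1 : ℝ → ℝ) : ℝ := ∫ x : Eu d, 4 * ‖x‖ ^ 2 * f1 (‖x‖ ^ 2) ^ 2
def Lp {d : ℕ} (u : Eu d → ℝ) (f1 f2 : ℝ → ℝ) : ℝ :=
  ∫ x : Eu d, u x * (4 * ‖x‖ ^ 2 * f2 (‖x‖ ^ 2) + 2 * d * f1 (‖x‖ ^ 2))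

lemma TestF.Dir_le {d : ℕ} (hd : 0 < d) {f f1 f2 : ℝ → ℝ} {T : ℝ} (h : TestF f f1 f2 T) :
    Dir (fun x : Eu d => f (‖x‖ ^ 2)) ≤ ENNReal.ofReal (kap d * Np d f1) := by
  refine (Dir_le_grad hd h.contDiff).trans (le_of_eq ?_)
  unfold Np
  rw [← integral_const_mul, ofReal_integral_eq_lintegral_ofReal]
  · congr 1; ext x
    rw [grad_radial h.d1, norm_smul, Real.norm_eq_abs, mul_pow, sq_abs]
    ring_nf
  · apply Continuous.integrable_of_hasCompactSupport
    · have := h.c1; fun_prop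
    · apply h.compact
      intro x hx
      rw [h.z1 _ hx]; simp
  · refine Filter.Eventually.of_forall fun x => ?_
    have := (kap_pos hd).le
    positivity

/-- measure on (direction, point) -/
def mB (d : ℕ) : Measure (Eu d × Eu d) := (volume.restrict (Metric.ball (0 : Eu d) 1)).prod volume

instance ball_finite (d : ℕ) : IsFiniteMeasure ((volume : Measure (Eu d)).restrict (Metric.ball (0 : Eu d) 1)) :=
  ⟨by simpa using measure_ball_lt_top⟩

lemma Den_mB {d : ℕ} (ε : ℝ) {u : Eu d → ℝ} (hu : Measurable u) :
    Den ε u = ∫⁻ p, ENNReal.ofReal (dq ε u p.1 p.2) ∂(mB d) := by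
  unfold Den mB
  rw [lintegral_prod _ (measurable_dq ε hu).ennreal_ofReal.aemeasurable]

lemma dq_integrable {d : ℕ} {ε D : ℝ} {u : Eu d → ℝ} (hu : Measurable u) (h : Den ε u ≤ ENNReal.ofReal D) (hD : 0 ≤ D) :
    Integrable (fun p : Eu d × Eu d => dq ε u p.1 p.2) (mB d) ∧ ∫ p, dq ε u p.1 p.2 ∂(mB d) ≤ D := by
  have hnn : ∀ p : Eu d × Eu d, 0 ≤ dq ε u p.1 p.2 := fun p => sq_nonneg _
  have hI : Integrable (fun p : Eu d × Eu d => dq ε u p.1 p.2) (mB d) := by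
    refine ⟨(measurable_dq ε hu).aestronglyMeasurable, ?_⟩
    rw [hasFiniteIntegral_iff_ofReal (Filter.Eventually.of_forall hnn), ← Den_mB ε hu]
    exact h.trans_lt ENNReal.ofReal_lt_top
  refine ⟨hI, ?_⟩
  rw [Den_mB ε hu, ← ofReal_integral_eq_lintegral_ofReal hI (Filter.Eventually.of_forall hnn)] at h
  exact (ENNReal.ofReal_le_ofReal_iff hD).1 h

lemma cross_eq {d : ℕ} {ε : ℝ} (hε : 0 < ε) {u : Eu d → ℝ} (hi : Integrable u) {f f1 f2 : ℝ → ℝ} {T : ℝ}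
    (h : TestF f f1 f2 T) (k : Eu d) :
    ∫ x, (u (x + ε • k) - u x) / ε * ((f (‖x + ε • k‖ ^ 2) - f (‖x‖ ^ 2)) / ε) = - ∫ x, u x * sdf f ε k x := by
  obtain ⟨C, hC⟩ := (h.compact (d := d) (g := fun x => f (‖x‖ ^ 2)) (fun x hx => h.z0 _ hx)).exists_bound_of_continuous
    (by have := h.c0; fun_prop)
  have hc := h.c0
  have I : ∀ (a b : Eu d), Integrable (fun x => u (x + a) * f (‖x + b‖ ^ 2)) := fun a b => by
    refine Integrable.mul_bdd (c := C) (hi.comp_add_right a) ?_ (Filter.Eventually.of_forall fun x => hC (x + b))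
    exact (by fun_prop : Continuous fun x : Eu d => f (‖x + b‖ ^ 2)).aestronglyMeasurable
  have I1 := I (ε • k) (ε • k)
  have I2 := I (ε • k) 0
  have I3 := I 0 (ε • k)
  have I4 := I 0 0
  have I5 := I 0 (- (ε • k))
  simp only [add_zero] at I2 I3 I4 I5
  have e1 : ∫ x, (u (x + ε • k) - u x) / ε * ((f (‖x + ε • k‖ ^ 2) - f (‖x‖ ^ 2)) / ε) =
      ((∫ x, u (x + ε • k) * f (‖x + ε • k‖ ^ 2)) - (∫ x, u (x + ε • k) * f (‖x‖ ^ 2)) - (∫ x, u x * f (‖x + ε • k‖ ^ 2))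
       + ∫ x, u x * f (‖x‖ ^ 2)) / ε ^ 2 := by
    rw [← integral_sub' I1 I2, ← integral_sub' (I1.sub I2) I3, ← integral_add' ((I1.sub I2).sub I3) I4, ← integral_div]
    congr 1; ext x; simp only [Pi.sub_apply, Pi.add_apply]; field_simp; ring
  have e2 : ∫ x, u x * sdf f ε k x = ((∫ x, u x * f (‖x + ε • k‖ ^ 2)) + (∫ x, u x * f (‖x - ε • k‖ ^ 2))
      - 2 * ∫ x, u x * f (‖x‖ ^ 2)) / ε ^ 2 := by
    simp only [← sub_eq_add_neg] at I5
    rw [← integral_const_mul, ← integral_add' I3 I5, ← integral_sub' (I3.add I5) (I4.const_mul 2), ← integral_div]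
    congr 1; ext x; unfold sdf; simp only [Pi.sub_apply, Pi.add_apply]; field_simp
  have e3 : ∫ x, u (x + ε • k) * f (‖x + ε • k‖ ^ 2) = ∫ x, u x * f (‖x‖ ^ 2) :=
    integral_add_right_eq_self (fun x => u x * f (‖x‖ ^ 2)) (ε • k)
  have e4 : ∫ x, u (x + ε • k) * f (‖x‖ ^ 2) = ∫ x, u x * f (‖x - ε • k‖ ^ 2) := by
    rw [← integral_add_right_eq_self (fun x => u x * f (‖x - ε • k‖ ^ 2)) (ε • k)]
    simp
  rw [e1, e2, e3, e4]
  ring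

end GNS

namespace GNS

lemma sdf_cont {d : ℕ} {f f1 f2 : ℝ → ℝ} {T : ℝ} (h : TestF f f1 f2 T) (ε : ℝ) :
    Continuous (fun p : Eu d × Eu d => sdf f ε p.1 p.2) := by
  have := h.c0
  unfold sdf
  fun_prop

lemma ae_ball_mB (d : ℕ) : ∀ᵐ p ∂(mB d), p.1 ∈ Metric.ball (0 : Eu d) 1 := by
  have h := ae_restrict_mem (μ := (volume : Measure (Eu d))) (s := Metric.ball (0 : Eu d) 1) measurableSet_ball
  exact Measure.quasiMeasurePreserving_fst.ae h

lemma int_snd {d : ℕ} {u : Eu d → ℝ} (hi : Integrable u) : Integrable (fun p : Eu d × Eu d => u p.2) (mB d) := by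
  unfold mB
  exact hi.comp_snd _

lemma cross_lim {d : ℕ} (hd : 0 < d) {u : Eu d → ℝ} (hu : Measurable u) (hi : Integrable u) {f f1 f2 : ℝ → ℝ} {T : ℝ}
    (h : TestF f f1 f2 T) {ε : ℕ → ℝ} (hε : ∀ n, 0 < ε n) (hl : Filter.Tendsto ε Filter.atTop (nhds 0)) :
    Filter.Tendsto (fun n => ∫ p, u p.2 * sdf f (ε n) p.1 p.2 ∂(mB d)) Filter.atTop (nhds (kap d * Lp u f1 f2)) := by
  obtain ⟨C, hC0, hC⟩ := h.W_bound (d := d)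
  have hb : ∀ n, ∀ᵐ p ∂(mB d), ‖u p.2 * sdf f (ε n) p.1 p.2‖ ≤ ‖u p.2‖ * C := fun n => by
    filter_upwards [ae_ball_mB d] with p hp
    rw [norm_mul]
    obtain ⟨ξ, -, h2⟩ := h.sdf_eq (hε n) p.1 p.2
    rw [h2]
    gcongr
    exact hC _ _ (by simpa using (mem_ball_zero_iff.1 hp).le)
  have hI : Integrable (fun p : Eu d × Eu d => ‖u p.2‖ * C) (mB d) := (int_snd hi).norm.mul_const C
  have hlim := tendsto_integral_of_dominated_convergence (μ := mB d) (fun p => ‖u p.2‖ * C)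
    (F := fun n (p : Eu d × Eu d) => u p.2 * sdf f (ε n) p.1 p.2) (f := fun p => u p.2 * Wf f1 f2 p.1 p.2)
    (fun n => ((hu.comp measurable_snd).mul (sdf_cont h (ε n)).measurable).aestronglyMeasurable) hI hb
    (Filter.Eventually.of_forall fun p => (h.sdf_tendsto hε hl p.1 p.2).const_mul _)
  have hIW : Integrable (fun p : Eu d × Eu d => u p.2 * Wf f1 f2 p.1 p.2) (mB d) := by
    refine hI.mono' ((hu.comp measurable_snd).mul h.W_cont.measurable).aestronglyMeasurable ?_
    filter_upwards [ae_ball_mB d] with p hp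
    rw [norm_mul]
    gcongr
    exact hC _ _ (by simpa using (mem_ball_zero_iff.1 hp).le)
  have e : ∫ p, u p.2 * Wf f1 f2 p.1 p.2 ∂(mB d) = kap d * Lp u f1 f2 := by
    unfold mB at hIW ⊢
    rw [integral_prod_symm _ hIW]
    unfold Lp
    rw [← integral_const_mul]
    congr 1; ext x
    dsimp only
    rw [integral_const_mul]
    unfold Wf
    have i1 : IntegrableOn (fun k : Eu d => 4 * (inner ℝ x k) ^ 2 * f2 (‖x‖ ^ 2)) (Metric.ball (0 : Eu d) 1) :=
      integrableOn_ball (by fun_prop)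
    have i2 : IntegrableOn (fun k : Eu d => 2 * ‖k‖ ^ 2 * f1 (‖x‖ ^ 2)) (Metric.ball (0 : Eu d) 1) :=
      integrableOn_ball (by fun_prop)
    rw [integral_add i1 i2, integral_mul_const, integral_const_mul, integral_mul_const, integral_const_mul, ball_inner hd, ball_norm hd]
    ring
  rw [← e]
  exact hlim

lemma Den_pert {d : ℕ} (hd : 0 < d) {u : Eu d → ℝ} (hu : Measurable u) (hi : Integrable u) {D : ℝ} (hD0 : 0 ≤ D)
    (hD : Dir u ≤ ENNReal.ofReal D) {f f1 f2 : ℝ → ℝ} {T : ℝ}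
    (h : TestF f f1 f2 T) (s : ℝ) {ε : ℝ} (hε : 0 < ε) :
    0 ≤ D - 2 * s * (∫ p, u p.2 * sdf f ε p.1 p.2 ∂(mB d)) + s ^ 2 * (kap d * Np d f1) ∧
    Den ε (fun x => u x + s * f (‖x‖ ^ 2)) ≤
      ENNReal.ofReal (D - 2 * s * (∫ p, u p.2 * sdf f ε p.1 p.2 ∂(mB d)) + s ^ 2 * (kap d * Np d f1)) := by
  have hc := h.c0
  have hη : Measurable (fun x : Eu d => f (‖x‖ ^ 2)) := (by fun_prop : Continuous _).measurable
  have hN : 0 ≤ kap d * Np d f1 := mul_nonneg (kap_pos hd).le (integral_nonneg fun x => by positivity)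
  obtain ⟨i1, b1⟩ := dq_integrable hu ((Den_le_Dir hε u).trans hD) hD0
  obtain ⟨i2, b2⟩ := dq_integrable hη ((Den_le_Dir hε _).trans (h.Dir_le hd)) hN
  have i3 : Integrable (fun p : Eu d × Eu d => (u (p.2 + ε • p.1) - u p.2) / ε *
      ((f (‖p.2 + ε • p.1‖ ^ 2) - f (‖p.2‖ ^ 2)) / ε)) (mB d) := by
    refine (i1.add i2).mono' ?_ ?_
    · apply Measurable.aestronglyMeasurable; fun_prop
    · refine Filter.Eventually.of_forall fun p => ?_
      simp only [Pi.add_apply, dq]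
      rw [norm_mul, Real.norm_eq_abs, Real.norm_eq_abs]
      generalize (u (p.2 + ε • p.1) - u p.2) / ε = a
      generalize (f (‖p.2 + ε • p.1‖ ^ 2) - f (‖p.2‖ ^ 2)) / ε = b
      rw [← sq_abs a, ← sq_abs b]
      nlinarith [sq_nonneg (|a| - |b|), sq_nonneg (|a|), sq_nonneg (|b|)]
  have e3 : ∫ p, (u (p.2 + ε • p.1) - u p.2) / ε *
      ((f (‖p.2 + ε • p.1‖ ^ 2) - f (‖p.2‖ ^ 2)) / ε) ∂(mB d) = - ∫ p, u p.2 * sdf f ε p.1 p.2 ∂(mB d) := by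
    have i4 : Integrable (fun p : Eu d × Eu d => u p.2 * sdf f ε p.1 p.2) (mB d) := by
      obtain ⟨C, hC0, hC⟩ := h.W_bound (d := d)
      refine ((int_snd hi).norm.mul_const C).mono' ((hu.comp measurable_snd).mul (sdf_cont h ε).measurable).aestronglyMeasurable ?_
      filter_upwards [ae_ball_mB d] with p hp
      rw [norm_mul]
      obtain ⟨ξ, -, h2⟩ := h.sdf_eq hε p.1 p.2
      rw [h2]
      gcongr
      exact hC _ _ (by simpa using (mem_ball_zero_iff.1 hp).le)
    unfold mB at i3 i4 ⊢
    rw [integral_prod _ i3, integral_prod _ i4, ← integral_neg]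
    congr 1; ext k
    exact cross_eq hε hi h k
  have e4 : ∀ p : Eu d × Eu d, dq ε (fun x => u x + s * f (‖x‖ ^ 2)) p.1 p.2 = dq ε u p.1 p.2 +
      (2 * s) * ((u (p.2 + ε • p.1) - u p.2) / ε * ((f (‖p.2 + ε • p.1‖ ^ 2) - f (‖p.2‖ ^ 2)) / ε))
      + s ^ 2 * dq ε (fun x : Eu d => f (‖x‖ ^ 2)) p.1 p.2 := fun p => by
    unfold dq; ring
  have e5 : ∫ p, dq ε (fun x => u x + s * f (‖x‖ ^ 2)) p.1 p.2 ∂(mB d) = (∫ p, dq ε u p.1 p.2 ∂(mB d))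
      - 2 * s * (∫ p, u p.2 * sdf f ε p.1 p.2 ∂(mB d))
      + s ^ 2 * ∫ p, dq ε (fun x : Eu d => f (‖x‖ ^ 2)) p.1 p.2 ∂(mB d) := by
    simp_rw [e4]
    have i5 : Integrable (fun p : Eu d × Eu d => dq ε u p.1 p.2 +
      (2 * s) * ((u (p.2 + ε • p.1) - u p.2) / ε * ((f (‖p.2 + ε • p.1‖ ^ 2) - f (‖p.2‖ ^ 2)) / ε))) (mB d) :=
      i1.add (i3.const_mul _)
    rw [integral_add i5 (i2.const_mul _), integral_add i1 (i3.const_mul _), integral_const_mul, integral_const_mul, e3]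
    ring
  have h0 : 0 ≤ ∫ p, dq ε (fun x => u x + s * f (‖x‖ ^ 2)) p.1 p.2 ∂(mB d) := integral_nonneg fun p => sq_nonneg _
  have h1 : ∫ p, dq ε (fun x => u x + s * f (‖x‖ ^ 2)) p.1 p.2 ∂(mB d) ≤
      D - 2 * s * (∫ p, u p.2 * sdf f ε p.1 p.2 ∂(mB d)) + s ^ 2 * (kap d * Np d f1) := by
    rw [e5]; gcongr
  refine ⟨h0.trans h1, ?_⟩
  have i6 : Integrable (fun p : Eu d × Eu d => dq ε (fun x => u x + s * f (‖x‖ ^ 2)) p.1 p.2) (mB d) := by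
    simp_rw [e4]
    exact (i1.add (i3.const_mul _)).add (i2.const_mul _)
  rw [Den_mB ε (by fun_prop), ← ofReal_integral_eq_lintegral_ofReal i6 (Filter.Eventually.of_forall fun p => sq_nonneg _)]
  exact ENNReal.ofReal_le_ofReal h1

theorem Dir_pert {d : ℕ} (hd : 0 < d) {u : Eu d → ℝ} (hu : Measurable u) (hi : Integrable u) {D : ℝ} (hD0 : 0 ≤ D)
    (hD : Dir u ≤ ENNReal.ofReal D) {f f1 f2 : ℝ → ℝ} {T : ℝ}
    (h : TestF f f1 f2 T) (s : ℝ) :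
    0 ≤ D - 2 * s * (kap d * Lp u f1 f2) + s ^ 2 * (kap d * Np d f1) ∧
    Dir (fun x => u x + s * f (‖x‖ ^ 2)) ≤
      ENNReal.ofReal (D - 2 * s * (kap d * Lp u f1 f2) + s ^ 2 * (kap d * Np d f1)) := by
  have hlim : ∀ ε0 : ℝ, 0 < ε0 → Filter.Tendsto (fun n : ℕ => D - 2 * s * (∫ p, u p.2 * sdf f (ε0 / 2 ^ n) p.1 p.2 ∂(mB d)) + s ^ 2 * (kap d * Np d f1))
      Filter.atTop (nhds (D - 2 * s * (kap d * Lp u f1 f2) + s ^ 2 * (kap d * Np d f1))) := by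
    intro ε0 hε0
    have hl : Filter.Tendsto (fun n : ℕ => ε0 / 2 ^ n) Filter.atTop (nhds 0) := by
      have := (tendsto_pow_atTop_nhds_zero_of_lt_one (r := (1/2:ℝ)) (by norm_num) (by norm_num)).const_mul ε0
      rw [mul_zero] at this
      refine this.congr fun n => ?_
      rw [one_div, inv_pow]; rfl
    exact (((cross_lim hd hu hi h (fun n => by positivity) hl).const_mul _).const_sub _).add_const _
  constructor
  · exact ge_of_tendsto (hlim 1 one_pos) (Filter.Eventually.of_forall fun n => (Den_pert hd hu hi hD0 hD h s (by positivity)).1)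
  · refine Dir_le fun ε0 hε0 => ?_
    have hc := h.c0
    refine ge_of_tendsto (ENNReal.tendsto_ofReal (hlim ε0 hε0)) (Filter.Eventually.of_forall fun n => ?_)
    exact (Den_pow_half hε0 (by fun_prop) n).trans (Den_pert hd hu hi hD0 hD h s (by positivity)).2

lemma Lp_sq_le {d : ℕ} (hd : 0 < d) {u : Eu d → ℝ} (hu : Measurable u) (hi : Integrable u) {D : ℝ} (hD0 : 0 ≤ D)
    (hD : Dir u ≤ ENNReal.ofReal D) {f f1 f2 : ℝ → ℝ} {T : ℝ}
    (h : TestF f f1 f2 T) : kap d * Lp u f1 f2 ^ 2 ≤ D * Np d f1 := by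
  have hk := kap_pos hd
  have hN : 0 ≤ Np d f1 := integral_nonneg fun x => by positivity
  have h1 := discrim_le_zero (a := kap d * Np d f1) (b := - 2 * (kap d * Lp u f1 f2)) (c := D) fun s => by
    have := (Dir_pert hd hu hi hD0 hD h s).1
    linarith
  unfold discrim at h1
  have h2 : kap d * (kap d * Lp u f1 f2 ^ 2) ≤ kap d * (D * Np d f1) := by nlinarith
  exact le_of_mul_le_mul_left h2 hk

end GNS

namespace GNS

/-- half surface area -/
def cw (d : ℕ) : ℝ := (d * (volume : Measure (Eu d)).real (Metric.ball 0 1)) / 2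

lemma cw_pos {d : ℕ} (hd : 0 < d) : 0 < cw d := by
  unfold cw
  have : 0 < (volume : Measure (Eu d)).real (Metric.ball 0 1) := by
    rw [measureReal_def]
    exact ENNReal.toReal_pos (Metric.measure_ball_pos _ _ one_pos).ne' measure_ball_lt_top.ne
  positivity

lemma nontriv {d : ℕ} (hd : 0 < d) : Nontrivial (Eu d) := by
  have : Nonempty (Fin d) := ⟨⟨0, hd⟩⟩
  infer_instance

lemma polar_aux {d : ℕ} (hd : 0 < d) {y : ℝ} (hy : 0 < y) (F : ℝ → ℝ) :
    y ^ (d - 1) * F (y ^ 2) = (1/2) * ((2 * y ^ ((2:ℝ) - 1)) * (F (y ^ (2:ℝ)) * (y ^ (2:ℝ)) ^ ((d:ℝ) / 2 - 1))) := by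
  have e1 : (y ^ (2:ℝ)) ^ ((d:ℝ) / 2 - 1) = y ^ ((d:ℝ) - 2) := by
    rw [← Real.rpow_mul hy.le]; congr 1; ring
  have e2 : y ^ (d - 1) = y ^ ((d:ℝ) - 1) := by
    rw [← Real.rpow_natCast, Nat.cast_sub hd]; simp
  have e3 : y ^ ((2:ℝ) - 1) * y ^ ((d:ℝ) - 2) = y ^ ((d:ℝ) - 1) := by
    rw [← Real.rpow_add hy]; congr 1; ring
  rw [e1, e2, ← e3, Real.rpow_two]
  ring

lemma polar {d : ℕ} (hd : 0 < d) (F : ℝ → ℝ) :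
    ∫ x : Eu d, F (‖x‖ ^ 2) = cw d * ∫ t in Set.Ioi (0:ℝ), F t * t ^ ((d:ℝ) / 2 - 1) := by
  have := nontriv hd
  rw [integral_fun_norm_addHaar volume (fun r => F (r ^ 2))]
  rw [← integral_comp_rpow_Ioi_of_pos (g := fun t => F t * t ^ ((d:ℝ) / 2 - 1)) (p := 2) two_pos]
  have e : ∫ y in Set.Ioi (0:ℝ), y ^ (Module.finrank ℝ (Eu d) - 1) • F (y ^ 2) =
      (1/2) * ∫ x in Set.Ioi (0:ℝ), (2 * x ^ ((2:ℝ) - 1)) • (F (x ^ (2:ℝ)) * (x ^ (2:ℝ)) ^ ((d:ℝ) / 2 - 1)) := by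
    rw [← integral_const_mul]
    apply setIntegral_congr_fun measurableSet_Ioi
    intro y hy
    simp only [finrank_euclideanSpace, Fintype.card_fin, smul_eq_mul]
    exact polar_aux hd hy F
  rw [e]
  unfold cw
  simp only [finrank_euclideanSpace, Fintype.card_fin, smul_eq_mul, nsmul_eq_mul]
  ring

lemma polar_int {d : ℕ} (hd : 0 < d) (F : ℝ → ℝ) :
    Integrable (fun x : Eu d => F (‖x‖ ^ 2)) ↔ IntegrableOn (fun t => F t * t ^ ((d:ℝ) / 2 - 1)) (Set.Ioi (0:ℝ)) := by
  have := nontriv hd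
  rw [integrable_fun_norm_addHaar volume (f := fun r => F (r ^ 2)),
    ← integrableOn_Ioi_comp_rpow_iff (fun t => F t * t ^ ((d:ℝ) / 2 - 1)) (p := 2) two_ne_zero]
  have e : ∀ y ∈ Set.Ioi (0:ℝ), y ^ (Module.finrank ℝ (Eu d) - 1) • F (y ^ 2) =
      (1/2) * ((|2| * y ^ ((2:ℝ) - 1)) • (F (y ^ (2:ℝ)) * (y ^ (2:ℝ)) ^ ((d:ℝ) / 2 - 1))) := by
    intro y hy
    simp only [finrank_euclideanSpace, Fintype.card_fin, smul_eq_mul, abs_two]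
    exact polar_aux hd hy F
  rw [integrableOn_congr_fun e measurableSet_Ioi]
  constructor
  · intro h
    have := h.const_mul 2
    refine this.congr (Filter.Eventually.of_forall fun y => ?_)
    simp only []
    ring
  · intro h; exact h.const_mul _

/-- one-dimensional test functions -/
structure TestB (b b1 : ℝ → ℝ) (a c : ℝ) : Prop where
  apos : 0 < a
  ac : a ≤ c
  der : ∀ t, HasDerivAt b (b1 t) t
  cont : Continuous b1
  z1 : ∀ t, t ≤ a → b t = 0
  z2 : ∀ t, c ≤ t → b t = 0

lemma TestB.b1_left {b b1 : ℝ → ℝ} {a c : ℝ} (h : TestB b b1 a c) {t : ℝ} (ht : t < a) : b1 t = 0 := by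
  have h1 : b =ᶠ[nhds t] fun _ => 0 := by
    filter_upwards [Iio_mem_nhds ht] with s hs using h.z1 s (le_of_lt hs)
  exact (h.der t).unique ((hasDerivAt_const t (0:ℝ)).congr_of_eventuallyEq h1)

lemma TestB.b1_right {b b1 : ℝ → ℝ} {a c : ℝ} (h : TestB b b1 a c) {t : ℝ} (ht : c < t) : b1 t = 0 := by
  have h1 : b =ᶠ[nhds t] fun _ => 0 := by
    filter_upwards [Ioi_mem_nhds ht] with s hs using h.z2 s (le_of_lt hs)
  exact (h.der t).unique ((hasDerivAt_const t (0:ℝ)).congr_of_eventuallyEq h1)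

lemma TestB.bcont {b b1 : ℝ → ℝ} {a c : ℝ} (h : TestB b b1 a c) : Continuous b :=
  continuous_iff_continuousAt.2 fun t => (h.der t).continuousAt

def tf1 (d : ℕ) (b : ℝ → ℝ) (t : ℝ) : ℝ := - (t ^ (-(d:ℝ)/2) * b t)
def tf2 (d : ℕ) (b b1 : ℝ → ℝ) (t : ℝ) : ℝ := (d:ℝ)/2 * t ^ (-(d:ℝ)/2 - 1) * b t - t ^ (-(d:ℝ)/2) * b1 t
def tf0 (d : ℕ) (b : ℝ → ℝ) (c t : ℝ) : ℝ := ∫ τ in t..c, τ ^ (-(d:ℝ)/2) * b τ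

lemma cont_of_vanish {g : ℝ → ℝ} {a : ℝ} (ha : 0 < a) (hg : ContinuousOn g (Set.Ioi 0)) (hz : ∀ t, t < a → g t = 0) :
    Continuous g := by
  rw [continuous_iff_continuousAt]
  intro t
  by_cases ht : t < a
  · have h1 : g =ᶠ[nhds t] fun _ => 0 := by
      filter_upwards [Iio_mem_nhds ht] with s hs using hz s hs
    exact continuousAt_const.congr h1.symm
  · exact hg.continuousAt (Ioi_mem_nhds (by linarith))

lemma rpow_contOn (r : ℝ) : ContinuousOn (fun t : ℝ => t ^ r) (Set.Ioi 0) := fun t ht =>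
  (Real.continuousAt_rpow_const t r (Or.inl (ne_of_gt ht))).continuousWithinAt

lemma TestB.wcont {b b1 : ℝ → ℝ} {a c : ℝ} (h : TestB b b1 a c) (r : ℝ) : Continuous (fun t => t ^ r * b t) :=
  cont_of_vanish h.apos ((rpow_contOn r).mul h.bcont.continuousOn) fun t ht => by simp [h.z1 t ht.le]

lemma TestB.wcont1 {b b1 : ℝ → ℝ} {a c : ℝ} (h : TestB b b1 a c) (r : ℝ) : Continuous (fun t => t ^ r * b1 t) :=
  cont_of_vanish h.apos ((rpow_contOn r).mul h.cont.continuousOn) fun t ht => by simp [h.b1_left ht]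

lemma TestB.testF {b b1 : ℝ → ℝ} {a c : ℝ} (h : TestB b b1 a c) (d : ℕ) :
    TestF (tf0 d b c) (tf1 d b) (tf2 d b b1) (c + 1) := by
  have hc := h.wcont (-(d:ℝ)/2)
  have hcp : 0 < c := h.apos.trans_le h.ac
  refine ⟨by linarith, fun t => ?_, fun t => ?_, ?_, fun t ht => ?_, fun t ht => ?_, fun t ht => ?_⟩
  · unfold tf0 tf1
    exact intervalIntegral.integral_hasDerivAt_left (hc.intervalIntegrable _ _)
      hc.measurable.stronglyMeasurable.stronglyMeasurableAtFilter hc.continuousAt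
  · by_cases ht : t < a
    · have h1 : tf1 d b =ᶠ[nhds t] fun _ => 0 := by
        filter_upwards [Iio_mem_nhds ht] with s hs
        simp [tf1, h.z1 s (le_of_lt hs)]
      have h2 : tf2 d b b1 t = 0 := by simp [tf2, h.z1 t ht.le, h.b1_left ht]
      rw [h2]
      exact (hasDerivAt_const t (0:ℝ)).congr_of_eventuallyEq h1
    · have htp : 0 < t := lt_of_lt_of_le h.apos (not_lt.1 ht)
      have h1 := ((Real.hasDerivAt_rpow_const (x := t) (p := -(d:ℝ)/2) (Or.inl htp.ne')).mul (h.der t)).neg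
      refine h1.congr_deriv ?_
      unfold tf2; ring
  · unfold tf2
    have h1 := (h.wcont (-(d:ℝ)/2 - 1)).const_mul ((d:ℝ)/2)
    have h2 := h1.sub (h.wcont1 (-(d:ℝ)/2))
    refine h2.congr fun t => ?_
    simp only [Pi.sub_apply]; ring
  · unfold tf0
    rw [intervalIntegral.integral_congr (g := fun _ => (0:ℝ))]
    · simp
    · intro τ hτ
      rw [Set.uIcc_of_ge (by linarith)] at hτ
      simp [h.z2 τ hτ.1]
  · simp [tf1, h.z2 t (by linarith)]
  · simp [tf2, h.z2 t (by linarith), h.b1_right (t := t) (by linarith)]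

lemma TestB.Np_eq {b b1 : ℝ → ℝ} {a c : ℝ} (_h : TestB b b1 a c) {d : ℕ} (hd : 0 < d) :
    Np d (tf1 d b) = 4 * cw d * ∫ t in Set.Ioi (0:ℝ), t ^ (-(d:ℝ)/2) * b t ^ 2 := by
  unfold Np
  rw [polar hd (fun t => 4 * t * tf1 d b t ^ 2), mul_comm 4, mul_assoc]
  congr 1
  rw [← integral_const_mul]
  apply setIntegral_congr_fun measurableSet_Ioi
  intro t ht
  have ht : 0 < t := ht
  simp only [tf1]
  have e : t ^ (-(d:ℝ)/2) * t * t ^ ((d:ℝ)/2 - 1) = 1 := by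
    rw [mul_assoc, ← Real.rpow_one_add' ht.le (by simp; positivity), ← Real.rpow_add ht]
    rw [show -(d:ℝ)/2 + (1 + (d / 2 - 1)) = 0 by ring, Real.rpow_zero]
  linear_combination (4 * t ^ (-(d:ℝ)/2) * b t ^ 2) * e

lemma TestB.Lp_eq {b b1 : ℝ → ℝ} {a c : ℝ} (_h : TestB b b1 a c) {d : ℕ} (hd : 0 < d) (ψ : ℝ → ℝ) :
    Lp (fun x : Eu d => ψ (‖x‖ ^ 2)) (tf1 d b) (tf2 d b b1) = - 4 * cw d * ∫ t in Set.Ioi (0:ℝ), ψ t * b1 t := by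
  unfold Lp
  rw [polar hd (fun t => ψ t * (4 * t * tf2 d b b1 t + 2 * d * tf1 d b t)), mul_comm (-4), mul_assoc]
  congr 1
  rw [← integral_const_mul]
  apply setIntegral_congr_fun measurableSet_Ioi
  intro t ht
  have ht : 0 < t := ht
  simp only [tf1, tf2]
  have e : t ^ (-(d:ℝ)/2) * t * t ^ ((d:ℝ)/2 - 1) = 1 := by
    rw [mul_assoc, ← Real.rpow_one_add' ht.le (by simp; positivity), ← Real.rpow_add ht]
    rw [show -(d:ℝ)/2 + (1 + (d / 2 - 1)) = 0 by ring, Real.rpow_zero]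
  have e2 : t * t ^ (-(d:ℝ)/2 - 1) = t ^ (-(d:ℝ)/2) := by
    rw [Real.rpow_sub_one ht.ne']; field_simp
  linear_combination (-4 * ψ t * b1 t) * e + (2 * d * ψ t * b t * t ^ ((d:ℝ)/2 - 1)) * e2

end GNS

namespace GNS

def st (δ a t : ℝ) : ℝ := Real.smoothTransition ((t - a) / δ)
def st1 (δ a t : ℝ) : ℝ := deriv Real.smoothTransition ((t - a) / δ) / δ

lemma st_der (δ a t : ℝ) : HasDerivAt (st δ a) (st1 δ a t) t := by
  have h1 : HasDerivAt (fun t : ℝ => (t - a) / δ) (1 / δ) t := ((hasDerivAt_id t).sub_const a).div_const δ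
  have h2 := ((Real.smoothTransition.contDiff (n := 1)).differentiable (by simp) ((t - a) / δ)).hasDerivAt
  refine (h2.comp t h1).congr_deriv ?_
  unfold st1; ring

lemma st1_cont (δ a : ℝ) : Continuous (st1 δ a) := by
  have := (Real.smoothTransition.contDiff (n := 1)).continuous_deriv (by simp)
  unfold st1
  fun_prop

lemma st_zero {δ a t : ℝ} (hδ : 0 < δ) (h : t ≤ a) : st δ a t = 0 :=
  Real.smoothTransition.zero_of_nonpos (div_nonpos_of_nonpos_of_nonneg (by linarith) hδ.le)

lemma st_one {δ a t : ℝ} (hδ : 0 < δ) (h : a + δ ≤ t) : st δ a t = 1 :=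
  Real.smoothTransition.one_of_one_le (by rw [le_div_iff₀ hδ]; linarith)

lemma st_nonneg (δ a t : ℝ) : 0 ≤ st δ a t := Real.smoothTransition.nonneg _
lemma st_le_one (δ a t : ℝ) : st δ a t ≤ 1 := Real.smoothTransition.le_one _

lemma st1_nonneg {δ : ℝ} (hδ : 0 < δ) (a t : ℝ) : 0 ≤ st1 δ a t :=
  div_nonneg (Real.smoothTransition.monotone.deriv_nonneg) hδ.le

lemma st1_left {δ a t : ℝ} (hδ : 0 < δ) (h : t < a) : st1 δ a t = 0 := by
  have h1 : st δ a =ᶠ[nhds t] fun _ => 0 := by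
    filter_upwards [Iio_mem_nhds h] with s hs using st_zero hδ (le_of_lt hs)
  exact (st_der δ a t).unique ((hasDerivAt_const t (0:ℝ)).congr_of_eventuallyEq h1)

lemma st1_right {δ a t : ℝ} (hδ : 0 < δ) (h : a + δ < t) : st1 δ a t = 0 := by
  have h1 : st δ a =ᶠ[nhds t] fun _ => 1 := by
    filter_upwards [Ioi_mem_nhds h] with s hs using st_one hδ (le_of_lt hs)
  exact (st_der δ a t).unique ((hasDerivAt_const t (1:ℝ)).congr_of_eventuallyEq h1)

lemma st_int {ψ : ℝ → ℝ} (hψ : AntitoneOn ψ (Set.Ioi 0)) {δ a : ℝ} (hδ : 0 < δ) (ha : 0 < a) :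
    IntegrableOn (fun t => ψ t * st1 δ a t) (Set.Ioi 0) ∧
    ψ (a + δ) ≤ ∫ t in Set.Ioi (0:ℝ), ψ t * st1 δ a t ∧ ∫ t in Set.Ioi (0:ℝ), ψ t * st1 δ a t ≤ ψ a := by
  have hle : a ≤ a + δ := by linarith
  have hsub : Set.Icc a (a + δ) ⊆ Set.Ioi 0 := fun t ht => lt_of_lt_of_le ha ht.1
  have hz : ∀ t ∈ Set.Ioi (0:ℝ) \ Set.Icc a (a + δ), ψ t * st1 δ a t = 0 := by
    intro t ht
    have : st1 δ a t = 0 := by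
      by_cases h : t < a
      · exact st1_left hδ h
      · refine st1_right hδ ?_
        by_contra h2
        exact ht.2 ⟨not_lt.1 h, not_lt.1 h2⟩
    simp [this]
  have hii : IntervalIntegrable ψ volume a (a + δ) := by
    apply AntitoneOn.intervalIntegrable
    rw [Set.uIcc_of_le hle]; exact hψ.mono hsub
  have hI : IntervalIntegrable (fun t => ψ t * st1 δ a t) volume a (a + δ) :=
    hii.mul_continuousOn (st1_cont δ a).continuousOn
  have hI1 : IntegrableOn (fun t => ψ t * st1 δ a t) (Set.Icc a (a + δ)) := by
    rw [integrableOn_Icc_iff_integrableOn_Ioc]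
    exact (intervalIntegrable_iff_integrableOn_Ioc_of_le hle).1 hI
  have e : ∫ t in Set.Ioi (0:ℝ), ψ t * st1 δ a t = ∫ t in a..(a + δ), ψ t * st1 δ a t := by
    rw [intervalIntegral.integral_of_le hle, ← integral_Icc_eq_integral_Ioc]
    exact setIntegral_eq_of_subset_of_forall_sdiff_eq_zero measurableSet_Ioi hsub hz
  have hone : ∀ C : ℝ, ∫ t in a..(a + δ), C * st1 δ a t = C := by
    intro C
    rw [intervalIntegral.integral_const_mul, intervalIntegral.integral_eq_sub_of_hasDerivAt (f := st δ a)
      (fun t _ => st_der δ a t) ((st1_cont δ a).intervalIntegrable _ _), st_one hδ le_rfl, st_zero hδ le_rfl]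
    ring
  have hc : ∀ C : ℝ, IntervalIntegrable (fun t => C * st1 δ a t) volume a (a + δ) := fun C =>
    ((st1_cont δ a).const_mul C).intervalIntegrable _ _
  refine ⟨hI1.of_forall_sdiff_eq_zero measurableSet_Ioi hz, ?_, ?_⟩
  · rw [e]
    conv_lhs => rw [← hone (ψ (a + δ))]
    apply intervalIntegral.integral_mono_on hle (hc _) hI
    intro t ht
    exact mul_le_mul_of_nonneg_right (hψ (hsub ht) (hsub ⟨hle, le_rfl⟩) ht.2) (st1_nonneg hδ a t)
  · rw [e]
    conv_rhs => rw [← hone (ψ a)]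
    apply intervalIntegral.integral_mono_on hle hI (hc _)
    intro t ht
    exact mul_le_mul_of_nonneg_right (hψ (hsub ⟨le_rfl, hle⟩) (hsub ht) ht.1) (st1_nonneg hδ a t)

def bp (δ a c t : ℝ) : ℝ := st δ a t - st δ c t
def bp1 (δ a c t : ℝ) : ℝ := st1 δ a t - st1 δ c t

lemma bp_nonneg {δ a c : ℝ} (hδ : 0 < δ) (h : a ≤ c) (t : ℝ) : 0 ≤ bp δ a c t := by
  unfold bp st
  have : (t - c) / δ ≤ (t - a) / δ := by gcongr
  have := Real.smoothTransition.monotone this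
  linarith

lemma bp_le_one (δ a c t : ℝ) : bp δ a c t ≤ 1 := by
  unfold bp
  linarith [st_nonneg δ c t, st_le_one δ a t]

lemma bp_test {δ a c : ℝ} (hδ : 0 < δ) (ha : 0 < a) (h : a ≤ c) : TestB (bp δ a c) (bp1 δ a c) a (c + δ) where
  apos := ha
  ac := by linarith
  der t := (st_der δ a t).sub (st_der δ c t)
  cont := (st1_cont δ a).sub (st1_cont δ c)
  z1 t ht := by simp [bp, st_zero hδ ht, st_zero hδ (ht.trans h)]
  z2 t ht := by simp [bp, st_one hδ ht, st_one hδ (show a + δ ≤ t by linarith)]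

lemma bp_int {ψ : ℝ → ℝ} (hψ : AntitoneOn ψ (Set.Ioi 0)) {δ a c : ℝ} (hδ : 0 < δ) (ha : 0 < a) (h : a ≤ c) :
    ψ (a + δ) - ψ c ≤ ∫ t in Set.Ioi (0:ℝ), ψ t * bp1 δ a c t ∧
    ∫ t in Set.Ioi (0:ℝ), ψ t * bp1 δ a c t ≤ ψ a - ψ (c + δ) := by
  obtain ⟨i1, l1, u1⟩ := st_int hψ hδ ha
  obtain ⟨i2, l2, u2⟩ := st_int hψ hδ (ha.trans_le h)
  have : ∫ t in Set.Ioi (0:ℝ), ψ t * bp1 δ a c t =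
      (∫ t in Set.Ioi (0:ℝ), ψ t * st1 δ a t) - ∫ t in Set.Ioi (0:ℝ), ψ t * st1 δ c t := by
    rw [← integral_sub i1 i2]
    congr 1; ext t; unfold bp1; ring
  rw [this]
  constructor <;> linarith

structure Rad (d : ℕ) (ψ : ℝ → ℝ) : Prop where
  meas : Measurable ψ
  nonneg : ∀ t, 0 ≤ ψ t
  anti : AntitoneOn ψ (Set.Ioi 0)
  int : ∫⁻ x : Eu d, ENNReal.ofReal (ψ (‖x‖ ^ 2)) ≤ 1
  dir : Dir (fun x : Eu d => ψ (‖x‖ ^ 2)) ≤ 1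

lemma Rad.measE {d : ℕ} {ψ : ℝ → ℝ} (h : Rad d ψ) : Measurable (fun x : Eu d => ψ (‖x‖ ^ 2)) :=
  h.meas.comp (by fun_prop)

lemma Rad.integrable {d : ℕ} {ψ : ℝ → ℝ} (h : Rad d ψ) : Integrable (fun x : Eu d => ψ (‖x‖ ^ 2)) := by
  refine ⟨h.measE.aestronglyMeasurable, ?_⟩
  rw [hasFiniteIntegral_iff_ofReal (Filter.Eventually.of_forall fun x => h.nonneg _)]
  exact h.int.trans_lt ENNReal.one_lt_top

lemma Rad.integral_le {d : ℕ} {ψ : ℝ → ℝ} (h : Rad d ψ) : ∫ x : Eu d, ψ (‖x‖ ^ 2) ≤ 1 := by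
  rw [integral_eq_lintegral_of_nonneg_ae (Filter.Eventually.of_forall fun x => h.nonneg _) h.measE.aestronglyMeasurable]
  exact ENNReal.toReal_le_of_le_ofReal zero_le_one (by simpa using h.int)

lemma Rad.diff {d : ℕ} (hd : 0 < d) {ψ : ℝ → ℝ} (h : Rad d ψ) {δ a c : ℝ} (hδ : 0 < δ) (ha : 0 < a) (hac : a + δ ≤ c) :
    4 * kap d * cw d * (ψ (a + δ) - ψ c) ^ 2 ≤ ∫ t in Set.Ioi (0:ℝ), t ^ (-(d:ℝ)/2) * bp δ a c t ^ 2 := by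
  have hb := bp_test hδ ha (show a ≤ c by linarith)
  have h1 := Lp_sq_le hd h.measE h.integrable zero_le_one (by simpa using h.dir) (hb.testF d)
  rw [hb.Lp_eq hd ψ, hb.Np_eq hd] at h1
  have h2 := (bp_int h.anti hδ ha (show a ≤ c by linarith)).1
  have h3 : 0 ≤ ψ (a + δ) - ψ c :=
    sub_nonneg.2 (h.anti (show a + δ ∈ Set.Ioi (0:ℝ) from add_pos ha hδ) (show c ∈ Set.Ioi (0:ℝ) from (add_pos ha hδ).trans_le hac) hac)
  have h4 : (ψ (a + δ) - ψ c) ^ 2 ≤ (∫ t in Set.Ioi (0:ℝ), ψ t * bp1 δ a c t) ^ 2 := pow_le_pow_left₀ h3 h2 2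
  have hc := cw_pos hd
  have hk := kap_pos hd
  have h5 : 4 * kap d * cw d * (∫ t in Set.Ioi (0:ℝ), ψ t * bp1 δ a c t) ^ 2 ≤ ∫ t in Set.Ioi (0:ℝ), t ^ (-(d:ℝ)/2) * bp δ a c t ^ 2 := by
    have : 0 < 4 * cw d := by positivity
    refine le_of_mul_le_mul_left ?_ this
    linarith
  refine le_trans ?_ h5
  gcongr

lemma bp_sq_int {d : ℕ} {δ a c : ℝ} (hδ : 0 < δ) (ha : 0 < a) (hac : a ≤ c) :
    IntegrableOn (fun t => t ^ (-(d:ℝ)/2) * bp δ a c t ^ 2) (Set.Ioi 0) ∧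
    ∫ t in Set.Ioi (0:ℝ), t ^ (-(d:ℝ)/2) * bp δ a c t ^ 2 = ∫ t in Set.Icc a (c + δ), t ^ (-(d:ℝ)/2) * bp δ a c t ^ 2 := by
  have hb := bp_test hδ ha hac
  have hsub : Set.Icc a (c + δ) ⊆ Set.Ioi 0 := fun t ht => lt_of_lt_of_le ha ht.1
  have hz : ∀ t ∈ Set.Ioi (0:ℝ) \ Set.Icc a (c + δ), t ^ (-(d:ℝ)/2) * bp δ a c t ^ 2 = 0 := by
    intro t ht
    have : bp δ a c t = 0 := by
      by_cases h : t < a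
      · exact hb.z1 t h.le
      · refine hb.z2 t ?_
        by_contra h2
        exact ht.2 ⟨not_lt.1 h, (not_le.1 h2).le⟩
    simp [this]
  have hc : Continuous (fun t => t ^ (-(d:ℝ)/2) * bp δ a c t ^ 2) := by
    have := (hb.wcont (-(d:ℝ)/2)).mul hb.bcont
    refine this.congr fun t => by simp only [Pi.mul_apply]; ring
  exact ⟨hc.continuousOn.integrableOn_Icc.of_forall_sdiff_eq_zero measurableSet_Ioi hz,
    setIntegral_eq_of_subset_of_forall_sdiff_eq_zero measurableSet_Ioi hsub hz⟩

lemma bp_sq_le {δ a c : ℝ} (hδ : 0 < δ) (hac : a ≤ c) (t : ℝ) : bp δ a c t ^ 2 ≤ 1 := by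
  have := bp_nonneg hδ hac t
  have := bp_le_one δ a c t
  nlinarith

lemma Rad.holder {d : ℕ} (hd : 0 < d) {ψ : ℝ → ℝ} (h : Rad d ψ) {a c : ℝ} (ha : 0 < a) (hac : a ≤ c) :
    4 * kap d * cw d * (ψ a - ψ c) ^ 2 ≤ (c - a) * a ^ (-(d:ℝ)/2) := by
  have key : ∀ δ, 0 < δ → δ < a → 4 * kap d * cw d * (ψ a - ψ c) ^ 2 ≤ (c - a + 2 * δ) * (a - δ) ^ (-(d:ℝ)/2) := by
    intro δ hδ hδa
    have h1 := h.diff hd hδ (show 0 < a - δ by linarith) (show a - δ + δ ≤ c by linarith)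
    rw [show a - δ + δ = a by ring] at h1
    refine h1.trans ?_
    have hac' : a - δ ≤ c := by linarith
    obtain ⟨i, e⟩ := bp_sq_int (d := d) hδ (show 0 < a - δ by linarith) hac'
    rw [e]
    have : ∫ t in Set.Icc (a - δ) (c + δ), (a - δ) ^ (-(d:ℝ)/2) = (c - a + 2 * δ) * (a - δ) ^ (-(d:ℝ)/2) := by
      rw [setIntegral_const, measureReal_def, Real.volume_Icc, ENNReal.toReal_ofReal (by linarith), smul_eq_mul]
      ring
    rw [← this]
    apply setIntegral_mono_on (i.mono_set fun t ht => lt_of_lt_of_le (show 0 < a - δ by linarith) ht.1) _ measurableSet_Icc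
    · intro t ht
      have h2 : t ^ (-(d:ℝ)/2) ≤ (a - δ) ^ (-(d:ℝ)/2) :=
        Real.rpow_le_rpow_of_nonpos (by linarith) ht.1 (by have : (0:ℝ) ≤ d := by positivity
                                                           linarith)
      calc _ ≤ t ^ (-(d:ℝ)/2) * 1 := by
            apply mul_le_mul_of_nonneg_left (bp_sq_le hδ hac' t)
            exact Real.rpow_nonneg (by linarith [ht.1]) _
        _ ≤ _ := by linarith
    · exact integrableOn_const (by simp)
  have hlim : Filter.Tendsto (fun δ : ℝ => (c - a + 2 * δ) * (a - δ) ^ (-(d:ℝ)/2)) (nhdsWithin 0 (Set.Ioi 0))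
      (nhds ((c - a + 2 * 0) * (a - 0) ^ (-(d:ℝ)/2))) := by
    apply Filter.Tendsto.mono_left _ nhdsWithin_le_nhds
    apply ContinuousAt.tendsto (f := fun δ : ℝ => (c - a + 2 * δ) * (a - δ) ^ (-(d:ℝ)/2))
    apply ContinuousAt.mul (by fun_prop)
    exact ContinuousAt.rpow_const (by fun_prop) (Or.inl (by simpa using ha.ne'))
  have := ge_of_tendsto hlim (b := 4 * kap d * cw d * (ψ a - ψ c) ^ 2) (by
    filter_upwards [Ioo_mem_nhdsGT ha] with δ hδ using key δ hδ.1 hδ.2)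
  simpa using this

lemma Rad.cont {d : ℕ} (hd : 0 < d) {ψ : ℝ → ℝ} (h : Rad d ψ) : ContinuousOn ψ (Set.Ioi 0) := by
  intro t ht
  have ht : 0 < t := ht
  apply ContinuousAt.continuousWithinAt
  set B := (t/2) ^ (-(d:ℝ)/2) / (4 * kap d * cw d)
  have hk := kap_pos hd
  have hc := cw_pos hd
  have key : ∀ s, t/2 < s → |ψ s - ψ t| ≤ √(B * |s - t|) := by
    have aux : ∀ a c, t/2 < a → a ≤ c → |ψ a - ψ c| ≤ √(B * |a - c|) := by
      intro a c ha hac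
      apply Real.abs_le_sqrt
      have h1 := h.holder hd (show 0 < a by linarith) hac
      have h2 : a ^ (-(d:ℝ)/2) ≤ (t/2) ^ (-(d:ℝ)/2) :=
        Real.rpow_le_rpow_of_nonpos (by linarith) ha.le (by have : (0:ℝ) ≤ d := by positivity
                                                            linarith)
      rw [abs_sub_comm, abs_of_nonneg (by linarith : 0 ≤ c - a)]
      have h3 : 4 * kap d * cw d * (ψ a - ψ c) ^ 2 ≤ (c - a) * (t/2) ^ (-(d:ℝ)/2) :=
        h1.trans (mul_le_mul_of_nonneg_left h2 (by linarith))
      have : 0 < 4 * kap d * cw d := by positivity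
      rw [div_mul_eq_mul_div, le_div_iff₀ this]
      linarith
    intro s hs
    rcases le_total s t with h1 | h1
    · exact aux s t hs h1
    · rw [abs_sub_comm, abs_sub_comm s]; exact aux t s (by linarith) h1
  have hlim : Filter.Tendsto (fun s => √(B * |s - t|)) (nhds t) (nhds 0) := by
    have : Continuous (fun s => √(B * |s - t|)) := by fun_prop
    simpa using this.tendsto t
  rw [ContinuousAt, tendsto_iff_dist_tendsto_zero]
  refine squeeze_zero' (Filter.Eventually.of_forall fun s => dist_nonneg) ?_ hlim
  filter_upwards [Ioi_mem_nhds (show t/2 < t by linarith)] with s hs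
  rw [Real.dist_eq]; exact key s hs

lemma Rad.decay1 {d : ℕ} (hd : 0 < d) {ψ : ℝ → ℝ} (h : Rad d ψ) {t : ℝ} (ht : 0 < t) :
    ψ t ≤ (d / (2 * cw d)) * t ^ (-(d:ℝ)/2) := by
  have hc := cw_pos hd
  have hdp : (0:ℝ) < d := by exact_mod_cast hd
  have h1 := h.integral_le
  have hi := (polar_int hd ψ).1 h.integrable
  rw [polar hd ψ] at h1
  have h2 : ψ t * (t ^ ((d:ℝ)/2) / (d/2)) ≤ ∫ s in Set.Ioi (0:ℝ), ψ s * s ^ ((d:ℝ)/2 - 1) := by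
    have e : ∫ s in Set.Ioc (0:ℝ) t, ψ t * s ^ ((d:ℝ)/2 - 1) = ψ t * (t ^ ((d:ℝ)/2) / (d/2)) := by
      rw [← intervalIntegral.integral_of_le ht.le, intervalIntegral.integral_const_mul, integral_rpow (Or.inl (by linarith [half_pos hdp]))]
      rw [sub_add_cancel, Real.zero_rpow (by positivity), sub_zero]
    rw [← e]
    have hsub : Set.Ioc (0:ℝ) t ⊆ Set.Ioi 0 := fun s hs => hs.1
    calc _ ≤ ∫ s in Set.Ioc (0:ℝ) t, ψ s * s ^ ((d:ℝ)/2 - 1) := by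
          apply setIntegral_mono_on _ (hi.mono_set hsub) measurableSet_Ioc
          · intro s hs
            exact mul_le_mul_of_nonneg_right (h.anti hs.1 (show t ∈ Set.Ioi (0:ℝ) from ht) hs.2) (Real.rpow_nonneg hs.1.le _)
          · apply Integrable.const_mul
            rw [← IntegrableOn, ← intervalIntegrable_iff_integrableOn_Ioc_of_le ht.le]
            exact intervalIntegral.intervalIntegrable_rpow' (by linarith [half_pos hdp])
      _ ≤ _ := by
          apply setIntegral_mono_set hi
          · filter_upwards [self_mem_ae_restrict measurableSet_Ioi] with s hs
            exact mul_nonneg (h.nonneg _) (Real.rpow_nonneg (le_of_lt hs) _)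
          · exact hsub.eventuallyLE
  have h3 : cw d * (ψ t * (t ^ ((d:ℝ)/2) / (d/2))) ≤ 1 := (mul_le_mul_of_nonneg_left h2 hc.le).trans h1
  have htp : 0 < t ^ ((d:ℝ)/2) := Real.rpow_pos_of_pos ht _
  rw [neg_div, Real.rpow_neg ht.le, ← div_eq_mul_inv, le_div_iff₀ htp, le_div_iff₀ (by positivity)]
  have : cw d * (ψ t * (t ^ ((d:ℝ)/2) / (d/2))) = (ψ t * t ^ ((d:ℝ)/2) * (2 * cw d)) / d := by field_simp
  rw [this, div_le_one hdp] at h3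
  exact h3

lemma Rad.tendsto_zero {d : ℕ} (hd : 0 < d) {ψ : ℝ → ℝ} (h : Rad d ψ) : Filter.Tendsto ψ Filter.atTop (nhds 0) := by
  have hdp : (0:ℝ) < d := by exact_mod_cast hd
  have hl : Filter.Tendsto (fun t : ℝ => (d / (2 * cw d)) * t ^ (-(d:ℝ)/2)) Filter.atTop (nhds 0) := by
    have := (tendsto_rpow_neg_atTop (show 0 < (d:ℝ)/2 by positivity)).const_mul (d / (2 * cw d))
    simpa [neg_div] using this
  refine squeeze_zero' (Filter.Eventually.of_forall h.nonneg) ?_ hl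
  filter_upwards [Filter.eventually_gt_atTop 0] with t ht using h.decay1 hd ht

lemma Rad.decay2 {d : ℕ} (hd : 3 ≤ d) : ∃ C : ℝ, 0 < C ∧ ∀ ψ : ℝ → ℝ, Rad d ψ → ∀ t, 0 < t → ψ t ≤ C * t ^ (-((d:ℝ) - 2) / 4) := by
  have hd0 : 0 < d := by omega
  have hd3 : (3:ℝ) ≤ d := by exact_mod_cast hd
  have hc := cw_pos hd0
  have hk := kap_pos hd0
  set E := (1/2:ℝ) ^ (-(d:ℝ)/2 + 1) / ((d:ℝ)/2 - 1) / (4 * kap d * cw d)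
  have hE : 0 < E := by
    have : 0 < (d:ℝ)/2 - 1 := by linarith
    positivity
  refine ⟨√E, Real.sqrt_pos.2 hE, fun ψ h t ht => ?_⟩
  have key : ∀ c, t ≤ c → 4 * kap d * cw d * (ψ t - ψ c) ^ 2 ≤ (t/2) ^ (-(d:ℝ)/2 + 1) / ((d:ℝ)/2 - 1) := by
    intro c hc
    have h1 := h.diff hd0 (half_pos ht) (half_pos ht) (show t/2 + t/2 ≤ c by linarith)
    rw [add_halves] at h1
    refine h1.trans ?_
    have hac : t/2 ≤ c := by linarith
    obtain ⟨i, e⟩ := bp_sq_int (d := d) (half_pos ht) (half_pos ht) hac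
    have hlt : -(d:ℝ)/2 < -1 := by linarith
    have e2 := integral_Ioi_rpow_of_lt hlt (half_pos ht)
    have e3 : (t/2) ^ (-(d:ℝ)/2 + 1) / ((d:ℝ)/2 - 1) = -(t/2) ^ (-(d:ℝ)/2 + 1) / (-(d:ℝ)/2 + 1) := by
      rw [show -(d:ℝ)/2 + 1 = -((d:ℝ)/2 - 1) by ring, neg_div_neg_eq]
    have i2 := integrableOn_Ioi_rpow_of_lt hlt (half_pos ht)
    rw [e, e3, ← e2, integral_Icc_eq_integral_Ioc]
    calc _ ≤ ∫ s in Set.Ioc (t/2) (c + t/2), s ^ (-(d:ℝ)/2) := by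
          apply setIntegral_mono_on (i.mono_set fun s hs => lt_trans (half_pos ht) hs.1)
            (i2.mono_set fun s hs => hs.1) measurableSet_Ioc
          intro s hs
          have : 0 ≤ s ^ (-(d:ℝ)/2) := Real.rpow_nonneg (by linarith [hs.1]) _
          have := mul_le_mul_of_nonneg_left (bp_sq_le (half_pos ht) hac s) this
          linarith
      _ ≤ _ := by
          apply setIntegral_mono_set i2
          · filter_upwards [self_mem_ae_restrict measurableSet_Ioi] with s hs
            exact Real.rpow_nonneg (by have : t/2 < s := hs
                                       linarith) _
          · exact Filter.Eventually.of_forall fun s hs => hs.1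
  have hlim : Filter.Tendsto (fun c => 4 * kap d * cw d * (ψ t - ψ c) ^ 2) Filter.atTop (nhds (4 * kap d * cw d * (ψ t - 0) ^ 2)) :=
    (((h.tendsto_zero hd0).const_sub (ψ t)).pow 2).const_mul _
  have h2 := le_of_tendsto hlim (by filter_upwards [Filter.eventually_ge_atTop t] with c hc using key c hc)
  have h3 : ψ t ^ 2 ≤ E * t ^ (-((d:ℝ) - 2) / 2) := by
    have e4 : (t/2) ^ (-(d:ℝ)/2 + 1) = (1/2) ^ (-(d:ℝ)/2 + 1) * t ^ (-((d:ℝ) - 2) / 2) := by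
      rw [show t/2 = (1/2) * t by ring, Real.mul_rpow (by norm_num) ht.le]
      congr 2; ring
    rw [e4, sub_zero] at h2
    have hp : 0 < 4 * kap d * cw d := by positivity
    have : E * t ^ (-((d:ℝ) - 2) / 2) = ((1/2) ^ (-(d:ℝ)/2 + 1) * t ^ (-((d:ℝ) - 2) / 2) / ((d:ℝ)/2 - 1)) / (4 * kap d * cw d) := by
      simp only [E]; ring
    rw [this, le_div_iff₀ hp]
    linarith
  have h4 : ψ t ≤ √(E * t ^ (-((d:ℝ) - 2) / 2)) := Real.le_sqrt_of_sq_le h3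
  refine h4.trans (le_of_eq ?_)
  rw [Real.sqrt_mul hE.le, Real.sqrt_eq_rpow (t ^ _), ← Real.rpow_mul ht.le]
  congr 2; ring

end GNS

namespace GNS

lemma to_rad {d : ℕ} (hd : 0 < d) {p : ℝ} (hp : 0 < p) {u : Eu d → ℝ} (hm : Measurable u) (hu : ∀ x, 0 ≤ u x)
    (h1 : ∫⁻ x, ENNReal.ofReal (u x) ≤ 1) (h2 : Dir u ≤ 1) {K : ENNReal}
    (hK : K < ∫⁻ x, ENNReal.ofReal (u x ^ p)) :
    ∃ ψ, Rad d ψ ∧ K ≤ ∫⁻ x : Eu d, ENNReal.ofReal (ψ (‖x‖ ^ 2) ^ p) := by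
  have hi : Integrable u := by
    refine ⟨hm.aestronglyMeasurable, ?_⟩
    rw [hasFiniteIntegral_iff_ofReal (Filter.Eventually.of_forall hu)]
    exact h1.trans_lt ENNReal.one_lt_top
  obtain ⟨L, R, M, v, -, hv, hmono⟩ := radial_exists hp hm hu hi hK
  have hle : ∀ x y, ‖x‖ = ‖y‖ → v x ≤ v y := by
    intro x y hxy
    by_cases hx : x = 0
    · have : y = 0 := by rw [hx, norm_zero] at hxy; exact norm_eq_zero.1 hxy.symm
      rw [hx, this]
    have hxp : 0 < ‖x‖ := norm_pos_iff.2 hx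
    have hlim : Filter.Tendsto (fun s : ℝ => v (s • x)) (nhdsWithin 1 (Set.Ioi 1)) (nhds (v x)) := by
      have : Continuous (fun s : ℝ => v (s • x)) := hv.cont.comp (by fun_prop)
      have := this.tendsto 1
      rw [one_smul] at this
      exact this.mono_left nhdsWithin_le_nhds
    refine le_of_tendsto hlim ?_
    filter_upwards [self_mem_nhdsWithin] with s hs
    apply hmono
    have hs : 1 < s := hs
    rw [norm_smul, ← hxy, Real.norm_of_nonneg (by linarith)]
    nlinarith
  have heq : ∀ x y, ‖x‖ = ‖y‖ → v x = v y := fun x y h => le_antisymm (hle x y h) (hle y x h.symm)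
  set e : Eu d := EuclideanSpace.single ⟨0, hd⟩ (1:ℝ)
  have he : ‖e‖ = 1 := by simp [e]
  have hψ : ∀ x : Eu d, v (√(‖x‖ ^ 2) • e) = v x := by
    intro x
    apply heq
    rw [norm_smul, he, Real.sqrt_sq (norm_nonneg _)]; simp
  refine ⟨fun t => v (√t • e), ⟨?_, fun t => hv.nonneg _, ?_, ?_, ?_⟩, ?_⟩
  · have : Continuous (fun t : ℝ => v (√t • e)) := hv.cont.comp (by fun_prop)
    exact this.measurable
  · intro s _ t _ hst
    rcases hst.eq_or_lt with h | h
    · rw [h]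
    · apply hmono
      rw [norm_smul, norm_smul, he, mul_one, mul_one, Real.norm_of_nonneg (Real.sqrt_nonneg _), Real.norm_of_nonneg (Real.sqrt_nonneg _)]
      have hs : 0 < s := by assumption
      exact Real.sqrt_lt_sqrt hs.le h
  · simp only [hψ]; exact hv.int.trans h1
  · simp only [hψ]; exact hv.dir.trans h2
  · simp only [hψ]; exact hv.pw

def SS (d : ℕ) (p : ℝ) : ENNReal := ⨆ ψ : {ψ : ℝ → ℝ // Rad d ψ}, ∫⁻ x : Eu d, ENNReal.ofReal (ψ.1 (‖x‖ ^ 2) ^ p)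

lemma le_SS {d : ℕ} (hd : 0 < d) {p : ℝ} (hp : 0 < p) {u : Eu d → ℝ} (hm : Measurable u) (hu : ∀ x, 0 ≤ u x)
    (h1 : ∫⁻ x, ENNReal.ofReal (u x) ≤ 1) (h2 : Dir u ≤ 1) : ∫⁻ x, ENNReal.ofReal (u x ^ p) ≤ SS d p := by
  refine le_of_forall_lt fun K hK => ?_
  obtain ⟨K', hK1, hK2⟩ := exists_between hK
  obtain ⟨ψ, h3, h4⟩ := to_rad hd hp hm hu h1 h2 hK2
  exact hK1.trans_le (h4.trans (le_iSup (fun ψ : {ψ : ℝ → ℝ // Rad d ψ} => ∫⁻ x : Eu d, ENNReal.ofReal (ψ.1 (‖x‖ ^ 2) ^ p)) ⟨ψ, h3⟩))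

lemma Rad.equi {d : ℕ} (hd : 0 < d) {t : ℝ} (ht : 0 < t) :
    ∃ B : ℝ, ∀ ψ, Rad d ψ → ∀ s, t/2 < s → |ψ s - ψ t| ≤ √(B * |s - t|) := by
  set B := (t/2) ^ (-(d:ℝ)/2) / (4 * kap d * cw d)
  have hk := kap_pos hd
  have hc := cw_pos hd
  refine ⟨B, fun ψ h => ?_⟩
  have aux : ∀ a c, t/2 < a → a ≤ c → |ψ a - ψ c| ≤ √(B * |a - c|) := by
    intro a c ha hac
    apply Real.abs_le_sqrt
    have h1 := h.holder hd (show 0 < a by linarith) hac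
    have h2 : a ^ (-(d:ℝ)/2) ≤ (t/2) ^ (-(d:ℝ)/2) :=
      Real.rpow_le_rpow_of_nonpos (by linarith) ha.le (by have : (0:ℝ) ≤ d := by positivity
                                                          linarith)
    rw [abs_sub_comm, abs_of_nonneg (by linarith : 0 ≤ c - a)]
    have h3 : 4 * kap d * cw d * (ψ a - ψ c) ^ 2 ≤ (c - a) * (t/2) ^ (-(d:ℝ)/2) :=
      h1.trans (mul_le_mul_of_nonneg_left h2 (by linarith))
    have : 0 < 4 * kap d * cw d := by positivity
    rw [div_mul_eq_mul_div, le_div_iff₀ this]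
    linarith
  intro s hs
  rcases le_total s t with h1 | h1
  · exact aux s t hs h1
  · rw [abs_sub_comm, abs_sub_comm s]; exact aux t s (by linarith) h1

lemma helly {d : ℕ} (hd : 0 < d) {ψ : ℕ → ℝ → ℝ} (h : ∀ n, Rad d (ψ n)) :
    ∃ φ : ℕ → ℕ, StrictMono φ ∧ ∃ ξ : ℝ → ℝ, Rad d ξ ∧
      ∀ t, 0 < t → Filter.Tendsto (fun n => ψ (φ n) t) Filter.atTop (nhds (ξ t)) := by
  let I := {q : ℚ // 0 < q}
  let M : I → ℝ := fun q => (d / (2 * cw d)) * (q.1 : ℝ) ^ (-(d:ℝ)/2)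
  have hc : IsCompact (Set.pi Set.univ (fun q : I => Set.Icc (0 : ℝ) (M q))) :=
    isCompact_univ_pi fun _ => isCompact_Icc
  obtain ⟨f, -, φ, hφ, hf⟩ := hc.tendsto_subseq (x := fun n (q : I) => ψ n (q.1 : ℝ))
    (fun n => by
      intro q _
      exact ⟨(h n).nonneg _, (h n).decay1 hd (by exact_mod_cast q.2)⟩)
  rw [tendsto_pi_nhds] at hf
  have hcau : ∀ t, 0 < t → ∃ l, Filter.Tendsto (fun n => ψ (φ n) t) Filter.atTop (nhds l) := by
    intro t ht
    apply cauchySeq_tendsto_of_complete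
    rw [Metric.cauchySeq_iff']
    intro ε hε
    obtain ⟨B, hB⟩ := Rad.equi hd ht
    have hlim : Filter.Tendsto (fun s => √(B * |s - t|)) (nhds t) (nhds 0) := by
      have : Continuous (fun s => √(B * |s - t|)) := by fun_prop
      simpa using this.tendsto t
    have hev : ∀ᶠ s in nhds t, √(B * |s - t|) < ε / 3 ∧ t / 2 < s :=
      (hlim.eventually (gt_mem_nhds (by positivity))).and (Ioi_mem_nhds (by linarith))
    obtain ⟨r, hr, hr2⟩ := Metric.eventually_nhds_iff.1 hev
    obtain ⟨q, hq1, hq2⟩ := exists_rat_btwn (show t < t + r by linarith)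
    obtain ⟨hq3, hq4⟩ := hr2 (show dist (q:ℝ) t < r by rw [Real.dist_eq, abs_lt]; constructor <;> linarith)
    have hqp : 0 < q := by
      have : (0:ℝ) < q := by linarith
      exact_mod_cast this
    have hcq : CauchySeq (fun n => ψ (φ n) (q:ℝ)) := (hf ⟨q, hqp⟩).cauchySeq
    obtain ⟨N, hN⟩ := Metric.cauchySeq_iff'.1 hcq (ε/3) (by positivity)
    refine ⟨N, fun n hn => ?_⟩
    have h1 := hN n hn
    have h2 := hB _ (h (φ n)) q hq4
    have h3 := hB _ (h (φ N)) q hq4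
    rw [Real.dist_eq, abs_lt] at *
    rw [abs_le] at h2 h3
    constructor <;> linarith
  choose! ξ hξ using hcau
  let ζ : ℝ → ℝ := (Set.Ioi (0:ℝ)).indicator ξ
  have hζ : ∀ t, 0 < t → Filter.Tendsto (fun n => ψ (φ n) t) Filter.atTop (nhds (ζ t)) := by
    intro t ht
    have : ζ t = ξ t := Set.indicator_of_mem (show t ∈ Set.Ioi (0:ℝ) from ht) _
    rw [this]; exact hξ t ht
  have hmeas : Measurable ζ := by
    refine measurable_of_tendsto_metrizable (f := fun n => (Set.Ioi (0:ℝ)).indicator (ψ (φ n)))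
      (fun n => (h _).meas.indicator measurableSet_Ioi) ?_
    rw [tendsto_pi_nhds]
    intro t
    by_cases ht : t ∈ Set.Ioi (0:ℝ)
    · simp only [Set.indicator_of_mem ht]; exact hζ t ht
    · simp only [ζ, Set.indicator_of_notMem ht]; exact tendsto_const_nhds
  have hae : ∀ᵐ x : Eu d, Filter.Tendsto (fun n => ψ (φ n) (‖x‖ ^ 2)) Filter.atTop (nhds (ζ (‖x‖ ^ 2))) := by
    have := nontriv hd
    filter_upwards [Measure.ae_ne (volume : Measure (Eu d)) 0] with x hx
    exact hζ _ (by have := norm_pos_iff.2 hx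
                   positivity)
  refine ⟨φ, hφ, ζ, ⟨hmeas, fun t => ?_, fun s hs t ht hst => ?_, ?_, ?_⟩, hζ⟩
  · by_cases ht : t ∈ Set.Ioi (0:ℝ)
    · exact ge_of_tendsto' (hζ t ht) fun n => (h _).nonneg t
    · simp [ζ, Set.indicator_of_notMem ht]
  · exact le_of_tendsto_of_tendsto' (hζ t ht) (hζ s hs) fun n => (h _).anti hs ht hst
  · calc ∫⁻ x : Eu d, ENNReal.ofReal (ζ (‖x‖ ^ 2))
        = ∫⁻ x : Eu d, Filter.liminf (fun n => ENNReal.ofReal (ψ (φ n) (‖x‖ ^ 2))) Filter.atTop := by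
          apply lintegral_congr_ae
          filter_upwards [hae] with x hx
          exact ((ENNReal.continuous_ofReal.tendsto _).comp hx).liminf_eq.symm
      _ ≤ Filter.liminf (fun n => ∫⁻ x : Eu d, ENNReal.ofReal (ψ (φ n) (‖x‖ ^ 2))) Filter.atTop :=
          lintegral_liminf_le fun n => (h _).measE.ennreal_ofReal
      _ ≤ 1 := by
          refine (Filter.liminf_le_liminf (v := fun _ => (1 : ENNReal)) (Filter.Eventually.of_forall fun n => (h _).int)).trans ?_
          simp
  · exact Dir_lsc (fun n => (h (φ n)).measE) (fun n => (h _).dir) hae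

lemma Rad.zero (d : ℕ) : Rad d (fun _ => 0) where
  meas := measurable_const
  nonneg _ := le_rfl
  anti := fun _ _ _ _ _ => le_rfl
  int := by simp
  dir := by
    refine Dir_le fun ε _ => ?_
    simp [Den, dq]

lemma exists_dom {d : ℕ} (hd : 3 ≤ d) {p : ℝ} (hp1 : 1 < p) (hp2 : p * ((d:ℝ) - 2) < 2 * d) :
    ∃ G : ℝ → ℝ, Measurable G ∧ Integrable (fun x : Eu d => G (‖x‖ ^ 2)) ∧
      ∀ ψ, Rad d ψ → ∀ t, 0 < t → ψ t ^ p ≤ G t := by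
  have hd0 : 0 < d := by omega
  have hd3 : (3:ℝ) ≤ d := by exact_mod_cast hd
  have hc := cw_pos hd0
  obtain ⟨C, hC, hdec⟩ := Rad.decay2 hd
  set C1 := (d / (2 * cw d))
  have hC1 : 0 < C1 := by positivity
  let G : ℝ → ℝ := fun t => if t ≤ 1 then C ^ p * t ^ (-((d:ℝ) - 2) / 4 * p) else C1 ^ p * t ^ (-(d:ℝ)/2 * p)
  refine ⟨G, ?_, ?_, ?_⟩
  · exact Measurable.ite measurableSet_Iic (by fun_prop) (by fun_prop)
  · rw [polar_int hd0]
    rw [← Set.Ioc_union_Ioi_eq_Ioi zero_le_one, integrableOn_union]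
    constructor
    · have : IntegrableOn (fun t : ℝ => C ^ p * t ^ (-((d:ℝ) - 2) / 4 * p + ((d:ℝ)/2 - 1))) (Set.Ioc 0 1) := by
        apply Integrable.const_mul
        rw [← IntegrableOn, ← intervalIntegrable_iff_integrableOn_Ioc_of_le zero_le_one]
        exact intervalIntegral.intervalIntegrable_rpow' (by nlinarith)
      refine (integrableOn_congr_fun ?_ measurableSet_Ioc).2 this
      intro t ht
      simp only [G, if_pos ht.2]
      rw [Real.rpow_add ht.1]; ring
    · have : IntegrableOn (fun t : ℝ => C1 ^ p * t ^ (-(d:ℝ) / 2 * p + ((d:ℝ)/2 - 1))) (Set.Ioi 1) := by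
        apply Integrable.const_mul
        exact integrableOn_Ioi_rpow_of_lt (by nlinarith) one_pos
      refine (integrableOn_congr_fun ?_ measurableSet_Ioi).2 this
      intro t ht
      have ht : 1 < t := ht
      simp only [G, if_neg (not_le.2 ht)]
      rw [Real.rpow_add (by linarith)]; ring
  · intro ψ h t ht
    have hp0 : 0 ≤ p := by linarith
    simp only [G]
    split_ifs with h1
    · rw [Real.rpow_mul ht.le, ← Real.mul_rpow hC.le (Real.rpow_nonneg ht.le _)]
      exact Real.rpow_le_rpow (h.nonneg t) (hdec ψ h t ht) hp0
    · rw [Real.rpow_mul ht.le, ← Real.mul_rpow hC1.le (Real.rpow_nonneg ht.le _)]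
      exact Real.rpow_le_rpow (h.nonneg t) (h.decay1 hd0 ht) hp0

lemma ae_sq_pos {d : ℕ} (hd : 0 < d) : ∀ᵐ x : Eu d, 0 < ‖x‖ ^ 2 := by
  have := nontriv hd
  filter_upwards [Measure.ae_ne (volume : Measure (Eu d)) 0] with x hx
  have := norm_pos_iff.2 hx
  positivity

lemma Rad.pow_int {d : ℕ} (hd : 3 ≤ d) {p : ℝ} (hp1 : 1 < p) (hp2 : p * ((d:ℝ) - 2) < 2 * d) {ψ : ℝ → ℝ} (h : Rad d ψ) :
    Integrable (fun x : Eu d => ψ (‖x‖ ^ 2) ^ p) := by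
  obtain ⟨G, hG, hGi, hle⟩ := exists_dom hd hp1 hp2
  refine hGi.mono' (h.measE.pow_const p).aestronglyMeasurable ?_
  filter_upwards [ae_sq_pos (show 0 < d by omega)] with x hx
  rw [Real.norm_of_nonneg (Real.rpow_nonneg (h.nonneg _) _)]
  exact hle ψ h _ hx

theorem exists_max {d : ℕ} (hd : 3 ≤ d) {p : ℝ} (hp1 : 1 < p) (hp2 : p * ((d:ℝ) - 2) < 2 * d) :
    ∃ ψ, Rad d ψ ∧ ∫⁻ x : Eu d, ENNReal.ofReal (ψ (‖x‖ ^ 2) ^ p) = SS d p := by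
  have hd0 : 0 < d := by omega
  obtain ⟨G, hG, hGi, hle⟩ := exists_dom hd hp1 hp2
  have : Nonempty {ψ : ℝ → ℝ // Rad d ψ} := ⟨⟨_, Rad.zero d⟩⟩
  obtain ⟨w, -, hw1, hw2⟩ := exists_seq_tendsto_sSup
    (S := Set.range (fun ψ : {ψ : ℝ → ℝ // Rad d ψ} => ∫⁻ x : Eu d, ENNReal.ofReal (ψ.1 (‖x‖ ^ 2) ^ p)))
    (Set.range_nonempty _) (OrderTop.bddAbove _)
  choose ψ hψ using hw2
  obtain ⟨φ, hφ, ξ, hξ, hl⟩ := helly hd0 (fun n => (ψ n).2)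
  refine ⟨ξ, hξ, ?_⟩
  have h1 : Filter.Tendsto (fun n => ∫⁻ x : Eu d, ENNReal.ofReal ((ψ (φ n)).1 (‖x‖ ^ 2) ^ p)) Filter.atTop (nhds (SS d p)) := by
    have : (fun n => ∫⁻ x : Eu d, ENNReal.ofReal ((ψ (φ n)).1 (‖x‖ ^ 2) ^ p)) = w ∘ φ := by
      ext n; exact hψ (φ n)
    rw [this]
    exact hw1.comp hφ.tendsto_atTop
  have h2 : Filter.Tendsto (fun n => ∫⁻ x : Eu d, ENNReal.ofReal ((ψ (φ n)).1 (‖x‖ ^ 2) ^ p)) Filter.atTop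
      (nhds (∫⁻ x : Eu d, ENNReal.ofReal (ξ (‖x‖ ^ 2) ^ p))) := by
    apply tendsto_lintegral_of_dominated_convergence (fun x : Eu d => ENNReal.ofReal (G (‖x‖ ^ 2)))
    · intro n
      exact ((ψ (φ n)).2.measE.pow_const p).ennreal_ofReal
    · intro n
      filter_upwards [ae_sq_pos hd0] with x hx
      exact ENNReal.ofReal_le_ofReal (hle _ (ψ (φ n)).2 _ hx)
    · exact hGi.lintegral_lt_top.ne
    · filter_upwards [ae_sq_pos hd0] with x hx
      apply (ENNReal.continuous_ofReal.tendsto _).comp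
      exact (hl _ hx).rpow_const (Or.inr (by linarith))
  exact tendsto_nhds_unique h2 h1

end GNS

namespace GNS

/-- the exponent -/
def th (d : ℕ) (m : ℝ) : ℝ := d * m / (d + 2)

lemma gn_scale {d : ℕ} (hd : 0 < d) {m : ℝ} (hm : 0 < m) {u : Eu d → ℝ} (hu : Measurable u) (hu0 : ∀ x, 0 ≤ u x)
    {a δ : ℝ} (ha : 0 < a) (hδ : 0 < δ) (h1 : ∫⁻ x, ENNReal.ofReal (u x) ≤ ENNReal.ofReal a) (h2 : Dir u ≤ ENNReal.ofReal δ) :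
    ∫⁻ x, ENNReal.ofReal (u x ^ (m + 1)) ≤ SS d (m + 1) * ENNReal.ofReal (a ^ (m + 1 - 2 * th d m) * δ ^ th d m) := by
  set s : ℝ := (a ^ 2 / δ) ^ (1 / ((d:ℝ) + 2)) with hs
  have hsp : 0 < s := by positivity
  set l : ℝ := s ^ d / a with hl
  have hlp : 0 < l := by positivity
  have hs2 : s ^ (d + 2) = a ^ 2 / δ := by
    rw [hs, ← Real.rpow_natCast, ← Real.rpow_mul (by positivity)]
    push_cast
    rw [one_div_mul_cancel (by positivity), Real.rpow_one]
  have hw : Measurable (fun x => l * u (s • x)) := (hu.comp (measurable_const_smul s)).const_mul l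
  have key := le_SS hd (p := m + 1) (by linarith) hw (fun x => mul_nonneg hlp.le (hu0 _)) (by
    simp only [ENNReal.ofReal_mul hlp.le]
    rw [lintegral_const_mul' _ _ ENNReal.ofReal_ne_top, lintegral_comp_smul hsp (fun x => ENNReal.ofReal (u x)), ← mul_assoc,
      ← ENNReal.ofReal_mul hlp.le]
    refine (mul_le_mul_right h1 _).trans ?_
    rw [← ENNReal.ofReal_mul (by positivity), ← ENNReal.ofReal_one]
    apply ENNReal.ofReal_le_ofReal
    rw [hl]; apply le_of_eq; field_simp) (by
    refine (Dir_scale l s hsp).trans ?_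
    refine (mul_le_mul_right h2 _).trans ?_
    rw [← ENNReal.ofReal_mul (by positivity), ← ENNReal.ofReal_one]
    apply ENNReal.ofReal_le_ofReal
    have : l ^ 2 * s ^ 2 * (s ^ d)⁻¹ * δ = s ^ (d + 2) * δ / a ^ 2 := by
      rw [hl, pow_add]; field_simp
    rw [this, hs2]
    apply le_of_eq; field_simp)
  have e1 : ∫⁻ x, ENNReal.ofReal ((l * u (s • x)) ^ (m + 1)) =
      ENNReal.ofReal (l ^ (m + 1) * (s ^ d)⁻¹) * ∫⁻ x, ENNReal.ofReal (u x ^ (m + 1)) := by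
    simp only [Real.mul_rpow hlp.le (hu0 _), ENNReal.ofReal_mul (Real.rpow_nonneg hlp.le (m + 1))]
    rw [lintegral_const_mul' _ _ ENNReal.ofReal_ne_top, lintegral_comp_smul hsp (fun x => ENNReal.ofReal (u x ^ (m + 1))), ← mul_assoc]
  rw [e1] at key
  have hcp : 0 < l ^ (m + 1) * (s ^ d)⁻¹ := by positivity
  have e2 : (l ^ (m + 1) * (s ^ d)⁻¹)⁻¹ = a ^ (m + 1 - 2 * th d m) * δ ^ th d m := by
    have hsd : s ^ d = (a ^ 2 / δ) ^ ((d:ℝ) / (d + 2)) := by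
      rw [hs, ← Real.rpow_natCast, ← Real.rpow_mul (by positivity)]
      congr 1; field_simp
    rw [hl, hsd, Real.div_rpow (by positivity) ha.le, ← Real.rpow_mul (by positivity)]
    have e3 : (a ^ 2 / δ) ^ ((d:ℝ) / (d + 2) * (m + 1)) = (a ^ 2 / δ) ^ (th d m) * (a ^ 2 / δ) ^ ((d:ℝ) / (d + 2)) := by
      rw [← Real.rpow_add (by positivity)]
      congr 1; unfold th; field_simp
    rw [e3, Real.div_rpow (x := a ^ 2) (z := th d m) (by positivity) hδ.le, ← Real.rpow_natCast a 2, ← Real.rpow_mul ha.le, Real.rpow_sub ha]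
    field_simp
    push_cast
    rw [mul_comm]
  rw [← e2, ENNReal.ofReal_inv_of_pos hcp, ← div_eq_mul_inv, ENNReal.le_div_iff_mul_le (Or.inl (by simpa using hcp))
    (Or.inl ENNReal.ofReal_ne_top), mul_comm]
  exact key

lemma SS_pos {d : ℕ} (hd : 0 < d) {m : ℝ} (hm : 0 < m) : 0 < SS d (m + 1) := by
  let φ : ContDiffBump (0 : Eu d) := ⟨1, 2, one_pos, one_lt_two⟩
  have hφ : ContDiff ℝ 1 φ := φ.contDiff
  have hi : Integrable φ := φ.continuous.integrable_of_hasCompactSupport φ.hasCompactSupport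
  have hgc := gradient_cont hφ
  have hgs : HasCompactSupport (fun x => kap d * ‖gradient φ x‖ ^ 2) := by
    refine φ.hasCompactSupport.mono' ?_
    intro x hx
    by_contra h
    apply hx
    have : (φ : Eu d → ℝ) =ᶠ[nhds x] fun _ => 0 := notMem_tsupport_iff_eventuallyEq.1 h
    have hg : gradient φ x = 0 := by
      rw [gradient, this.fderiv_eq]; simp
    simp [hg]
  have hgi : Integrable (fun x => kap d * ‖gradient φ x‖ ^ 2) :=
    Continuous.integrable_of_hasCompactSupport (by fun_prop) hgs
  have hk := kap_pos hd
  set a := (∫ x, φ x) + 1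
  set δ := (∫ x, kap d * ‖gradient φ x‖ ^ 2) + 1
  have ha0 : 0 ≤ ∫ x, φ x := integral_nonneg fun x => φ.nonneg
  have hδ0 : 0 ≤ ∫ x, kap d * ‖gradient φ x‖ ^ 2 := integral_nonneg fun x => by positivity
  have key := gn_scale hd hm φ.continuous.measurable (fun x => φ.nonneg) (a := a) (δ := δ) (by linarith) (by linarith) (by
    rw [← ofReal_integral_eq_lintegral_ofReal hi (Filter.Eventually.of_forall fun x => φ.nonneg)]
    apply ENNReal.ofReal_le_ofReal; linarith) (by
    refine (Dir_le_grad hd hφ).trans ?_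
    rw [← ofReal_integral_eq_lintegral_ofReal hgi (Filter.Eventually.of_forall fun x => by positivity)]
    apply ENNReal.ofReal_le_ofReal; linarith)
  rw [pos_iff_ne_zero]
  intro h0
  rw [h0, zero_mul, nonpos_iff_eq_zero, lintegral_eq_zero_iff (by
    exact (φ.continuous.measurable.pow_const _).ennreal_ofReal)] at key
  have h1 : ∀ᵐ x : Eu d, x ∉ Metric.ball (0 : Eu d) 1 := by
    filter_upwards [key] with x hx hx2
    have : φ x = 1 := φ.one_of_mem_closedBall (Metric.ball_subset_closedBall hx2)
    simp [this] at hx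
  have h2 : (volume : Measure (Eu d)) (Metric.ball 0 1) = 0 := measure_eq_zero_iff_ae_notMem.2 h1
  exact (Metric.measure_ball_pos (volume : Measure (Eu d)) 0 one_pos).ne' h2

lemma gn_scale_ae {d : ℕ} (hd : 0 < d) {m : ℝ} (hm : 0 < m) {u : Eu d → ℝ} (hu : Measurable u) (hu0 : ∀ᵐ x, 0 ≤ u x)
    {a δ : ℝ} (ha : 0 < a) (hδ : 0 < δ) (h1 : ∫⁻ x, ENNReal.ofReal (u x) ≤ ENNReal.ofReal a) (h2 : Dir u ≤ ENNReal.ofReal δ) :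
    ∫⁻ x, ENNReal.ofReal (u x ^ (m + 1)) ≤ SS d (m + 1) * ENNReal.ofReal (a ^ (m + 1 - 2 * th d m) * δ ^ th d m) := by
  have hae : (fun x => |u x|) =ᵐ[volume] u := by
    filter_upwards [hu0] with x hx using abs_of_nonneg hx
  have key := gn_scale hd hm (u := fun x => |u x|) (by fun_prop) (fun x => abs_nonneg _) ha hδ (by
    refine le_of_eq_of_le (lintegral_congr_ae ?_) h1
    filter_upwards [hae] with x hx
    rw [hx]) (by rw [Dir_congr hae]; exact h2)
  refine le_of_eq_of_le (lintegral_congr_ae ?_) key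
  filter_upwards [hae] with x hx
  rw [hx]

lemma tangent {p x h : ℝ} (hp : 1 < p) (hx : 0 ≤ x) (hxh : 0 ≤ x + h) : x ^ p + p * (x ^ (p - 1) * h) ≤ (x + h) ^ p := by
  rcases hx.eq_or_lt with h0 | h0
  · rw [← h0, Real.zero_rpow (by linarith), Real.zero_rpow (by linarith)]
    simp only [zero_mul, mul_zero, add_zero]
    rw [← h0] at hxh
    exact Real.rpow_nonneg hxh _
  · have h1 := one_add_mul_self_le_rpow_one_add (s := h / x) (by rw [le_div_iff₀ h0]; linarith) hp.le
    have h2 : (x + h) ^ p = x ^ p * (1 + h / x) ^ p := by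
      rw [← Real.mul_rpow hx (by rw [← div_self h0.ne', ← add_div]; positivity)]
      congr 1; field_simp
    have h3 : x ^ p = x ^ (p - 1) * x := by
      rw [Real.rpow_sub_one h0.ne']; field_simp
    rw [h2]
    refine le_trans (le_of_eq ?_) (mul_le_mul_of_nonneg_left h1 (Real.rpow_nonneg hx p))
    rw [h3]; field_simp

lemma deriv_le {X Y N r θ S T : ℝ} {s0 : ℝ} (hs0 : 0 < s0)
    (h : ∀ s, 0 < s → s < s0 → S + s * T ≤ S * ((1 + s * X) ^ r * (1 - s * Y + s ^ 2 * N) ^ θ)) :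
    T ≤ S * (r * X - θ * Y) := by
  have hd1 : HasDerivAt (fun s : ℝ => 1 + s * X) X 0 := by
    simpa using ((hasDerivAt_id (0:ℝ)).mul_const X).const_add 1
  have hd2 : HasDerivAt (fun s : ℝ => 1 - s * Y + s ^ 2 * N) (-Y) 0 := by
    have := (((hasDerivAt_id (0:ℝ)).mul_const Y).const_sub 1).add (((hasDerivAt_id (0:ℝ)).pow 2).mul_const N)
    refine (this.congr_deriv (by simp)).congr_of_eventuallyEq (Filter.Eventually.of_forall fun s => ?_)
    simp
  have hd3 : HasDerivAt (fun s : ℝ => S * ((1 + s * X) ^ r * (1 - s * Y + s ^ 2 * N) ^ θ)) (S * (r * X - θ * Y)) 0 := by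
    have := ((hd1.rpow_const (p := r) (Or.inl (by simp))).mul (hd2.rpow_const (p := θ) (Or.inl (by simp)))).const_mul S
    refine this.congr_deriv ?_
    simp; ring_nf; simp
  have hl := hd3.tendsto_slope_zero_right
  refine ge_of_tendsto hl ?_
  filter_upwards [Ioo_mem_nhdsGT hs0] with s hs
  have := h s hs.1 hs.2
  simp only [zero_add, smul_eq_mul]
  rw [inv_mul_eq_div, le_div_iff₀ hs.1]
  simp
  linarith

end GNS

namespace GNS

lemma TestF.intE {d : ℕ} {f f1 f2 : ℝ → ℝ} {T : ℝ} (hf : TestF f f1 f2 T) : Integrable (fun x : Eu d => f (‖x‖ ^ 2)) :=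
  hf.contDiff.continuous.integrable_of_hasCompactSupport (hf.compact fun _ hx => hf.z0 _ hx)

lemma TestF.bdd {f f1 f2 : ℝ → ℝ} {T : ℝ} (hf : TestF f f1 f2 T) : ∃ M, 0 < M ∧ ∀ t, 0 ≤ t → |f t| ≤ M := by
  obtain ⟨M, hM⟩ := isCompact_Icc.exists_bound_of_continuousOn (hf.c0.continuousOn (s := Set.Icc 0 T))
  refine ⟨max M 1, by positivity, fun t ht => ?_⟩
  by_cases h : t ≤ T
  · exact (hM t ⟨ht, h⟩).trans (le_max_left _ _)
  · rw [hf.z0 t (not_le.1 h).le]; simp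

lemma Rad.vm_int {d : ℕ} (hd : 3 ≤ d) {m : ℝ} (hm : 0 < m) (hp2 : (m + 1) * ((d:ℝ) - 2) < 2 * d) {ψ : ℝ → ℝ}
    (h : Rad d ψ) {f f1 f2 : ℝ → ℝ} {T : ℝ} (hf : TestF f f1 f2 T) :
    Integrable (fun x : Eu d => ψ (‖x‖ ^ 2) ^ m * f (‖x‖ ^ 2)) := by
  obtain ⟨M, hM0, hM⟩ := hf.bdd
  have h1 := (hf.intE (d := d)).norm.add ((h.pow_int hd (p := m + 1) (by linarith) hp2).const_mul M)
  refine h1.mono' ((h.measE.pow_const m).mul hf.contDiff.continuous.measurable).aestronglyMeasurable ?_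
  refine Filter.Eventually.of_forall fun x => ?_
  have h0 := h.nonneg (‖x‖ ^ 2)
  have h2 : ψ (‖x‖ ^ 2) ^ m ≤ 1 + ψ (‖x‖ ^ 2) ^ (m + 1) := by
    rcases le_total (ψ (‖x‖ ^ 2)) 1 with h3 | h3
    · have := Real.rpow_le_one h0 h3 hm.le
      have := Real.rpow_nonneg h0 (m + 1)
      linarith
    · have := Real.rpow_le_rpow_of_exponent_le h3 (show m ≤ m + 1 by linarith)
      linarith
  have h4 := hM (‖x‖ ^ 2) (by positivity)
  simp only [Pi.add_apply, norm_mul, Real.norm_eq_abs, abs_of_nonneg (Real.rpow_nonneg h0 m)]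
  have h5 := abs_nonneg (f (‖x‖ ^ 2))
  have h6 := Real.rpow_nonneg h0 (m + 1)
  calc _ ≤ (1 + ψ (‖x‖ ^ 2) ^ (m + 1)) * |f (‖x‖ ^ 2)| := by gcongr
    _ ≤ _ := by nlinarith

theorem el_x {d : ℕ} (hd : 3 ≤ d) {m : ℝ} (hm : 0 < m) (hp2 : (m + 1) * ((d:ℝ) - 2) < 2 * d) {ψ : ℝ → ℝ}
    (h : Rad d ψ) (hS : ∫⁻ x : Eu d, ENNReal.ofReal (ψ (‖x‖ ^ 2) ^ (m + 1)) = SS d (m + 1))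
    {f f1 f2 : ℝ → ℝ} {T : ℝ} (hf : TestF f f1 f2 T) {s0 : ℝ} (hs0 : 0 < s0)
    (hpos : ∀ s, 0 < s → s < s0 → ∀ t, 0 < t → 0 ≤ ψ t + s * f t) :
    (m + 1) * (∫ x : Eu d, ψ (‖x‖ ^ 2) ^ m * f (‖x‖ ^ 2)) ≤ (SS d (m + 1)).toReal *
      ((m + 1 - 2 * th d m) * (∫ x : Eu d, f (‖x‖ ^ 2)) - th d m * (2 * (kap d * Lp (fun x : Eu d => ψ (‖x‖ ^ 2)) f1 f2))) := by
  have hd0 : 0 < d := by omega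
  set X := ∫ x : Eu d, f (‖x‖ ^ 2)
  set Y := 2 * (kap d * Lp (fun x : Eu d => ψ (‖x‖ ^ 2)) f1 f2) with hY
  set N := kap d * Np d f1 with hN
  set S := (SS d (m + 1)).toReal
  have hpi := h.pow_int hd (p := m + 1) (by linarith) hp2
  have hfi := hf.intE (d := d)
  have hvm := h.vm_int hd hm hp2 hf
  have hfin : SS d (m + 1) ≠ ⊤ := by
    rw [← hS]; exact hpi.lintegral_lt_top.ne
  have hSe : ∫ x : Eu d, ψ (‖x‖ ^ 2) ^ (m + 1) = S := by
    rw [integral_eq_lintegral_of_nonneg_ae (Filter.Eventually.of_forall fun x => Real.rpow_nonneg (h.nonneg _) _)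
      hpi.aestronglyMeasurable, hS]
  have hev : ∀ᶠ s : ℝ in nhds 0, 0 < 1 + s * X ∧ 0 < 1 - s * Y + s ^ 2 * N := by
    have c1 : Continuous (fun s : ℝ => 1 + s * X) := by fun_prop
    have c2 : Continuous (fun s : ℝ => 1 - s * Y + s ^ 2 * N) := by fun_prop
    have t1 := c1.tendsto 0
    have t2 := c2.tendsto 0
    simp only [zero_mul, add_zero, sub_zero, ne_eq, OfNat.ofNat_ne_zero, not_false_eq_true, zero_pow] at t1 t2
    exact (t1.eventually (lt_mem_nhds one_pos)).and (t2.eventually (lt_mem_nhds one_pos))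
  obtain ⟨r, hr, hr2⟩ := Metric.eventually_nhds_iff.1 hev
  refine deriv_le (s0 := min s0 r) (N := N) (lt_min hs0 hr) fun s hs hs1 => ?_
  obtain ⟨p1, p2⟩ := hr2 (show dist s 0 < r by
    rw [Real.dist_eq, sub_zero, abs_of_pos hs]; exact hs1.trans_le (min_le_right _ _))
  have hD := (Dir_pert hd0 h.measE h.integrable zero_le_one (by simpa using h.dir) hf s).2
  have hae : ∀ᵐ x : Eu d, 0 ≤ ψ (‖x‖ ^ 2) + s * f (‖x‖ ^ 2) := by
    filter_upwards [ae_sq_pos hd0] with x hx using hpos s hs (hs1.trans_le (min_le_left _ _)) _ hx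
  have hmeas : Measurable (fun x : Eu d => ψ (‖x‖ ^ 2) + s * f (‖x‖ ^ 2)) :=
    h.measE.add (hf.contDiff.continuous.measurable.const_mul s)
  have key := gn_scale_ae hd0 hm hmeas hae p1 p2 (by
    rw [← ofReal_integral_eq_lintegral_ofReal (f := fun x : Eu d => ψ (‖x‖ ^ 2) + s * f (‖x‖ ^ 2)) (h.integrable.add (hfi.const_mul s)) hae]
    apply ENNReal.ofReal_le_ofReal
    rw [integral_add h.integrable (hfi.const_mul s), integral_const_mul]
    linarith [h.integral_le]) (by
    refine hD.trans (le_of_eq ?_)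
    congr 1
    rw [hY, hN]; ring)
  have hRnn : 0 ≤ (1 + s * X) ^ (m + 1 - 2 * th d m) * (1 - s * Y + s ^ 2 * N) ^ th d m := by positivity
  have hne : SS d (m + 1) * ENNReal.ofReal ((1 + s * X) ^ (m + 1 - 2 * th d m) * (1 - s * Y + s ^ 2 * N) ^ th d m) ≠ ⊤ :=
    ENNReal.mul_ne_top hfin ENNReal.ofReal_ne_top
  have hae2 : ∀ᵐ x : Eu d, 0 ≤ (ψ (‖x‖ ^ 2) + s * f (‖x‖ ^ 2)) ^ (m + 1) := by
    filter_upwards [hae] with x hx using Real.rpow_nonneg hx _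
  have hmeas2 := hmeas.pow_const (m + 1)
  have hintg : Integrable (fun x : Eu d => (ψ (‖x‖ ^ 2) + s * f (‖x‖ ^ 2)) ^ (m + 1)) := by
    refine ⟨hmeas2.aestronglyMeasurable, ?_⟩
    rw [hasFiniteIntegral_iff_ofReal hae2]
    exact key.trans_lt hne.lt_top
  have hle : ∫ x : Eu d, (ψ (‖x‖ ^ 2) + s * f (‖x‖ ^ 2)) ^ (m + 1) ≤
      S * ((1 + s * X) ^ (m + 1 - 2 * th d m) * (1 - s * Y + s ^ 2 * N) ^ th d m) := by
    rw [integral_eq_lintegral_of_nonneg_ae hae2 hmeas2.aestronglyMeasurable]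
    have := ENNReal.toReal_mono hne key
    rwa [ENNReal.toReal_mul, ENNReal.toReal_ofReal hRnn] at this
  refine le_trans ?_ hle
  have e : S + s * ((m + 1) * ∫ x : Eu d, ψ (‖x‖ ^ 2) ^ m * f (‖x‖ ^ 2)) =
      ∫ x : Eu d, (ψ (‖x‖ ^ 2) ^ (m + 1) + (s * (m + 1)) * (ψ (‖x‖ ^ 2) ^ m * f (‖x‖ ^ 2))) := by
    rw [integral_add hpi (hvm.const_mul _), hSe, integral_const_mul]; ring
  rw [e]
  apply integral_mono_ae (hpi.add (hvm.const_mul _)) hintg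
  filter_upwards [hae] with x hx
  have := tangent (p := m + 1) (by linarith) (h.nonneg (‖x‖ ^ 2)) hx
  simp only [add_sub_cancel_right] at this
  simp only [Pi.add_apply]
  linarith

end GNS

namespace GNS

lemma TestB.tf0_zero {b b1 : ℝ → ℝ} {a c : ℝ} (h : TestB b b1 a c) (d : ℕ) {t : ℝ} (ht : c ≤ t) : tf0 d b c t = 0 := by
  unfold tf0
  rw [intervalIntegral.integral_congr (g := fun _ => (0:ℝ))]
  · simp
  · intro τ hτ
    rw [Set.uIcc_of_ge (by linarith)] at hτ
    simp [h.z2 τ hτ.1]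

lemma TestB.tf0_nonneg {b b1 : ℝ → ℝ} {a c : ℝ} (h : TestB b b1 a c) (d : ℕ) (hb : ∀ t, 0 ≤ b t) {t : ℝ} (ht0 : 0 < t) : 0 ≤ tf0 d b c t := by
  rcases le_total c t with h1 | h1
  · rw [h.tf0_zero d h1]
  · exact intervalIntegral.integral_nonneg h1 fun τ hτ => mul_nonneg (Real.rpow_nonneg (by linarith [hτ.1]) _) (hb τ)

lemma TestB.neg {b b1 : ℝ → ℝ} {a c : ℝ} (h : TestB b b1 a c) : TestB (fun t => - b t) (fun t => - b1 t) a c where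
  apos := h.apos
  ac := h.ac
  der t := (h.der t).neg
  cont := h.cont.neg
  z1 t ht := by simp [h.z1 t ht]
  z2 t ht := by simp [h.z2 t ht]

lemma tf0_neg (d : ℕ) (b : ℝ → ℝ) (c t : ℝ) : tf0 d (fun t => - b t) c t = - tf0 d b c t := by
  unfold tf0
  rw [← intervalIntegral.integral_neg]
  congr 1; ext τ; ring

lemma setInt_eq {g : ℝ → ℝ} {T : ℝ} (hT : 0 ≤ T) (hz : ∀ t, T < t → g t = 0) :
    ∫ t in Set.Ioi (0:ℝ), g t = ∫ t in (0:ℝ)..T, g t := by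
  rw [intervalIntegral.integral_of_le hT]
  apply setIntegral_eq_of_subset_of_forall_sdiff_eq_zero measurableSet_Ioi (fun t ht => ht.1)
  intro t ht
  apply hz
  by_contra h
  exact ht.2 ⟨ht.1, not_lt.1 h⟩

lemma ibp {w : ℝ → ℝ} (hw : ContinuousOn w (Set.Ioi 0)) (hi : ∀ T, 0 < T → IntervalIntegrable w volume 0 T)
    {b b1 : ℝ → ℝ} {a c : ℝ} (h : TestB b b1 a c) (d : ℕ) :
    ∫ t in Set.Ioi (0:ℝ), tf0 d b c t * w t = ∫ t in Set.Ioi (0:ℝ), (∫ τ in (0:ℝ)..t, w τ) * t ^ (-(d:ℝ)/2) * b t := by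
  have hcp : 0 < c := h.apos.trans_le h.ac
  have hf := h.testF d
  set W : ℝ → ℝ := fun t => ∫ τ in (0:ℝ)..t, w τ
  have hWc : ContinuousOn W (Set.uIcc 0 c) := intervalIntegral.continuousOn_primitive_interval'
    (hi c hcp) (by simp)
  rw [setInt_eq hcp.le (fun t ht => by rw [h.tf0_zero d ht.le, zero_mul]),
    setInt_eq hcp.le (fun t ht => by rw [h.z2 t ht.le, mul_zero])]
  have i1 : IntervalIntegrable (fun t => tf0 d b c t * w t) volume 0 c :=
    (hi c hcp).continuousOn_mul hf.c0.continuousOn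
  have hc2 : ContinuousOn (fun t => W t * t ^ (-(d:ℝ)/2) * b t) (Set.uIcc 0 c) := by
    have := hWc.mul (h.wcont (-(d:ℝ)/2)).continuousOn
    refine this.congr fun t _ => by simp only [Pi.mul_apply]; ring
  have i2 : IntervalIntegrable (fun t => W t * t ^ (-(d:ℝ)/2) * b t) volume 0 c := hc2.intervalIntegrable
  have key := intervalIntegral.integral_eq_sub_of_hasDerivAt_of_le hcp.le (f := fun t => tf0 d b c t * W t)
    (f' := fun t => tf0 d b c t * w t - W t * t ^ (-(d:ℝ)/2) * b t) (by
      rw [Set.uIcc_of_le hcp.le] at hWc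
      exact hf.c0.continuousOn.mul hWc) (by
      intro t ht
      have hWd : HasDerivAt W (w t) t :=
        intervalIntegral.integral_hasDerivAt_right (hi t ht.1)
          (hw.stronglyMeasurableAtFilter isOpen_Ioi t ht.1)
          (hw.continuousAt (Ioi_mem_nhds ht.1))
      refine ((hf.d1 t).mul hWd).congr_deriv ?_
      unfold tf1; ring) (i1.sub i2)
  rw [intervalIntegral.integral_sub i1 i2, h.tf0_zero d le_rfl] at key
  have : W 0 = 0 := by simp [W]
  rw [this] at key
  linarith

def qq (d : ℕ) (m A B : ℝ) (ψ : ℝ → ℝ) (t : ℝ) : ℝ := (A - B * ψ t ^ m) * t ^ ((d:ℝ)/2 - 1)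
def HH (d : ℕ) (m A B : ℝ) (ψ : ℝ → ℝ) (t : ℝ) : ℝ := (∫ τ in (0:ℝ)..t, qq d m A B ψ τ) * t ^ (-(d:ℝ)/2)

lemma Rad.qq_cont {d : ℕ} (hd : 0 < d) {m : ℝ} (hm : 0 < m) {ψ : ℝ → ℝ} (h : Rad d ψ) (A B : ℝ) :
    ContinuousOn (qq d m A B ψ) (Set.Ioi 0) := by
  unfold qq
  have h1 : ContinuousOn (fun t => ψ t ^ m) (Set.Ioi 0) := (h.cont hd).rpow_const fun t _ => Or.inr hm.le
  exact (continuousOn_const.sub (continuousOn_const.mul h1)).mul (rpow_contOn _)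

lemma Rad.psim_int {d : ℕ} (hd : 3 ≤ d) {m : ℝ} (hm : 0 < m) (hp2 : (m + 1) * ((d:ℝ) - 2) < 2 * d) {ψ : ℝ → ℝ}
    (h : Rad d ψ) {T : ℝ} (hT : 0 < T) :
    IntervalIntegrable (fun t => ψ t ^ m * t ^ ((d:ℝ)/2 - 1)) volume 0 T := by
  have hd0 : 0 < d := by omega
  have hd3 : (3:ℝ) ≤ d := by exact_mod_cast hd
  have h1 := (polar_int hd0 (fun t => ψ t ^ (m + 1))).1 (h.pow_int hd (p := m + 1) (by linarith) hp2)
  have h2 : IntervalIntegrable (fun t => ψ t ^ (m+1) * t ^ ((d:ℝ)/2 - 1)) volume 0 T := by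
    rw [intervalIntegrable_iff_integrableOn_Ioc_of_le hT.le]
    exact h1.mono_set fun t ht => ht.1
  have h3 : IntervalIntegrable (fun t : ℝ => t ^ ((d:ℝ)/2 - 1)) volume 0 T :=
    intervalIntegral.intervalIntegrable_rpow' (by linarith)
  refine (h3.add h2).mono_fun' (((h.meas.pow_const m).mul (by fun_prop)).aestronglyMeasurable) ?_
  rw [Set.uIoc_of_le hT.le]
  filter_upwards [self_mem_ae_restrict measurableSet_Ioc] with t ht
  have h0 := h.nonneg t
  have h2 : ψ t ^ m ≤ 1 + ψ t ^ (m + 1) := by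
    rcases le_total (ψ t) 1 with h3 | h3
    · have := Real.rpow_le_one h0 h3 hm.le
      have := Real.rpow_nonneg h0 (m + 1)
      linarith
    · have := Real.rpow_le_rpow_of_exponent_le h3 (show m ≤ m + 1 by linarith)
      linarith
  have h4 := Real.rpow_nonneg ht.1.le ((d:ℝ)/2 - 1)
  rw [Real.norm_of_nonneg (mul_nonneg (Real.rpow_nonneg h0 m) h4)]
  nlinarith

lemma Rad.qq_int {d : ℕ} (hd : 3 ≤ d) {m : ℝ} (hm : 0 < m) (hp2 : (m + 1) * ((d:ℝ) - 2) < 2 * d) {ψ : ℝ → ℝ}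
    (h : Rad d ψ) (A B : ℝ) {T : ℝ} (hT : 0 < T) : IntervalIntegrable (qq d m A B ψ) volume 0 T := by
  have hd3 : (3:ℝ) ≤ d := by exact_mod_cast hd
  have h3 : IntervalIntegrable (fun t : ℝ => t ^ ((d:ℝ)/2 - 1)) volume 0 T :=
    intervalIntegral.intervalIntegrable_rpow' (by linarith)
  have := (h3.const_mul A).sub ((h.psim_int hd hm hp2 hT).const_mul B)
  refine this.congr ?_
  intro t _
  simp only [qq]; ring

lemma HH_cont {d : ℕ} (hd : 3 ≤ d) {m : ℝ} (hm : 0 < m) (hp2 : (m + 1) * ((d:ℝ) - 2) < 2 * d) {ψ : ℝ → ℝ}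
    (h : Rad d ψ) (A B : ℝ) : ContinuousOn (HH d m A B ψ) (Set.Ioi 0) := by
  intro t ht
  have ht : 0 < t := ht
  have hWd : HasDerivAt (fun t => ∫ τ in (0:ℝ)..t, qq d m A B ψ τ) (qq d m A B ψ t) t :=
    intervalIntegral.integral_hasDerivAt_right (h.qq_int hd hm hp2 A B ht)
      ((h.qq_cont (by omega) hm A B).stronglyMeasurableAtFilter isOpen_Ioi t ht)
      ((h.qq_cont (by omega) hm A B).continuousAt (Ioi_mem_nhds ht))
  exact (hWd.continuousAt.mul (Real.continuousAt_rpow_const t _ (Or.inl ht.ne'))).continuousWithinAt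

theorem el_t {d : ℕ} (hd : 3 ≤ d) {m : ℝ} (hm : 0 < m) (hp2 : (m + 1) * ((d:ℝ) - 2) < 2 * d) {ψ : ℝ → ℝ}
    (h : Rad d ψ) (hS : ∫⁻ x : Eu d, ENNReal.ofReal (ψ (‖x‖ ^ 2) ^ (m + 1)) = SS d (m + 1)) :
    ∃ A B : ℝ, 0 < A ∧ 0 < B ∧ ∀ b b1 a c, TestB b b1 a c → ∀ s0, 0 < s0 →
      (∀ s, 0 < s → s < s0 → ∀ t, 0 < t → 0 ≤ ψ t + s * tf0 d b c t) →
      0 ≤ (∫ t in Set.Ioi (0:ℝ), HH d m A B ψ t * b t) + ∫ t in Set.Ioi (0:ℝ), ψ t * b1 t := by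
  have hd0 : 0 < d := by omega
  have hd3 : (3:ℝ) ≤ d := by exact_mod_cast hd
  have hpi := h.pow_int hd (p := m + 1) (by linarith) hp2
  have hfin : SS d (m + 1) ≠ ⊤ := by
    rw [← hS]; exact hpi.lintegral_lt_top.ne
  have hSp : 0 < (SS d (m + 1)).toReal := ENNReal.toReal_pos (SS_pos hd0 hm).ne' hfin
  set S := (SS d (m + 1)).toReal
  have hκ := kap_pos hd0
  have hc := cw_pos hd0
  have hθ : 0 < th d m := by unfold th; positivity
  have hr : 0 < m + 1 - 2 * th d m := by
    unfold th
    have : m + 1 - 2 * (d * m / (d + 2)) = (2 * d - (m + 1) * (d - 2) + (2 - d) + (d-2)) / (d + 2) := by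
      field_simp; ring
    rw [this]
    apply div_pos _ (by linarith)
    linarith
  refine ⟨(m + 1 - 2 * th d m) / (8 * th d m * kap d), (m + 1) / (8 * S * th d m * kap d), by positivity, by positivity, ?_⟩
  set A := (m + 1 - 2 * th d m) / (8 * th d m * kap d) with hA
  set B := (m + 1) / (8 * S * th d m * kap d) with hB
  intro b b1 a c hb s0 hs0 hpos
  have hf := hb.testF d
  have key := el_x hd hm hp2 h hS hf hs0 hpos
  rw [hb.Lp_eq hd0 ψ, polar hd0 (fun t => ψ t ^ m * tf0 d b c t), polar hd0 (fun t => tf0 d b c t)] at key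
  have i1 := (polar_int hd0 (fun t => ψ t ^ m * tf0 d b c t)).1 (h.vm_int hd hm hp2 hf)
  have i2 := (polar_int hd0 (tf0 d b c)).1 (hf.intE (d := d))
  have e1 : ∫ t in Set.Ioi (0:ℝ), HH d m A B ψ t * b t = ∫ t in Set.Ioi (0:ℝ), tf0 d b c t * qq d m A B ψ t := by
    rw [ibp (h.qq_cont hd0 hm A B) (fun T hT => h.qq_int hd hm hp2 A B hT) hb d]
    rfl
  have e2 : ∫ t in Set.Ioi (0:ℝ), tf0 d b c t * qq d m A B ψ t =
      A * (∫ t in Set.Ioi (0:ℝ), tf0 d b c t * t ^ ((d:ℝ)/2 - 1)) - B * ∫ t in Set.Ioi (0:ℝ), ψ t ^ m * tf0 d b c t * t ^ ((d:ℝ)/2 - 1) := by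
    rw [← integral_const_mul, ← integral_const_mul, ← integral_sub (i2.const_mul A) (i1.const_mul B)]
    congr 1; ext t; unfold qq; ring
  rw [e1, e2]
  set I1 := ∫ t in Set.Ioi (0:ℝ), ψ t ^ m * tf0 d b c t * t ^ ((d:ℝ)/2 - 1)
  set I2 := ∫ t in Set.Ioi (0:ℝ), tf0 d b c t * t ^ ((d:ℝ)/2 - 1)
  set I3 := ∫ t in Set.Ioi (0:ℝ), ψ t * b1 t
  have hP : 0 < 8 * S * th d m * kap d * cw d := by positivity
  have e3 : (8 * S * th d m * kap d * cw d) * (A * I2 - B * I1 + I3) =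
      S * ((m + 1 - 2 * th d m) * (cw d * I2) - th d m * (2 * (kap d * (-4 * cw d * I3)))) - (m + 1) * (cw d * I1) := by
    rw [hA, hB]; field_simp; ring
  have : 0 ≤ (8 * S * th d m * kap d * cw d) * (A * I2 - B * I1 + I3) := by
    rw [e3]; linarith
  exact nonneg_of_mul_nonneg_right this hP

end GNS

namespace GNS

lemma bp_tendsto {a c : ℝ} (hac : a ≤ c) (t : ℝ) :
    Filter.Tendsto (fun n : ℕ => bp (1 / ((n:ℝ) + 1)) a c t) Filter.atTop (nhds ((Set.Ioc a c).indicator (fun _ => (1:ℝ)) t)) := by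
  have hδ : ∀ n : ℕ, 0 < 1 / ((n:ℝ) + 1) := fun n => by positivity
  have hl := tendsto_one_div_add_atTop_nhds_zero_nat (𝕜 := ℝ)
  have hst : ∀ e : ℝ, e < t → ∀ᶠ n : ℕ in Filter.atTop, st (1 / ((n:ℝ) + 1)) e t = 1 := by
    intro e he
    filter_upwards [hl.eventually (gt_mem_nhds (show 0 < t - e by linarith))] with n hn
    exact st_one (hδ n) (by linarith)
  apply tendsto_const_nhds.congr'
  by_cases h1 : t ≤ a
  · filter_upwards with n
    rw [Set.indicator_of_notMem (fun h => not_lt.2 h1 h.1)]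
    rw [bp, st_zero (hδ n) h1, st_zero (hδ n) (h1.trans hac)]; simp
  · by_cases h2 : t ≤ c
    · filter_upwards [hst a (not_le.1 h1)] with n hn
      rw [Set.indicator_of_mem (show t ∈ Set.Ioc a c from ⟨not_le.1 h1, h2⟩), bp, hn, st_zero (hδ n) h2]; simp
    · filter_upwards [hst a (not_le.1 h1), hst c (not_le.1 h2)] with n hn hn2
      rw [Set.indicator_of_notMem (fun h => h2 h.2), bp, hn, hn2]; simp

lemma bp_H_tendsto {H : ℝ → ℝ} (hH : ContinuousOn H (Set.Ioi 0)) {a c : ℝ} (ha : 0 < a) (hac : a ≤ c) :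
    Filter.Tendsto (fun n : ℕ => ∫ t in Set.Ioi (0:ℝ), H t * bp (1 / ((n:ℝ) + 1)) a c t) Filter.atTop
      (nhds (∫ t in a..c, H t)) := by
  have hδ : ∀ n : ℕ, 0 < 1 / ((n:ℝ) + 1) := fun n => by positivity
  have hδ1 : ∀ n : ℕ, 1 / ((n:ℝ) + 1) ≤ 1 := fun n => by
    rw [div_le_one (by positivity)]; linarith [(Nat.cast_nonneg n : (0:ℝ) ≤ n)]
  have e : ∫ t in a..c, H t = ∫ t in Set.Ioi (0:ℝ), H t * (Set.Ioc a c).indicator (fun _ => (1:ℝ)) t := by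
    rw [intervalIntegral.integral_of_le hac]
    have : (fun t => H t * (Set.Ioc a c).indicator (fun _ => (1:ℝ)) t) = (Set.Ioc a c).indicator H := by
      ext t
      by_cases h : t ∈ Set.Ioc a c
      · simp [h]
      · simp [h]
    rw [this, setIntegral_indicator measurableSet_Ioc]
    congr 2
    ext t
    constructor
    · intro h; exact ⟨ha.trans h.1, h⟩
    · intro h; exact h.2
  rw [e]
  have hsub : Set.Icc a (c+1) ⊆ Set.Ioi 0 := fun t ht => lt_of_lt_of_le ha ht.1
  have hb : IntegrableOn ((Set.Icc a (c + 1)).indicator (fun t => |H t|)) (Set.Ioi 0) := by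
    apply IntegrableOn.integrable_indicator _ measurableSet_Icc |>.integrableOn
    exact ((hH.mono hsub).abs).integrableOn_Icc
  apply tendsto_integral_of_dominated_convergence _ _ hb
  · intro n
    filter_upwards with t
    rw [norm_mul, Real.norm_eq_abs, Real.norm_of_nonneg (bp_nonneg (hδ n) hac t)]
    by_cases h : t ∈ Set.Icc a (c + 1)
    · rw [Set.indicator_of_mem h]
      exact mul_le_of_le_one_right (abs_nonneg _) (bp_le_one _ _ _ _)
    · rw [Set.indicator_of_notMem h]
      have : bp (1 / ((n:ℝ) + 1)) a c t = 0 := by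
        by_cases h1 : t ≤ a
        · rw [bp, st_zero (hδ n) h1, st_zero (hδ n) (h1.trans hac)]; simp
        · have h2 : c + 1 ≤ t := by
            by_contra h3
            exact h ⟨(not_le.1 h1).le, (not_le.1 h3).le⟩
          rw [bp, st_one (hδ n) (by linarith [hδ1 n]), st_one (hδ n) (by linarith [hδ1 n])]; simp
      rw [this, mul_zero]
  · filter_upwards with t
    exact (bp_tendsto hac t).const_mul _
  · intro n
    have hm : ContinuousOn H (Set.Ioi 0) := hH
    have hbc : Continuous (bp (1 / ((n:ℝ) + 1)) a c) := (bp_test (hδ n) ha hac).bcont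
    exact (hm.mul hbc.continuousOn).aestronglyMeasurable measurableSet_Ioi

/-- The Euler-Lagrange relation in integrated form. -/
structure EL (d : ℕ) (m A B : ℝ) (ψ : ℝ → ℝ) : Prop where
  Apos : 0 < A
  Bpos : 0 < B
  le : ∀ a c, 0 < a → a ≤ c → ψ c - ψ a ≤ ∫ t in a..c, HH d m A B ψ t
  eq : ∀ a c, 0 < a → a ≤ c → 0 < ψ c → ψ c - ψ a = ∫ t in a..c, HH d m A B ψ t

theorem el_exists {d : ℕ} (hd : 3 ≤ d) {m : ℝ} (hm : 0 < m) (hp2 : (m + 1) * ((d:ℝ) - 2) < 2 * d) {ψ : ℝ → ℝ}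
    (h : Rad d ψ) (hS : ∫⁻ x : Eu d, ENNReal.ofReal (ψ (‖x‖ ^ 2) ^ (m + 1)) = SS d (m + 1)) :
    ∃ A B, EL d m A B ψ := by
  obtain ⟨A, B, hA, hB, hel⟩ := el_t hd hm hp2 h hS
  have hd0 : 0 < d := by omega
  have hHc := HH_cont hd hm hp2 h A B
  have hψc := h.cont hd0
  have hδ : ∀ n : ℕ, 0 < 1 / ((n:ℝ) + 1) := fun n => by positivity
  have hl := tendsto_one_div_add_atTop_nhds_zero_nat (𝕜 := ℝ)
  have hlim : ∀ e : ℝ, 0 < e → Filter.Tendsto (fun n : ℕ => ψ (e + 1 / ((n:ℝ) + 1))) Filter.atTop (nhds (ψ e)) := by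
    intro e he
    have h1 : Filter.Tendsto (fun n : ℕ => e + 1 / ((n:ℝ) + 1)) Filter.atTop (nhds e) := by
      simpa using hl.const_add e
    exact (hψc.continuousAt (Ioi_mem_nhds he)).tendsto.comp h1
  have hle : ∀ a c, 0 < a → a ≤ c → ψ c - ψ a ≤ ∫ t in a..c, HH d m A B ψ t := by
    intro a c ha hac
    refine le_of_tendsto_of_tendsto' ((hlim c (by linarith)).sub_const (ψ a)) (bp_H_tendsto hHc ha hac) fun n => ?_
    have hb := bp_test (hδ n) ha hac
    have h1 := hel _ _ _ _ hb 1 one_pos (fun s hs _ t ht => add_nonneg (h.nonneg t)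
      (mul_nonneg hs.le (hb.tf0_nonneg d (bp_nonneg (hδ n) hac) ht)))
    have h2 := (bp_int h.anti (hδ n) ha hac).2
    linarith
  refine ⟨A, B, hA, hB, hle, fun a c ha hac hc => le_antisymm (hle a c ha hac) ?_⟩
  have hcp : 0 < c := by linarith
  refine le_of_tendsto_of_tendsto (bp_H_tendsto hHc ha hac) ((hlim a ha).const_sub (ψ c)) ?_
  filter_upwards [(hlim c hcp).eventually (lt_mem_nhds hc)] with n hn
  have hb := bp_test (hδ n) ha hac
  obtain ⟨M, hM0, hM⟩ := (hb.testF d).bdd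
  have h1 := hel _ _ _ _ hb.neg (ψ (c + 1 / ((n:ℝ) + 1)) / M) (by positivity) (fun s hs hs1 t ht => by
    rw [tf0_neg]
    rcases le_total (c + 1 / ((n:ℝ) + 1)) t with h3 | h3
    · rw [hb.tf0_zero d h3]; simpa using h.nonneg t
    · have h4 := h.anti (show t ∈ Set.Ioi (0:ℝ) from ht) (show c + 1 / ((n:ℝ) + 1) ∈ Set.Ioi (0:ℝ) from add_pos hcp (hδ n)) h3
      have h5 := (abs_le.1 (hM t ht.le)).2
      rw [lt_div_iff₀ hM0] at hs1
      nlinarith)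
  have h2 := (bp_int h.anti (hδ n) ha hac).1
  simp only [mul_neg, integral_neg] at h1
  linarith

end GNS

namespace GNS

lemma exists_pos {d : ℕ} (hd : 3 ≤ d) {m : ℝ} (hm : 0 < m) {ψ : ℝ → ℝ}
    (h : Rad d ψ) (hS : ∫⁻ x : Eu d, ENNReal.ofReal (ψ (‖x‖ ^ 2) ^ (m + 1)) = SS d (m + 1)) :
    ∃ t, 0 < t ∧ 0 < ψ t := by
  by_contra hc
  push Not at hc
  have hS0 : 0 < SS d (m+1) := SS_pos (by omega) hm
  rw [← hS] at hS0
  refine hS0.ne' ?_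
  rw [lintegral_eq_zero_iff' ?_]
  · filter_upwards [ae_sq_pos (d := d) (by omega)] with x hx
    have : ψ (‖x‖^2) = 0 := le_antisymm (hc _ hx) (h.nonneg _)
    simp only [Pi.zero_apply]
    rw [this, Real.zero_rpow (by linarith)]; simp
  · have := h.meas
    fun_prop

lemma HH_pos_of {d : ℕ} {m A B : ℝ} {ψ : ℝ → ℝ} {a c : ℝ} (hac : a < c) (ha : 0 < a)
    (hH : ContinuousOn (HH d m A B ψ) (Set.Ioi 0)) (hp : ∀ t ∈ Set.Icc a c, 0 < HH d m A B ψ t) :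
    0 < ∫ t in a..c, HH d m A B ψ t := by
  apply intervalIntegral.intervalIntegral_pos_of_pos_on _ (fun t ht => hp t ⟨ht.1.le, ht.2.le⟩) hac
  apply ContinuousOn.intervalIntegrable
  rw [Set.uIcc_of_le hac.le]
  exact hH.mono fun t ht => lt_of_lt_of_le ha ht.1

lemma HH_neg_of {d : ℕ} {m A B : ℝ} {ψ : ℝ → ℝ} {a c : ℝ} (hac : a < c) (ha : 0 < a)
    (hH : ContinuousOn (HH d m A B ψ) (Set.Ioi 0)) (hp : ∀ t ∈ Set.Icc a c, HH d m A B ψ t < 0) :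
    ∫ t in a..c, HH d m A B ψ t < 0 := by
  have : 0 < ∫ t in a..c, - HH d m A B ψ t := by
    apply intervalIntegral.intervalIntegral_pos_of_pos_on _ (fun t ht => neg_pos.2 (hp t ⟨ht.1.le, ht.2.le⟩)) hac
    apply ContinuousOn.intervalIntegrable
    rw [Set.uIcc_of_le hac.le]
    exact (hH.mono fun t ht => lt_of_lt_of_le ha ht.1).neg
  rw [intervalIntegral.integral_neg] at this
  linarith

lemma exists_zero {d : ℕ} (hd : 3 ≤ d) {m : ℝ} (hm : 0 < m) (hp2 : (m + 1) * ((d:ℝ) - 2) < 2 * d) {ψ : ℝ → ℝ}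
    (h : Rad d ψ) {A B : ℝ} (he : EL d m A B ψ) : ∃ t, 0 < t ∧ ψ t = 0 := by
  by_contra hc
  push Not at hc
  have hd0 : 0 < d := by omega
  have hd3 : (3:ℝ) ≤ d := by exact_mod_cast hd
  have hpos : ∀ t, 0 < t → 0 < ψ t := fun t ht => lt_of_le_of_ne (h.nonneg t) (hc t ht).symm
  have hlim : Filter.Tendsto (fun t => A - B * ψ t ^ m) Filter.atTop (nhds A) := by
    have h1 := (h.tendsto_zero hd0).rpow_const (p := m) (Or.inr hm.le)
    rw [Real.zero_rpow hm.ne'] at h1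
    simpa using (h1.const_mul B).const_sub A
  have hA := he.Apos
  obtain ⟨T0, hT0⟩ := Filter.eventually_atTop.1 (hlim.eventually (lt_mem_nhds (show A/2 < A by linarith)))
  set T := max T0 1
  have hT1 : 1 ≤ T := le_max_right _ _
  have hTp : 0 < T := by linarith
  have hq : ∀ t, T ≤ t → A/2 ≤ qq d m A B ψ t := by
    intro t ht
    have h1 := hT0 t ((le_max_left _ _).trans ht)
    have h2 : 1 ≤ t ^ ((d:ℝ)/2 - 1) := Real.one_le_rpow (hT1.trans ht) (by linarith)
    unfold qq
    nlinarith
  set Q0 := ∫ τ in (0:ℝ)..T, qq d m A B ψ τ with hQ0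
  have hQ : ∀ t, T ≤ t → Q0 + (A/2) * (t - T) ≤ ∫ τ in (0:ℝ)..t, qq d m A B ψ τ := by
    intro t ht
    have i1 := h.qq_int hd hm hp2 A B hTp
    have i2 := h.qq_int hd hm hp2 A B (hTp.trans_le ht)
    have i3 := i1.symm.trans i2
    rw [← intervalIntegral.integral_add_adjacent_intervals i1 i3]
    have : ∫ τ in T..t, A/2 ≤ ∫ τ in T..t, qq d m A B ψ τ :=
      intervalIntegral.integral_mono_on ht (by simp) i3 fun x hx => hq x hx.1
    rw [intervalIntegral.integral_const, smul_eq_mul] at this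
    linarith
  set T2 := T + (|Q0| + 1) / (A/2)
  have hT2 : T ≤ T2 := by
    have : 0 ≤ (|Q0| + 1) / (A/2) := by positivity
    simp only [T2]; linarith
  have hH : ∀ t ∈ Set.Icc T2 (T2 + 1), 0 < HH d m A B ψ t := by
    intro t ht
    have h1 := hQ t (hT2.trans ht.1)
    have h2 : (|Q0| + 1) ≤ A/2 * (t - T) := by
      have := ht.1
      have h3 : (|Q0| + 1) / (A/2) ≤ t - T := by simp only [T2] at this; linarith
      rw [div_le_iff₀ (by linarith)] at h3
      linarith
    have h3 := neg_abs_le Q0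
    unfold HH
    apply mul_pos (by linarith) (Real.rpow_pos_of_pos (by linarith [ht.1]) _)
  have h1 := HH_pos_of (by linarith) (by linarith) (HH_cont hd hm hp2 h A B) hH
  have h2 := he.eq T2 (T2 + 1) (by linarith) (by linarith) (hpos _ (by linarith))
  have h3 := h.anti (show T2 ∈ Set.Ioi (0:ℝ) from by simp; linarith) (show T2 + 1 ∈ Set.Ioi (0:ℝ) from by simp; linarith) (by linarith)
  linarith

/-- one step of the bootstrap -/
lemma boot_step {d : ℕ} (hd : 3 ≤ d) {m : ℝ} (hm : 0 < m) (hp2 : (m + 1) * ((d:ℝ) - 2) < 2 * d) {ψ : ℝ → ℝ}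
    (h : Rad d ψ) {A B : ℝ} (he : EL d m A B ψ) {t1 : ℝ} (ht1 : 0 < t1) (hψ1 : 0 < ψ t1)
    {C a s : ℝ} (hC : 0 < C) (hP : ∀ t, 0 < t → t ≤ t1 → ψ t ≤ C * t ^ (-a)) (ham : a * m < (d:ℝ)/2)
    (hs : a * m ≤ s + 1) :
    ∃ K, 0 ≤ K ∧ ∀ t, 0 < t → t ≤ t1 → ψ t ≤ ψ t1 + K * ∫ τ in t..t1, τ ^ (-(s+1)) := by
  have hA := he.Apos
  have hB := he.Bpos
  have hd3 : (3:ℝ) ≤ d := by exact_mod_cast hd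
  set K1 := B * C ^ m / ((d:ℝ)/2 - a * m)
  have hK1 : 0 ≤ K1 := by
    have : 0 < (d:ℝ)/2 - a * m := by linarith
    positivity
  have hH : ∀ t, 0 < t → t ≤ t1 → - HH d m A B ψ t ≤ K1 * t ^ (-(a * m)) := by
    intro t ht htt
    have i1 := h.qq_int hd hm hp2 A B ht
    have i2 : IntervalIntegrable (fun τ : ℝ => τ ^ ((d:ℝ)/2 - 1 - a * m)) volume 0 t :=
      intervalIntegral.intervalIntegrable_rpow' (by linarith)
    have h1 : ∫ τ in (0:ℝ)..t, (- qq d m A B ψ τ) ≤ ∫ τ in (0:ℝ)..t, B * C ^ m * τ ^ ((d:ℝ)/2 - 1 - a * m) := by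
      apply intervalIntegral.integral_mono_on_of_le_Ioo ht.le i1.neg (i2.const_mul _)
      intro τ hτ
      have hτ0 : 0 < τ := hτ.1
      have hp := hP τ hτ0 (hτ.2.le.trans htt)
      have h3 : ψ τ ^ m ≤ C ^ m * τ ^ (-(a*m)) := by
        calc ψ τ ^ m ≤ (C * τ ^ (-a)) ^ m := Real.rpow_le_rpow (h.nonneg τ) hp hm.le
          _ = _ := by
            rw [Real.mul_rpow hC.le (Real.rpow_nonneg hτ0.le _), ← Real.rpow_mul hτ0.le]
            congr 2; ring
      have h4 : 0 < τ ^ ((d:ℝ)/2 - 1) := Real.rpow_pos_of_pos hτ0 _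
      have h5 : τ ^ ((d:ℝ)/2 - 1 - a * m) = τ ^ (-(a*m)) * τ ^ ((d:ℝ)/2 - 1) := by
        rw [← Real.rpow_add hτ0]; congr 1; ring
      rw [h5]
      unfold qq
      have h6 : - (A - B * ψ τ ^ m) ≤ B * (C ^ m * τ ^ (-(a*m))) := by
        have := mul_le_mul_of_nonneg_left h3 hB.le
        linarith
      have := mul_le_mul_of_nonneg_right h6 h4.le
      simp only [Pi.neg_apply]
      linarith
    rw [intervalIntegral.integral_neg, intervalIntegral.integral_const_mul,
      integral_rpow (Or.inl (by linarith))] at h1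
    have e1 : (d:ℝ)/2 - 1 - a * m + 1 = (d:ℝ)/2 - a * m := by ring
    rw [e1, Real.zero_rpow (by linarith), sub_zero] at h1
    have h7 : 0 < t ^ (-(d:ℝ)/2) := Real.rpow_pos_of_pos ht _
    have h8 := mul_le_mul_of_nonneg_right h1 h7.le
    have h9 : t ^ (-(a*m)) = t ^ ((d:ℝ)/2 - a * m) * t ^ (-(d:ℝ)/2) := by
      rw [← Real.rpow_add ht]; congr 1; ring
    rw [h9]
    unfold HH
    simp only [K1]
    calc _ = -(∫ τ in (0:ℝ)..t, qq d m A B ψ τ) * t ^ (-(d:ℝ)/2) := by ring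
      _ ≤ _ := h8
      _ = _ := by ring
  refine ⟨K1 * t1 ^ (s + 1 - a * m), by positivity, fun t ht htt => ?_⟩
  have h1 := he.eq t t1 ht htt hψ1
  have hsub : Set.uIcc t t1 ⊆ Set.Ioi 0 := by
    rw [Set.uIcc_of_le htt]; exact fun x hx => lt_of_lt_of_le ht hx.1
  have i1 : IntervalIntegrable (fun τ => - HH d m A B ψ τ) volume t t1 :=
    (((HH_cont hd hm hp2 h A B).mono hsub).neg).intervalIntegrable
  have i2 : IntervalIntegrable (fun τ : ℝ => K1 * t1 ^ (s + 1 - a * m) * τ ^ (-(s+1))) volume t t1 :=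
    (((rpow_contOn _).mono hsub).const_mul _).intervalIntegrable
  have h2 : ∫ τ in t..t1, (- HH d m A B ψ τ) ≤ ∫ τ in t..t1, K1 * t1 ^ (s + 1 - a * m) * τ ^ (-(s+1)) := by
    apply intervalIntegral.integral_mono_on htt i1 i2
    intro τ hτ
    have hτ0 : 0 < τ := ht.trans_le hτ.1
    refine (hH τ hτ0 hτ.2).trans ?_
    have h3 : τ ^ (-(a * m)) = τ ^ (s + 1 - a * m) * τ ^ (-(s+1)) := by
      rw [← Real.rpow_add hτ0]; congr 1; ring
    rw [h3, mul_assoc]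
    have h4 : τ ^ (s + 1 - a * m) ≤ t1 ^ (s + 1 - a * m) := Real.rpow_le_rpow hτ0.le hτ.2 (by linarith)
    have h5 : 0 ≤ τ ^ (-(s+1)) := Real.rpow_nonneg hτ0.le _
    gcongr
  rw [intervalIntegral.integral_neg, intervalIntegral.integral_const_mul] at h2
  linarith

lemma boot_pos {ψ : ℝ → ℝ} {t1 : ℝ} (ht1 : 0 < t1) {s K : ℝ} (hs : 0 < s) (hK : 0 ≤ K) (h1 : 0 < ψ t1)
    (hb : ∀ t, 0 < t → t ≤ t1 → ψ t ≤ ψ t1 + K * ∫ τ in t..t1, τ ^ (-(s+1))) :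
    ∃ C, 0 < C ∧ ∀ t, 0 < t → t ≤ t1 → ψ t ≤ C * t ^ (-s) := by
  refine ⟨ψ t1 * t1 ^ s + K / s, by positivity, fun t ht htt => (hb t ht htt).trans ?_⟩
  have hz : (0:ℝ) ∉ Set.uIcc t t1 := by
    rw [Set.uIcc_of_le htt]; intro hx; linarith [hx.1]
  rw [integral_rpow (Or.inr ⟨by linarith, hz⟩)]
  have e : -(s+1) + 1 = -s := by ring
  rw [e]
  have h2 : 1 ≤ t1 ^ s * t ^ (-s) := by
    rw [Real.rpow_neg ht.le, ← div_eq_mul_inv, le_div_iff₀ (by positivity), one_mul]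
    exact Real.rpow_le_rpow ht.le htt hs.le
  have h3 : 0 ≤ t1 ^ (-s) := by positivity
  have h4 : (t1 ^ (-s) - t ^ (-s)) / -s ≤ t ^ (-s) / s := by
    rw [div_neg, ← neg_div]
    gcongr
    linarith
  have h5 := mul_le_mul_of_nonneg_left h4 hK
  have h6 := mul_le_mul_of_nonneg_left h2 h1.le
  calc _ ≤ ψ t1 * (t1 ^ s * t ^ (-s)) + K * (t ^ (-s) / s) := by linarith
    _ = _ := by ring

lemma boot_neg {ψ : ℝ → ℝ} {t1 : ℝ} (ht1 : 0 < t1) {s K : ℝ} (hs : s < 0) (hK : 0 ≤ K)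
    (hb : ∀ t, 0 < t → t ≤ t1 → ψ t ≤ ψ t1 + K * ∫ τ in t..t1, τ ^ (-(s+1))) :
    ∃ C, ∀ t, 0 < t → t ≤ t1 → ψ t ≤ C := by
  refine ⟨ψ t1 + K * (t1 ^ (-s) / (-s)), fun t ht htt => (hb t ht htt).trans ?_⟩
  rw [integral_rpow (Or.inl (by linarith))]
  have e : -(s+1) + 1 = -s := by ring
  rw [e]
  have hs' : 0 < -s := by linarith
  have h3 : 0 ≤ t ^ (-s) := by positivity
  gcongr
  linarith

lemma bounded {d : ℕ} (hd : 3 ≤ d) {m : ℝ} (hm : 0 < m) (hp2 : (m + 1) * ((d:ℝ) - 2) < 2 * d) {ψ : ℝ → ℝ}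
    (h : Rad d ψ) {A B : ℝ} (he : EL d m A B ψ) {t1 : ℝ} (ht1 : 0 < t1) (hψ1 : 0 < ψ t1) :
    ∃ C, ∀ t, 0 < t → ψ t ≤ C := by
  have hd3 : (3:ℝ) ≤ d := by exact_mod_cast hd
  suffices hh : ∃ C, ∀ t, 0 < t → t ≤ t1 → ψ t ≤ C by
    obtain ⟨C, hC⟩ := hh
    refine ⟨C, fun t ht => ?_⟩
    rcases le_total t t1 with h1 | h1
    · exact hC t ht h1
    · exact (h.anti (show t1 ∈ Set.Ioi 0 from ht1) (show t ∈ Set.Ioi 0 from ht) h1).trans (hC t1 ht1 le_rfl)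
  set a0 := ((d:ℝ) - 2)/4 with ha0
  have ha0p : 0 < a0 := by rw [ha0]; linarith
  have hg : a0 * (m - 1) < 1 := by rw [ha0]; linarith
  obtain ⟨N, hN⟩ := exists_nat_gt (a0 / min 1 (1 - a0 * (m - 1)))
  have hmin : 0 < min 1 (1 - a0 * (m - 1)) := lt_min one_pos (by linarith)
  set γ := a0 / ((N:ℝ) + 1/2) with hγ
  have hγ0 : 0 < γ := by positivity
  have hγN : γ * ((N:ℝ) + 1/2) = a0 := by rw [hγ]; field_simp
  have hγ1 : γ ≤ min 1 (1 - a0 * (m - 1)) := by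
    rw [div_lt_iff₀ hmin] at hN
    rw [hγ, div_le_iff₀ (by positivity)]
    nlinarith
  have hγa := hγ1.trans (min_le_left _ _)
  have hγb := hγ1.trans (min_le_right _ _)
  have hγc : ∀ a, 0 ≤ a → a ≤ a0 → a * m ≤ (a - γ) + 1 := by
    intro a h1 h2
    rcases le_total m 1 with h3 | h3
    · nlinarith
    · nlinarith
  have ham : ∀ a, 0 ≤ a → a ≤ a0 → a * m < (d:ℝ)/2 := by
    intro a h1 h2
    have : a * m ≤ a0 * m := by gcongr
    have h4 : a0 * m < (d:ℝ)/2 := by rw [ha0]; nlinarith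
    linarith
  have key : ∀ k : ℕ, k ≤ N → ∃ C, 0 < C ∧ ∀ t, 0 < t → t ≤ t1 → ψ t ≤ C * t ^ (-(a0 - k * γ)) := by
    intro k
    induction k with
    | zero =>
      intro _
      obtain ⟨C, hC, hC2⟩ := Rad.decay2 hd
      refine ⟨C, hC, fun t ht _ => (hC2 ψ h t ht).trans_eq ?_⟩
      congr 2
      rw [ha0]; push_cast; ring
    | succ k ih =>
      intro hk
      obtain ⟨C, hC, hP⟩ := ih (by omega)
      have hkN : (k:ℝ) + 1 ≤ N := by exact_mod_cast hk
      have h1 : 0 ≤ a0 - k * γ := by nlinarith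
      have h2 : a0 - k * γ ≤ a0 := by
        have : 0 ≤ k * γ := by positivity
        linarith
      obtain ⟨K, hK, hb⟩ := boot_step hd hm hp2 h he ht1 hψ1 hC hP (ham _ h1 h2) (hγc _ h1 h2)
      have h3 : 0 < a0 - k * γ - γ := by nlinarith
      obtain ⟨C', hC', hb'⟩ := boot_pos ht1 h3 hK hψ1 hb
      refine ⟨C', hC', fun t ht htt => (hb' t ht htt).trans_eq ?_⟩
      congr 2
      push_cast; ring
  obtain ⟨C, hC, hP⟩ := key N le_rfl
  have h1 : 0 ≤ a0 - N * γ := by nlinarith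
  have h2 : a0 - N * γ ≤ a0 := by
    have : 0 ≤ N * γ := by positivity
    linarith
  obtain ⟨K, hK, hb⟩ := boot_step hd hm hp2 h he ht1 hψ1 hC hP (ham _ h1 h2) (hγc _ h1 h2)
  exact boot_neg ht1 (by nlinarith) hK hb

lemma HH_lim {d : ℕ} (hd : 3 ≤ d) {m : ℝ} (hm : 0 < m) (hp2 : (m + 1) * ((d:ℝ) - 2) < 2 * d) {ψ : ℝ → ℝ}
    (h : Rad d ψ) {A B C : ℝ} (hB : 0 < B) (hC : ∀ t, 0 < t → ψ t ≤ C) :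
    ∃ l, Filter.Tendsto (HH d m A B ψ) (nhdsWithin 0 (Set.Ioi 0)) (nhds l) := by
  have hd3 : (3:ℝ) ≤ d := by exact_mod_cast hd
  set p : ℝ → ℝ := fun t => A - B * ψ t ^ m
  have hmono : MonotoneOn p (Set.Ioi 0) := by
    intro a ha b hb hab
    have h1 := Real.rpow_le_rpow (h.nonneg b) (h.anti ha hb hab) hm.le
    have := mul_le_mul_of_nonneg_left h1 hB.le
    simp only [p]; linarith
  have hbdd : BddBelow (p '' Set.Ioi 0) := by
    refine ⟨A - B * C ^ m, ?_⟩
    rintro _ ⟨t, ht, rfl⟩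
    have h1 := Real.rpow_le_rpow (h.nonneg t) (hC t ht) hm.le
    have := mul_le_mul_of_nonneg_left h1 hB.le
    simp only [p]; linarith
  have hp := hmono.tendsto_nhdsGT hbdd
  set p0 := sInf (p '' Set.Ioi 0)
  have hp0 : ∀ t, 0 < t → p0 ≤ p t := fun t ht => csInf_le hbdd ⟨t, ht, rfl⟩
  have hI : ∀ t c : ℝ, 0 < t → (∫ τ in (0:ℝ)..t, c * τ ^ ((d:ℝ)/2 - 1)) * t ^ (-(d:ℝ)/2) = c * (2/d) := by
    intro t c ht
    rw [intervalIntegral.integral_const_mul, integral_rpow (Or.inl (by linarith))]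
    have e1 : (d:ℝ)/2 - 1 + 1 = (d:ℝ)/2 := by ring
    rw [e1, Real.zero_rpow (by linarith), sub_zero]
    have h9 : t ^ ((d:ℝ)/2) * t ^ (-(d:ℝ)/2) = 1 := by
      rw [← Real.rpow_add ht]; convert Real.rpow_zero t using 2; ring
    calc _ = c * (2/d) * (t ^ ((d:ℝ)/2) * t ^ (-(d:ℝ)/2)) := by field_simp
      _ = _ := by rw [h9, mul_one]
  have i3 : ∀ t c : ℝ, IntervalIntegrable (fun τ : ℝ => c * τ ^ ((d:ℝ)/2 - 1)) volume 0 t := fun t c =>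
    (intervalIntegral.intervalIntegrable_rpow' (by linarith)).const_mul _
  refine ⟨p0 * (2/d), tendsto_of_tendsto_of_tendsto_of_le_of_le' tendsto_const_nhds (hp.mul_const (2/(d:ℝ))) ?_ ?_⟩
  · filter_upwards [self_mem_nhdsWithin] with t ht
    have ht : 0 < t := ht
    rw [← hI t p0 ht]
    unfold HH
    refine mul_le_mul_of_nonneg_right ?_ (Real.rpow_nonneg ht.le _)
    apply intervalIntegral.integral_mono_on_of_le_Ioo ht.le (i3 t _) (h.qq_int hd hm hp2 A B ht)
    intro τ hτ
    exact mul_le_mul_of_nonneg_right (hp0 τ hτ.1) (Real.rpow_nonneg hτ.1.le _)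
  · filter_upwards [self_mem_nhdsWithin] with t ht
    have ht : 0 < t := ht
    rw [← hI t (p t) ht]
    unfold HH
    refine mul_le_mul_of_nonneg_right ?_ (Real.rpow_nonneg ht.le _)
    apply intervalIntegral.integral_mono_on_of_le_Ioo ht.le (h.qq_int hd hm hp2 A B ht) (i3 t _)
    intro τ hτ
    exact mul_le_mul_of_nonneg_right (hmono hτ.1 ht hτ.2.le) (Real.rpow_nonneg hτ.1.le _)

theorem regular {d : ℕ} (hd : 3 ≤ d) {m : ℝ} (hm : 0 < m) (hp2 : (m + 1) * ((d:ℝ) - 2) < 2 * d) {ψ : ℝ → ℝ}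
    (h : Rad d ψ) (hS : ∫⁻ x : Eu d, ENNReal.ofReal (ψ (‖x‖ ^ 2) ^ (m + 1)) = SS d (m + 1)) :
    ∃ (Ψ K : ℝ → ℝ) (R : ℝ), (∀ t, HasDerivAt Ψ (K t) t) ∧ Continuous K ∧ 0 < R ∧ (∀ t, R ≤ t → Ψ t = 0) ∧
      (∀ t, 0 < t → Ψ t = ψ t) := by
  have hd0 : 0 < d := by omega
  obtain ⟨A, B, he⟩ := el_exists hd hm hp2 h hS
  obtain ⟨t1, ht1, hψ1⟩ := exists_pos hd hm h hS
  obtain ⟨t2, ht2, hψ2⟩ := exists_zero hd hm hp2 h he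
  obtain ⟨C, hC⟩ := bounded hd hm hp2 h he ht1 hψ1
  obtain ⟨l, hl⟩ := HH_lim (A := A) hd hm hp2 h he.Bpos hC
  have hHc := HH_cont hd hm hp2 h A B
  have hψc := h.cont hd0
  set Z : Set ℝ := {t | 0 < t ∧ 0 < ψ t}
  have hZb : BddAbove Z := by
    refine ⟨t2, fun t ht => ?_⟩
    by_contra hlt
    have := h.anti (show t2 ∈ Set.Ioi 0 from ht2) (show t ∈ Set.Ioi 0 from ht.1) (not_le.1 hlt).le
    linarith [ht.2]
  set R := sSup Z
  have ht1Z : t1 ∈ Z := ⟨ht1, hψ1⟩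
  have hR : 0 < R := ht1.trans_le (le_csSup hZb ht1Z)
  have hlt : ∀ t, 0 < t → t < R → 0 < ψ t := by
    intro t ht htR
    obtain ⟨s, hs, hts⟩ := exists_lt_of_lt_csSup ⟨t1, ht1Z⟩ htR
    exact hs.2.trans_le (h.anti (show t ∈ Set.Ioi 0 from ht) (show s ∈ Set.Ioi 0 from hs.1) hts.le)
  have hgt : ∀ t, R < t → ψ t = 0 := by
    intro t ht
    by_contra hne
    have : t ∈ Z := ⟨hR.trans ht, lt_of_le_of_ne (h.nonneg t) (Ne.symm hne)⟩
    exact not_le.2 ht (le_csSup hZb this)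
  have hRc : ContinuousAt ψ R := hψc.continuousAt (Ioi_mem_nhds hR)
  have hψR : ψ R = 0 := by
    have h1 : Filter.Tendsto ψ (nhdsWithin R (Set.Ioi R)) (nhds (ψ R)) := hRc.tendsto.mono_left nhdsWithin_le_nhds
    have h2 : Filter.Tendsto ψ (nhdsWithin R (Set.Ioi R)) (nhds 0) := by
      apply tendsto_const_nhds.congr'
      filter_upwards [self_mem_nhdsWithin] with t ht
      exact (hgt t ht).symm
    exact tendsto_nhds_unique h1 h2
  have hge : ∀ t, R ≤ t → ψ t = 0 := by
    intro t ht
    rcases ht.eq_or_lt with rfl | h1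
    · exact hψR
    · exact hgt t h1
  have hii : ∀ a c, 0 < a → 0 < c → IntervalIntegrable (HH d m A B ψ) volume a c := by
    intro a c ha hc
    apply ContinuousOn.intervalIntegrable
    apply hHc.mono
    intro x hx
    exact (lt_min ha hc).trans_le hx.1
  have heq : ∀ a, 0 < a → a < R → ψ R - ψ a = ∫ t in a..R, HH d m A B ψ t := by
    intro a ha haR
    have h1 : Filter.Tendsto (fun c => ψ c - ψ a) (nhdsWithin R (Set.Iio R)) (nhds (ψ R - ψ a)) :=
      (hRc.tendsto.mono_left nhdsWithin_le_nhds).sub_const _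
    have hder : HasDerivAt (fun c => ∫ t in a..c, HH d m A B ψ t) (HH d m A B ψ R) R :=
      intervalIntegral.integral_hasDerivAt_right (hii a R ha hR)
        (hHc.stronglyMeasurableAtFilter isOpen_Ioi R hR) (hHc.continuousAt (Ioi_mem_nhds hR))
    have h2 : Filter.Tendsto (fun c => ψ c - ψ a) (nhdsWithin R (Set.Iio R)) (nhds (∫ t in a..R, HH d m A B ψ t)) := by
      refine Filter.Tendsto.congr' ?_ (hder.continuousAt.tendsto.mono_left nhdsWithin_le_nhds)
      filter_upwards [Ioo_mem_nhdsLT haR] with c hc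
      exact (he.eq a c ha hc.1.le (hlt c (ha.trans hc.1) hc.2)).symm
    exact tendsto_nhds_unique h1 h2
  have hHR : HH d m A B ψ R = 0 := by
    have hc : ContinuousAt (HH d m A B ψ) R := hHc.continuousAt (Ioi_mem_nhds hR)
    rcases lt_trichotomy (HH d m A B ψ R) 0 with hneg | hz | hpos
    · exfalso
      obtain ⟨e, he0, hee⟩ := Metric.eventually_nhds_iff.1 (hc.eventually (gt_mem_nhds hneg))
      have h1 := HH_neg_of (a := R) (c := R + e/2) (by linarith) hR hHc (fun t ht => hee (by
        rw [Real.dist_eq, abs_lt]; constructor <;> linarith [ht.1, ht.2]))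
      have h2 := he.le R (R + e/2) hR (by linarith)
      rw [hψR, hge (R + e/2) (by linarith)] at h2
      linarith
    · exact hz
    · exfalso
      obtain ⟨e, he0, hee⟩ := Metric.eventually_nhds_iff.1 (hc.eventually (lt_mem_nhds hpos))
      set a := max (R - e/2) (R/2)
      have ha1 : R - e/2 ≤ a := le_max_left _ _
      have ha2 : R/2 ≤ a := le_max_right _ _
      have ha3 : a < R := max_lt (by linarith) (by linarith)
      have h1 := HH_pos_of (a := a) (c := R) ha3 (by linarith) hHc (fun t ht => hee (by
        rw [Real.dist_eq, abs_lt]; constructor <;> linarith [ht.1, ht.2]))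
      have h2 := heq a (by linarith) ha3
      have h3 := h.nonneg a
      linarith
  set K : ℝ → ℝ := fun t => if t ≤ 0 then l else if t ≤ R then HH d m A B ψ t else 0 with hK
  have hKgt : ∀ x, R < x → K x = 0 := by
    intro x hx
    simp only [hK]
    rw [if_neg (not_le.2 (hR.trans hx)), if_neg (not_le.2 hx)]
  have hKmid : ∀ x, 0 < x → x ≤ R → K x = HH d m A B ψ x := by
    intro x hx hxR
    simp only [hK]
    rw [if_neg (not_le.2 hx), if_pos hxR]
  have hKc : Continuous K := by
    rw [continuous_iff_continuousAt]
    intro t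
    rcases lt_trichotomy t 0 with h1 | h1 | h1
    · have : K =ᶠ[nhds t] fun _ => l := by
        filter_upwards [Iio_mem_nhds h1] with x hx
        simp [hK, (show x < 0 from hx).le]
      exact this.continuousAt
    · subst h1
      rw [continuousAt_iff_continuous_left'_right']
      have hK0 : K 0 = l := by simp [hK]
      constructor
      · unfold ContinuousWithinAt
        rw [hK0]
        apply tendsto_const_nhds.congr'
        filter_upwards [self_mem_nhdsWithin] with x hx
        simp [hK, (show x < 0 from hx).le]
      · unfold ContinuousWithinAt
        rw [hK0]
        apply hl.congr'
        filter_upwards [Ioo_mem_nhdsGT hR] with x hx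
        simp [hK, hx.1, hx.2.le]
    · rcases lt_trichotomy t R with h2 | h2 | h2
      · have : K =ᶠ[nhds t] HH d m A B ψ := by
          filter_upwards [Ioo_mem_nhds h1 h2] with x hx
          simp [hK, hx.1, hx.2.le]
        exact (hHc.continuousAt (Ioi_mem_nhds h1)).congr this.symm
      · rw [h2, continuousAt_iff_continuous_left'_right']
        have hKR : K R = HH d m A B ψ R := by simp [hK, hR]
        constructor
        · unfold ContinuousWithinAt
          rw [hKR]
          apply ((hHc.continuousAt (Ioi_mem_nhds hR)).tendsto.mono_left nhdsWithin_le_nhds).congr'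
          filter_upwards [Ioo_mem_nhdsLT hR] with x hx
          simp [hK, hx.1, hx.2.le]
        · unfold ContinuousWithinAt
          rw [hKR, hHR]
          apply tendsto_const_nhds.congr'
          filter_upwards [self_mem_nhdsWithin] with x hx
          exact (hKgt x hx).symm
      · have : K =ᶠ[nhds t] fun _ => 0 := by
          filter_upwards [Ioi_mem_nhds h2] with x hx
          exact hKgt x hx
        exact this.continuousAt
  have hzero : ∀ t, R ≤ t → ∫ τ in R..t, K τ = 0 := by
    intro t ht
    rw [intervalIntegral.integral_of_le ht]
    apply setIntegral_eq_zero_of_forall_eq_zero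
    intro x hx
    exact hKgt x hx.1
  refine ⟨fun t => ∫ τ in R..t, K τ, K, R, fun t => ?_, hKc, hR, fun t ht => ?_, fun t ht => ?_⟩
  · exact intervalIntegral.integral_hasDerivAt_right (hKc.intervalIntegrable _ _)
      (hKc.stronglyMeasurableAtFilter _ _) hKc.continuousAt
  · exact hzero t ht
  · rcases le_or_gt R t with h1 | h1
    · rw [hge t h1]; exact hzero t h1
    · have h2 := heq t ht h1
      have h3 : ∫ τ in t..R, K τ = ∫ τ in t..R, HH d m A B ψ τ := by
        apply intervalIntegral.integral_congr
        intro τ hτ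
        rw [Set.uIcc_of_le h1.le] at hτ
        exact hKmid τ (ht.trans_le hτ.1) hτ.2
      simp only
      rw [intervalIntegral.integral_symm, h3, ← h2, hψR]; ring

end GNS

namespace GNS

lemma gn_real {d : ℕ} (hd : 0 < d) {m : ℝ} (hm : 0 < m) (hSf : SS d (m + 1) ≠ ⊤) {u : Eu d → ℝ}
    (hu0 : ∀ x, 0 ≤ u x) (hu : ContDiff ℝ 1 u) (i1 : Integrable u) (i2 : Integrable (fun x => ‖gradient u x‖ ^ 2))
    (i3 : Integrable (fun x => u x ^ (m + 1))) {a δ : ℝ} (ha : 0 < a) (hδ : 0 < δ) (h1 : ∫ x, u x ≤ a)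
    (h2 : kap d * ∫ x, ‖gradient u x‖ ^ 2 ≤ δ) :
    ∫ x, u x ^ (m + 1) ≤ (SS d (m + 1)).toReal * (a ^ (m + 1 - 2 * th d m) * δ ^ th d m) := by
  have hk := kap_pos hd
  have e1 : ∫⁻ x, ENNReal.ofReal (u x) ≤ ENNReal.ofReal a := by
    rw [← ofReal_integral_eq_lintegral_ofReal i1 (Filter.Eventually.of_forall hu0)]
    exact ENNReal.ofReal_le_ofReal h1
  have e2 : Dir u ≤ ENNReal.ofReal δ := by
    refine (Dir_le_grad hd hu).trans ?_
    rw [← ofReal_integral_eq_lintegral_ofReal (i2.const_mul _)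
      (Filter.Eventually.of_forall fun x => by positivity), integral_const_mul]
    exact ENNReal.ofReal_le_ofReal h2
  have h := gn_scale hd hm hu.continuous.measurable hu0 ha hδ e1 e2
  rw [← ofReal_integral_eq_lintegral_ofReal i3 (Filter.Eventually.of_forall fun x => Real.rpow_nonneg (hu0 x) _),
    ← ENNReal.ofReal_toReal hSf, ← ENNReal.ofReal_mul ENNReal.toReal_nonneg] at h
  exact (ENNReal.ofReal_le_ofReal_iff (by positivity)).1 h

/-- The regularized maximizer. -/
theorem maximizer {d : ℕ} (hd : 3 ≤ d) {m : ℝ} (hm : 0 < m) (hp2 : (m + 1) * ((d:ℝ) - 2) < 2 * d) :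
    ∃ V : Eu d → ℝ, (∀ x, 0 ≤ V x) ∧ ContDiff ℝ 1 V ∧ Integrable V ∧
      Integrable (fun x => ‖gradient V x‖ ^ 2) ∧ Integrable (fun x => V x ^ (m + 1)) ∧
      HasCompactSupport V ∧ (∃ φ : ℝ → ℝ, (∀ x, V x = φ ‖x‖) ∧ AntitoneOn φ (Set.Ici 0)) ∧
      SS d (m + 1) ≠ ⊤ ∧ ∫ x, V x ^ (m + 1) = (SS d (m + 1)).toReal ∧ ∫ x, V x ≤ 1 ∧
      kap d * ∫ x, ‖gradient V x‖ ^ 2 ≤ 1 := by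
  have hd0 : 0 < d := by omega
  obtain ⟨ψ, h, hS⟩ := exists_max hd (p := m + 1) (by linarith) hp2
  obtain ⟨Ψ, K, R, hder, hK, hR, hz, heq⟩ := regular hd hm hp2 h hS
  have hΨc : Continuous Ψ := continuous_iff_continuousAt.2 fun t => (hder t).continuousAt
  have hanti : AntitoneOn Ψ (Set.Ici 0) := by
    intro a ha b hb hab
    have ha : 0 ≤ a := ha
    rcases ha.eq_or_lt with h0 | h0
    · rcases hab.eq_or_lt with h1 | h1
      · rw [h1]
      · have hb0 : 0 < b := by linarith
        have hl : Filter.Tendsto Ψ (nhdsWithin 0 (Set.Ioi 0)) (nhds (Ψ 0)) := hΨc.continuousAt.tendsto.mono_left nhdsWithin_le_nhds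
        rw [← h0]
        apply ge_of_tendsto hl
        filter_upwards [Ioo_mem_nhdsGT hb0] with t ht
        rw [heq b hb0, heq t ht.1]
        exact h.anti (show t ∈ Set.Ioi 0 from ht.1) (show b ∈ Set.Ioi 0 from hb0) ht.2.le
    · have hb0 : 0 < b := by linarith
      rw [heq b hb0, heq a h0]
      exact h.anti (show a ∈ Set.Ioi 0 from h0) (show b ∈ Set.Ioi 0 from hb0) hab
  have hnn : ∀ t, 0 ≤ t → 0 ≤ Ψ t := by
    intro t ht
    rcases le_total R t with h1 | h1
    · rw [hz t h1]
    · have := hanti ht (show R ∈ Set.Ici 0 from hR.le) h1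
      rwa [hz R le_rfl] at this
  have hΨd : ContDiff ℝ 1 Ψ := by
    rw [contDiff_one_iff_deriv]
    refine ⟨fun t => (hder t).differentiableAt, ?_⟩
    have : deriv Ψ = K := by ext t; exact (hder t).deriv
    rw [this]; exact hK
  set V : Eu d → ℝ := fun x => Ψ (‖x‖ ^ 2) with hV
  have hV0 : ∀ x, 0 ≤ V x := fun x => hnn _ (by positivity)
  have hVd : ContDiff ℝ 1 V := hΨd.comp (contDiff_norm_sq ℝ)
  have hVz : ∀ x, x ∉ Metric.closedBall (0 : Eu d) (Real.sqrt R) → V x = 0 := by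
    intro x hx
    apply hz
    rw [mem_closedBall_zero_iff, not_le] at hx
    exact (Real.lt_sq_of_sqrt_lt hx).le
  have hcs : HasCompactSupport V := HasCompactSupport.intro (isCompact_closedBall _ _) hVz
  have hVae : V =ᵐ[volume] fun x => ψ (‖x‖ ^ 2) := by
    filter_upwards [ae_sq_pos (d := d) hd0] with x hx
    exact heq _ hx
  have i1 : Integrable V := hVd.continuous.integrable_of_hasCompactSupport hcs
  have i3 : Integrable (fun x => V x ^ (m + 1)) := by
    refine (h.pow_int hd (p := m + 1) (by linarith) hp2).congr ?_
    filter_upwards [hVae] with x hx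
    rw [hx]
  have hgz : ∀ x : Eu d, x ∉ tsupport V → gradient V x = 0 := by
    intro x hx
    have : V =ᶠ[nhds x] fun _ => 0 := by
      filter_upwards [(isClosed_tsupport V).isOpen_compl.mem_nhds hx] with y hy
      exact image_eq_zero_of_notMem_tsupport hy
    rw [gradient, this.fderiv_eq]; simp
  have i2 : Integrable (fun x => ‖gradient V x‖ ^ 2) := by
    apply Continuous.integrable_of_hasCompactSupport ((gradient_cont hVd).norm.pow 2)
    apply HasCompactSupport.intro hcs
    intro x hx
    simp [hgz x hx]
  have hb : ENNReal.ofReal (∫ x, V x ^ (m + 1)) = SS d (m + 1) := by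
    rw [ofReal_integral_eq_lintegral_ofReal i3 (Filter.Eventually.of_forall fun x => Real.rpow_nonneg (hV0 x) _), ← hS]
    apply lintegral_congr_ae
    filter_upwards [hVae] with x hx
    rw [hx]
  refine ⟨V, hV0, hVd, i1, i2, i3, hcs, ⟨fun r => Ψ (r ^ 2), fun x => rfl, ?_⟩, ?_, ?_, ?_, ?_⟩
  · intro a ha b hb hab
    have ha : 0 ≤ a := ha
    exact hanti (show a ^ 2 ∈ Set.Ici 0 from by simp; positivity) (show b ^ 2 ∈ Set.Ici 0 from by simp; positivity) (by gcongr)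
  · rw [← hb]; exact ENNReal.ofReal_ne_top
  · rw [← hb, ENNReal.toReal_ofReal (integral_nonneg fun x => Real.rpow_nonneg (hV0 x) _)]
  · rw [← ENNReal.ofReal_le_one, ofReal_integral_eq_lintegral_ofReal i1 (Filter.Eventually.of_forall hV0)]
    refine le_trans (le_of_eq ?_) h.int
    apply lintegral_congr_ae
    filter_upwards [hVae] with x hx
    rw [hx]
  · have hk := kap_pos hd0
    rw [← ENNReal.ofReal_le_one, ← integral_const_mul, ofReal_integral_eq_lintegral_ofReal (i2.const_mul _)
      (Filter.Eventually.of_forall fun x => by positivity)]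
    refine (grad_le_Dir hd0 hVd).trans ?_
    rw [Dir_congr hVae]
    exact h.dir

end GNS

theorem gns_extremal_exists (d : ℕ) (hd : 3 ≤ d) (m : ℝ) (hm0 : 0 < m)
    (hm1 : m < ((d : ℝ) + 2) / ((d : ℝ) - 2))
    (α : ℝ) (hα : α = ((d : ℝ) + 2 - ((d : ℝ) - 2) * m) / ((d : ℝ) * m)) :
    ∃ V : EuclideanSpace ℝ (Fin d) → ℝ,
      (∀ x, 0 ≤ V x) ∧ ContDiff ℝ 1 V ∧ Integrable V ∧
      Integrable (fun x => ‖gradient V x‖ ^ 2) ∧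
      Integrable (fun x => V x ^ (m + 1)) ∧
      HasCompactSupport V ∧
      (∃ x, V x ≠ 0) ∧
      (∃ φ : ℝ → ℝ, (∀ x, V x = φ ‖x‖) ∧ AntitoneOn φ (Set.Ici 0)) ∧
      ∀ u : EuclideanSpace ℝ (Fin d) → ℝ,
        (∀ x, 0 ≤ u x) → ContDiff ℝ 1 u →
        Integrable u → Integrable (fun x => ‖gradient u x‖ ^ 2) →
        Integrable (fun x => u x ^ (m + 1)) →
        ¬ (u =ᵐ[volume] 0) → 0 < ∫ x, ‖gradient u x‖ ^ 2 →
        (∫ x, u x ^ (m + 1)) ^ ((α + 2) / (m + 1)) /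
            ((∫ x, u x) ^ α * ∫ x, ‖gradient u x‖ ^ 2) ≤
          (∫ x, V x ^ (m + 1)) ^ ((α + 2) / (m + 1)) /
            ((∫ x, V x) ^ α * ∫ x, ‖gradient V x‖ ^ 2) := by
  have hd0 : 0 < d := by omega
  have hd3 : (3:ℝ) ≤ d := by exact_mod_cast hd
  have hm2 : m * ((d:ℝ) - 2) < d + 2 := by rwa [lt_div_iff₀ (by linarith)] at hm1
  have hp2 : (m + 1) * ((d:ℝ) - 2) < 2 * d := by linarith
  have hα0 : 0 < α := by
    rw [hα]; apply div_pos (by linarith) (by positivity)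
  set θ := GNS.th d m with hθ
  have hθ0 : 0 < θ := by rw [hθ, GNS.th]; positivity
  have e1 : (α + 2) / (m + 1) = 1 / θ := by
    rw [hα, hθ, GNS.th]; field_simp; ring
  have e2 : m + 1 - 2 * θ = α * θ := by
    rw [hα, hθ, GNS.th]; field_simp; ring
  have hk := GNS.kap_pos hd0
  obtain ⟨V, hV0, hVd, i1, i2, i3, hcs, hφ, hSf, hb, ha, hG⟩ := GNS.maximizer hd hm0 hp2
  set S := (GNS.SS d (m + 1)).toReal with hSdef
  have hS0 : 0 < S := ENNReal.toReal_pos (GNS.SS_pos hd0 hm0).ne' hSf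
  have hne : ∃ x, V x ≠ 0 := by
    by_contra hc
    push Not at hc
    have : ∫ x, V x ^ (m + 1) = 0 := by
      simp only [hc]
      rw [Real.zero_rpow (by linarith)]; simp
    linarith
  have haV : 0 < ∫ x, V x := by
    refine lt_of_le_of_ne (integral_nonneg hV0) fun h0 => ?_
    have h1 := (integral_eq_zero_iff_of_nonneg hV0 i1).1 h0.symm
    have : ∫ x, V x ^ (m + 1) = 0 := by
      apply integral_eq_zero_of_ae
      filter_upwards [h1] with x hx
      rw [hx]; simp only [Pi.zero_apply]
      rw [Real.zero_rpow (by linarith)]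
    linarith
  have hGV : 0 < ∫ x, ‖gradient V x‖ ^ 2 := by
    refine lt_of_le_of_ne (integral_nonneg fun x => by positivity) fun h0 => ?_
    have h1 := GNS.gn_real hd0 hm0 hSf hV0 hVd i1 i2 i3 (a := 1) (δ := 1/2) one_pos (by norm_num) ha
      (by rw [← h0]; norm_num)
    rw [hb, Real.one_rpow, one_mul] at h1
    have h2 : ((1:ℝ)/2) ^ θ < 1 := Real.rpow_lt_one (by norm_num) (by norm_num) hθ0
    nlinarith
  refine ⟨V, hV0, hVd, i1, i2, i3, hcs, hne, hφ, fun u hu0 hu j1 j2 j3 hun hGu => ?_⟩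
  have hau : 0 < ∫ x, u x := by
    refine lt_of_le_of_ne (integral_nonneg hu0) fun h0 => hun ?_
    exact (integral_eq_zero_iff_of_nonneg hu0 j1).1 h0.symm
  have h1 := GNS.gn_real hd0 hm0 hSf hu0 hu j1 j2 j3 hau (mul_pos hk hGu) le_rfl le_rfl
  rw [← hθ, e2] at h1
  rw [e1, hb]
  set a := ∫ x, u x
  set G := ∫ x, ‖gradient u x‖ ^ 2
  set b := ∫ x, u x ^ (m + 1)
  set aV := ∫ x, V x
  set GV := ∫ x, ‖gradient V x‖ ^ 2
  have hb0 : 0 ≤ b := integral_nonneg fun x => Real.rpow_nonneg (hu0 x) _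
  have hT : 0 < S ^ (1/θ) := Real.rpow_pos_of_pos hS0 _
  have h2 : b ^ (1/θ) ≤ S ^ (1/θ) * (a ^ α * (GNS.kap d * G)) := by
    refine (Real.rpow_le_rpow hb0 h1 (by positivity)).trans_eq ?_
    rw [Real.mul_rpow hS0.le (by positivity), Real.mul_rpow (by positivity) (by positivity),
      ← Real.rpow_mul hau.le, ← Real.rpow_mul (by positivity)]
    have e3 : α * θ * (1/θ) = α := by field_simp
    have e4 : θ * (1/θ) = 1 := by field_simp
    rw [e3, e4, Real.rpow_one]
  have h3 : b ^ (1/θ) / (a ^ α * G) ≤ GNS.kap d * S ^ (1/θ) := by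
    rw [div_le_iff₀ (by positivity)]
    linarith
  refine h3.trans ?_
  rw [le_div_iff₀ (by positivity)]
  have h4 : aV ^ α ≤ 1 := Real.rpow_le_one haV.le ha hα0.le
  have h5 : aV ^ α * (GNS.kap d * GV) ≤ 1 := mul_le_one₀ h4 (by positivity) hG
  calc _ = S ^ (1/θ) * (aV ^ α * (GNS.kap d * GV)) := by ring
    _ ≤ S ^ (1/θ) * 1 := by gcongr
    _ = _ := mul_one _
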